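/- Localization principle for the Kobayashi–Royden metric: Let D be a domain in ℝ^{2n} and J a smooth almost complex structure on a neighborhood of the closure of D. Let p ∈ closure(D) and let U be a neighborhood of p (not necessarily contained in D) for which there exist: a diffeomorphism z : U → 𝔹 (the unit ball of ℝ^{2n}) with z(p) = 0; a real number 0 < r < 1 and a smooth nondecreasing function θ_r : [0,∞) → ℝ with θ_r(s) = s for s ≤ r/3 and θ_r(s) = 1 for s ≥ 2r/3; and constants A, B > 0 such that the function log(θ_r(|z(·)|²)) + θ_r(A|z(·)|) + B|z(·)|² is J-plurisubharmonic on U. Let u be a C² function on the closure of D, negative and J-plurisubharmonic on D, such that −L ≤ u < 0 on D ∩ U and u − c|z(·)|² is J-plurisubharmonic on D ∩ U, where c and L are positive constants. Then there exist a constant s > 0 and a neighborhood V of p relatively compact in U, depending only on c and L (and on the data above), such that K_{(D,J)}(q,v) ≥ s·K_{(D∩U,J)}(q,v) for every q ∈ D ∩ V and every v ∈ ℝ^{2n}. -/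

import Mathlib

open Complex Metric Set MeasureTheory Filter Topology Bornology ENNReal

noncomputable section

/-- We identify `ℝ^{2n}` with `ℂⁿ` (with the Euclidean norm). -/
abbrev Cn (n : ℕ) : Type := EuclideanSpace ℂ (Fin n)

/-- The standard complex structure on `ℂⁿ ≅ ℝ^{2n}`: multiplication by `i`,
viewed as an `ℝ`-linear map. -/
def Jstd (n : ℕ) : Cn n →L[ℝ] Cn n :=
  ContinuousLinearMap.restrictScalars ℝ (Complex.I • ContinuousLinearMap.id ℂ (Cn n))

/-- The standard complex structure on `ℂ ≅ ℝ²`. -/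
def JstdC : ℂ →L[ℝ] ℂ :=
  ContinuousLinearMap.restrictScalars ℝ (Complex.I • ContinuousLinearMap.id ℂ ℂ)

/-- `J` is a (smooth) almost complex structure on the set `Ω ⊆ ℂⁿ ≅ ℝ^{2n}`:
a `C^∞` field of linear automorphisms with `J(x) ∘ J(x) = -Id`. -/
def IsACS {n : ℕ} (Ω : Set (Cn n)) (J : Cn n → Cn n →L[ℝ] Cn n) : Prop :=
  ContDiffOn ℝ (⊤ : ℕ∞) J Ω ∧ ∀ x ∈ Ω, (J x).comp (J x) = -ContinuousLinearMap.id ℝ (Cn n)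

/-- The open unit disc `Δ` in `ℂ`. -/
def unitDisc : Set ℂ := Metric.ball 0 1

/-- A map between (subsets of) almost complex spaces is `(J,J')`-holomorphic on `s` if
`df_x ∘ J(x) = J'(f(x)) ∘ df_x` on `s`. -/
def PseudoHolOn {n m : ℕ} (J : Cn n → Cn n →L[ℝ] Cn n) (J' : Cn m → Cn m →L[ℝ] Cn m)
    (f : Cn n → Cn m) (s : Set (Cn n)) : Prop :=
  ∀ x ∈ s, DifferentiableAt ℝ f x ∧
    (fderiv ℝ f x).comp (J x) = (J' (f x)).comp (fderiv ℝ f x)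

/-- A map from an open subset of `ℂ` is `J`-holomorphic on `s` if
`df_ζ ∘ J_st = J(f(ζ)) ∘ df_ζ` on `s`. -/
def JHolOn {n : ℕ} (J : Cn n → Cn n →L[ℝ] Cn n) (f : ℂ → Cn n) (s : Set ℂ) : Prop :=
  ∀ ζ ∈ s, DifferentiableAt ℝ f ζ ∧
    (fderiv ℝ f ζ).comp JstdC = (J (f ζ)).comp (fderiv ℝ f ζ)

/-- A `J`-holomorphic disc in `D`. -/
def JDisc {n : ℕ} (J : Cn n → Cn n →L[ℝ] Cn n) (D : Set (Cn n)) (f : ℂ → Cn n) : Prop :=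
  MapsTo f unitDisc D ∧ JHolOn J f unitDisc

/-- The nonnegative part of an extended real number, as an element of `ℝ≥0∞`. -/
def erealPos (x : EReal) : ℝ≥0∞ := if x = ⊤ then ⊤ else ENNReal.ofReal x.toReal

/-- The integral of an `EReal`-valued function: the (unsigned) integral of the positive part
minus the integral of the negative part. -/
def erealIntegral {X : Type} [MeasurableSpace X] (μ : Measure X) (g : X → EReal) : EReal :=
  ((∫⁻ x, erealPos (g x) ∂μ : ℝ≥0∞) : EReal) - ((∫⁻ x, erealPos (-(g x)) ∂μ : ℝ≥0∞) : EReal)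

/-- `h : ℂ → [-∞,∞)` is subharmonic on `s`: upper semicontinuous and satisfying the
sub-mean-value inequality `h(a) ≤ (2π)⁻¹ ∫₀^{2π} h(a + r e^{iθ}) dθ` whenever the closed disc
of center `a` and radius `r` is contained in `s`. -/
def SubharmonicOnE (h : ℂ → EReal) (s : Set ℂ) : Prop :=
  UpperSemicontinuousOn h s ∧
  ∀ a : ℂ, ∀ r : ℝ, 0 < r → Metric.closedBall a r ⊆ s →
    h a ≤ (((2 * Real.pi)⁻¹ : ℝ) : EReal) *
      erealIntegral (volume.restrict (Set.Ioc (0 : ℝ) (2 * Real.pi)))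
        (fun θ : ℝ => h (a + (r : ℂ) * Complex.exp ((θ : ℂ) * Complex.I)))

/-- `u : Ω → [-∞,∞)` is `J`-plurisubharmonic on `Ω`: upper semicontinuous, and `u ∘ f` is
subharmonic on `Δ` for every `J`-holomorphic disc `f : Δ → Ω`. -/
def JPshOn {n : ℕ} (J : Cn n → Cn n →L[ℝ] Cn n) (Ω : Set (Cn n)) (u : Cn n → EReal) : Prop :=
  UpperSemicontinuousOn u Ω ∧
  ∀ f : ℂ → Cn n, JDisc J Ω f → SubharmonicOnE (fun ζ => u (f ζ)) unitDisc

/-- Real-valued `J`-plurisubharmonic functions. -/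
def JPshOnR {n : ℕ} (J : Cn n → Cn n →L[ℝ] Cn n) (Ω : Set (Cn n)) (u : Cn n → ℝ) : Prop :=
  JPshOn J Ω (fun x => (u x : EReal))

/-- The `1`-form `J*dr : w ↦ dr_x(J(x)w)`. -/
def JStarDr {n : ℕ} (J : Cn n → Cn n →L[ℝ] Cn n) (r : Cn n → ℝ) (x : Cn n) : Cn n →L[ℝ] ℝ :=
  (fderiv ℝ r x).comp (J x)

/-- The Levi form of a `C²` function `r`:
`L^J_r(p,v) = -d(J*dr)_p(v, J(p)v)` where `dα_p(u,w) = (∂_u α)_p(w) - (∂_w α)_p(u)`. -/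
def LeviForm {n : ℕ} (J : Cn n → Cn n →L[ℝ] Cn n) (r : Cn n → ℝ) (p v : Cn n) : ℝ :=
  -((fderiv ℝ (JStarDr J r) p v) (J p v) - (fderiv ℝ (JStarDr J r) p (J p v)) v)

/-- `r` is strictly `J`-plurisubharmonic on `S`: its Levi form is positive definite there. -/
def StrictJPshOn {n : ℕ} (J : Cn n → Cn n →L[ℝ] Cn n) (r : Cn n → ℝ) (S : Set (Cn n)) : Prop :=
  ∀ p ∈ S, ∀ v : Cn n, v ≠ 0 → 0 < LeviForm J r p v

/-- The Kobayashi–Royden infinitesimal pseudometric of `(D,J)`: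
`K(p,v) = inf {α > 0 : ∃ J-holomorphic disc f : Δ → D, f(0) = p, df_0(∂/∂x) = v/α}`. -/
def kobMetric {n : ℕ} (J : Cn n → Cn n →L[ℝ] Cn n) (D : Set (Cn n)) (p v : Cn n) : ℝ :=
  sInf {α : ℝ | 0 < α ∧ ∃ f : ℂ → Cn n, JDisc J D f ∧ f 0 = p ∧ fderiv ℝ f 0 1 = α⁻¹ • v}

/-- A piecewise `C¹` path `γ : [0,1] → ℝ^{2n}`. -/
def PiecewiseC1On {n : ℕ} (γ : ℝ → Cn n) : Prop :=
  ContinuousOn γ (Set.Icc 0 1) ∧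
  ∃ (m : ℕ) (t : ℕ → ℝ), t 0 = 0 ∧ t m = 1 ∧ (∀ i < m, t i < t (i + 1)) ∧
    ∀ i < m, ContDiffOn ℝ 1 γ (Set.Icc (t i) (t (i + 1)))

/-- The (integrated) Kobayashi pseudodistance of `(D,J)`: the infimum of the Kobayashi–Royden
lengths of piecewise `C¹` paths in `D` joining `p` to `q`. -/
def kobDist {n : ℕ} (J : Cn n → Cn n →L[ℝ] Cn n) (D : Set (Cn n)) (p q : Cn n) : ℝ :=
  sInf {L : ℝ | ∃ γ : ℝ → Cn n, PiecewiseC1On γ ∧ MapsTo γ (Set.Icc 0 1) D ∧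
    γ 0 = p ∧ γ 1 = q ∧ L = ∫ t in (0 : ℝ)..1, kobMetric J D (γ t) (deriv γ t)}

/-- The cluster set of `f` (defined on `S`) along `A ⊆ closure S`: all limits of sequences
`f(s_k)` where `s_k ∈ S` converges to a point of `A`. -/
def clusterSet {X Y : Type*} [TopologicalSpace X] [TopologicalSpace Y]
    (f : X → Y) (S A : Set X) : Set Y :=
  {y | ∃ u : ℕ → X, (∀ k, u k ∈ S) ∧ (∃ a ∈ A, Tendsto u atTop (𝓝 a)) ∧
    Tendsto (fun k => f (u k)) atTop (𝓝 y)}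

/-- `N` is a `d`-dimensional `C^∞` submanifold of `ℂⁿ ≅ ℝ^{2n}`: near every point it can be
straightened, by a `C^∞` diffeomorphism onto an open subset of `ℝ^{2n}`, to the coordinate
subspace spanned by the first `d` coordinates. -/
def IsSmoothSubmanifold {n : ℕ} (d : ℕ) (N : Set (Cn n)) : Prop :=
  ∀ p ∈ N, ∃ (U : Set (Cn n)) (V : Set (EuclideanSpace ℝ (Fin (2 * n))))
    (φ : Cn n → EuclideanSpace ℝ (Fin (2 * n))) (ψ : EuclideanSpace ℝ (Fin (2 * n)) → Cn n),
    IsOpen U ∧ p ∈ U ∧ IsOpen V ∧ ContDiffOn ℝ (⊤ : ℕ∞) φ U ∧ ContDiffOn ℝ (⊤ : ℕ∞) ψ V ∧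
    (∀ x ∈ U, ψ (φ x) = x) ∧ (∀ y ∈ V, φ (ψ y) = y) ∧ MapsTo φ U V ∧
    φ '' (N ∩ U) = V ∩ {x | ∀ i : Fin (2 * n), d ≤ (i : ℕ) → x i = 0}

/-- The tangent set of `N ⊆ ℂⁿ` at `p`: velocities at `0` of differentiable curves through `p`
staying in `N` near time `0`. For a `C^∞` submanifold this is the tangent space `T_pN`. -/
def TangentSet {n : ℕ} (N : Set (Cn n)) (p : Cn n) : Set (Cn n) :=
  {v | ∃ γ : ℝ → Cn n, γ 0 = p ∧ (∀ᶠ t in 𝓝 (0 : ℝ), γ t ∈ N) ∧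
    DifferentiableAt ℝ γ 0 ∧ deriv γ 0 = v}

/-- `N` is totally real for `J`: `T_pN ∩ J(p)(T_pN) = {0}` at every `p ∈ N`. -/
def TotallyReal {n : ℕ} (J : Cn n → Cn n →L[ℝ] Cn n) (N : Set (Cn n)) : Prop :=
  ∀ p ∈ N, ∀ v ∈ TangentSet N p, J p v ∈ TangentSet N p → v = 0

/-- `ρ` is a (global) `C^∞` defining function of `D`, defined on the neighborhood `Ω` of the
closure of `D`, with nonvanishing differential on `∂D`.  (This encodes that `D` has
`C^∞` boundary.) -/
def DefiningFunction {n : ℕ} (D Ω : Set (Cn n)) (ρ : Cn n → ℝ) : Prop :=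
  IsOpen Ω ∧ closure D ⊆ Ω ∧ ContDiffOn ℝ (⊤ : ℕ∞) ρ Ω ∧
  D = {x ∈ Ω | ρ x < 0} ∧ ∀ x ∈ frontier D, fderiv ℝ ρ x ≠ 0

/-- `D` is a bounded strictly `J`-pseudoconvex domain with `C^∞` boundary: it admits a smooth
defining function which is `J`-plurisubharmonic on `D` and strictly `J`-plurisubharmonic on a
neighborhood of `∂D`. -/
def StrictlyPseudoconvexDomain {n : ℕ} (J : Cn n → Cn n →L[ℝ] Cn n) (D : Set (Cn n)) : Prop :=
  IsOpen D ∧ IsConnected D ∧ IsBounded D ∧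
  ∃ (Ω : Set (Cn n)) (ρ : Cn n → ℝ), DefiningFunction D Ω ρ ∧
    JPshOnR J D ρ ∧ ∃ W : Set (Cn n), IsOpen W ∧ frontier D ⊆ W ∧ StrictJPshOn J ρ W

end


/-- continuity of the correlation of two `L²` functions. -/
lemma corr_continuous (a h : ℂ → ℝ) (ha : MemLp a 2) (hh : MemLp h 2) (e : ℂ) :
    Continuous (fun t : ℝ => ∫ ζ : ℂ, a (ζ + t • e) * h ζ) := by
  let g : ℝ → C(ℂ, ℂ) := fun t => ⟨fun ζ => ζ + t • e, by fun_prop⟩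
  have hg : Continuous g := by
    refine ContinuousMap.continuous_of_continuous_uncurry _ ?_
    simp only [Function.uncurry_def, g, ContinuousMap.coe_mk]
    fun_prop
  have hgm : ∀ t, MeasurePreserving (g t) volume volume := fun t =>
    measurePreserving_add_right volume (t • e)
  have h1 : Continuous (fun t => Lp.compMeasurePreserving (g t) (hgm t) (ha.toLp a)) :=
    Continuous.compMeasurePreservingLp continuous_const hg hgm (by simp)
  have h2 : Continuous (fun t => inner ℝ (hh.toLp h)
      (Lp.compMeasurePreserving (g t) (hgm t) (ha.toLp a))) := continuous_const.inner h1
  convert h2 using 1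
  ext t
  rw [L2.inner_def]
  refine integral_congr_ae ?_
  filter_upwards [hh.coeFn_toLp, Lp.coeFn_compMeasurePreserving (ha.toLp a) (hgm t),
    (hgm t).quasiMeasurePreserving.ae (ha.coeFn_toLp)] with ζ h1 h2 h3
  rw [h1, h2, Function.comp_apply, h3]
  simp [g]

lemma diffquot (f h : ℂ → ℝ) (hf : Differentiable ℝ f) (cf : HasCompactSupport f) (e : ℂ)
    (hf2 : MemLp (fun ζ => fderiv ℝ f ζ e) 2) (hh : MemLp h 2) :
    HasDerivAt (fun t : ℝ => ∫ ζ : ℂ, (f (ζ + t • e) - f ζ) * h ζ)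
      (∫ ζ : ℂ, fderiv ℝ f ζ e * h ζ) 0 := by
  set a : ℂ → ℝ := fun ζ => fderiv ℝ f ζ e with ha
  have am : Measurable a := measurable_fderiv_apply_const ℝ f e
  have hJ := corr_continuous a h hf2 hh e
  have hsm : ∀ t : ℝ, MeasurePreserving (fun ζ : ℂ => ζ + t • e) volume volume := fun t =>
    measurePreserving_add_right volume (t • e)
  have hsupp : HasCompactSupport a := cf.fderiv_apply ℝ e
  have haint : Integrable a := by
    have : Integrable ((tsupport a).indicator a) := by
      rw [integrable_indicator_iff (isClosed_tsupport a).measurableSet]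
      have : IsFiniteMeasure (volume.restrict (tsupport a)) :=
        ⟨by simpa using hsupp.isCompact.measure_lt_top⟩
      exact (hf2.restrict _).integrable (by norm_num)
    rwa [Set.indicator_eq_self.2 (subset_tsupport a)] at this
  -- formula
  have key : ∀ t : ℝ, ∫ ζ : ℂ, (f (ζ + t • e) - f ζ) * h ζ
      = ∫ σ in (0:ℝ)..t, ∫ ζ : ℂ, a (ζ + σ • e) * h ζ := by
    intro t
    have hmeas : Measurable (fun p : ℝ × ℂ => a (p.2 + p.1 • e)) :=
      am.comp (by fun_prop)
    have I1 : Integrable (fun p : ℝ × ℂ => a (p.2 + p.1 • e))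
        ((volume.restrict (uIoc 0 t)).prod volume) := by
      rw [integrable_prod_iff hmeas.aestronglyMeasurable]
      refine ⟨ae_of_all _ fun σ => (hsm σ).integrable_comp_of_integrable haint, ?_⟩
      have : ∀ σ : ℝ, ∫ ζ : ℂ, ‖a (ζ + σ • e)‖ = ∫ ζ, ‖a ζ‖ := fun σ =>
        integral_add_right_eq_self (fun ζ => ‖a ζ‖) (σ • e)
      simp only [this]
      exact (intervalIntegrable_iff.1 intervalIntegrable_const)
    have I2 : Integrable (fun p : ℝ × ℂ => a (p.2 + p.1 • e) * h p.2)
        ((volume.restrict (uIoc 0 t)).prod volume) := by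
      have hm2 : AEStronglyMeasurable (fun p : ℝ × ℂ => a (p.2 + p.1 • e) * h p.2)
          ((volume.restrict (uIoc 0 t)).prod volume) :=
        hmeas.aestronglyMeasurable.mul hh.1.comp_snd
      rw [integrable_prod_iff hm2]
      have hmem : ∀ σ : ℝ, MemLp (fun ζ => a (ζ + σ • e)) 2 := fun σ =>
        hf2.comp_measurePreserving (hsm σ)
      refine ⟨ae_of_all _ fun σ => (hmem σ).integrable_mul hh, ?_⟩
      have c2 := corr_continuous (fun ζ => ‖a ζ‖) (fun ζ => ‖h ζ‖) hf2.norm hh.norm e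
      have : ∀ σ : ℝ, ∫ ζ : ℂ, ‖a (ζ + σ • e) * h ζ‖ = ∫ ζ, ‖a (ζ + σ • e)‖ * ‖h ζ‖ := fun σ => by
        simp only [norm_mul]
      simp only [this]
      exact (intervalIntegrable_iff.1 (c2.intervalIntegrable 0 t))
    have e1 : ∀ᵐ ζ : ℂ, f (ζ + t • e) - f ζ = ∫ σ in (0:ℝ)..t, a (ζ + σ • e) := by
      filter_upwards [I1.prod_left_ae] with ζ hζ
      have := intervalIntegral.integral_eq_sub_of_hasDerivAt (a := 0) (b := t)
        (f := fun σ : ℝ => f (ζ + σ • e)) (f' := fun σ => a (ζ + σ • e)) ?_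
        (intervalIntegrable_iff.2 hζ)
      · rw [this]; simp
      · intro x _
        have h1 := (hf (ζ + x • e)).hasFDerivAt
        have h2 : HasDerivAt (fun σ : ℝ => ζ + σ • e) e x := by
          simpa using ((hasDerivAt_id x).smul_const e).const_add ζ
        exact h1.comp_hasDerivAt x h2
    have e2 : ∫ ζ : ℂ, (f (ζ + t • e) - f ζ) * h ζ
        = ∫ ζ : ℂ, ∫ σ in (0:ℝ)..t, a (ζ + σ • e) * h ζ := by
      refine integral_congr_ae ?_
      filter_upwards [e1] with ζ hζ
      rw [hζ, intervalIntegral.integral_mul_const]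
    rw [e2]
    rw [intervalIntegral_integral_swap]
    · exact I2
  have e3 : (fun t : ℝ => ∫ ζ : ℂ, (f (ζ + t • e) - f ζ) * h ζ)
      = fun t => ∫ σ in (0:ℝ)..t, ∫ ζ : ℂ, a (ζ + σ • e) * h ζ := funext key
  rw [e3]
  have := intervalIntegral.integral_hasDerivAt_right (a := 0) (b := 0)
    (hJ.intervalIntegrable 0 0) (hJ.stronglyMeasurableAtFilter _ _) hJ.continuousAt
  simpa using this

/-- the Jacobian of a pair of compactly supported differentiable functions with `L²` derivative
has integral zero. -/
lemma nullLag (f g : ℂ → ℝ) (hf : Differentiable ℝ f) (hg : Differentiable ℝ g)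
    (cf : HasCompactSupport f) (cg : HasCompactSupport g)
    (hf2 : ∀ e, MemLp (fun ζ => fderiv ℝ f ζ e) 2) (hg2 : ∀ e, MemLp (fun ζ => fderiv ℝ g ζ e) 2) :
    ∫ ζ, fderiv ℝ f ζ 1 * fderiv ℝ g ζ I = ∫ ζ, fderiv ℝ f ζ I * fderiv ℝ g ζ 1 := by
  have h1 := diffquot f (fun ζ => fderiv ℝ g ζ I) hf cf 1 (hf2 1) (hg2 I)
  have h2 := diffquot g (fun ζ => fderiv ℝ f ζ I) hg cg (-1) (hg2 (-1)) (hf2 I)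
  have mf : MemLp f 2 := hf.continuous.memLp_of_hasCompactSupport cf
  have mg : MemLp g 2 := hg.continuous.memLp_of_hasCompactSupport cg
  have hsm : ∀ t : ℂ, MeasurePreserving (fun ζ : ℂ => ζ + t) volume volume := fun t =>
    measurePreserving_add_right volume t
  have key : ∀ t : ℝ, ∫ ζ : ℂ, (f (ζ + t • 1) - f ζ) * fderiv ℝ g ζ I
      = - ∫ ζ : ℂ, (g (ζ + t • (-1)) - g ζ) * fderiv ℝ f ζ I := by
    intro t
    have hd : Differentiable ℝ (fun ζ : ℂ => f (ζ + t • 1)) :=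
      fun ζ => (hf _).comp ζ (by fun_prop)
    have hfd : ∀ ζ : ℂ, fderiv ℝ (fun ζ : ℂ => f (ζ + t • 1)) ζ = fderiv ℝ f (ζ + t • 1) := by
      intro ζ; exact fderiv_comp_add_right _
    have m1 : MemLp (fun ζ : ℂ => f (ζ + t • 1)) 2 := mf.comp_measurePreserving (hsm _)
    have m2 : MemLp (fun ζ : ℂ => fderiv ℝ f (ζ + t • 1) I) 2 :=
      (hf2 I).comp_measurePreserving (hsm _)
    have i1 : ∫ ζ : ℂ, f (ζ + t • 1) * fderiv ℝ g ζ I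
        = - ∫ ζ : ℂ, fderiv ℝ f (ζ + t • 1) I * g ζ := by
      have := integral_mul_fderiv_eq_neg_fderiv_mul_of_integrable (μ := volume)
        (f := fun ζ : ℂ => f (ζ + t • 1)) (g := g) (v := I) ?_ ?_ ?_ (fun x _ => hd x) (fun x _ => hg x)
      · simpa only [hfd] using this
      · simp only [hfd]; exact m2.integrable_mul mg
      · exact m1.integrable_mul (hg2 I)
      · exact m1.integrable_mul mg
    have i2 : ∫ ζ : ℂ, f ζ * fderiv ℝ g ζ I = - ∫ ζ : ℂ, fderiv ℝ f ζ I * g ζ :=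
      integral_mul_fderiv_eq_neg_fderiv_mul_of_integrable ((hf2 I).integrable_mul mg)
        (mf.integrable_mul (hg2 I)) (mf.integrable_mul mg) (fun x _ => hf x) (fun x _ => hg x)
    have i3 : ∫ ζ : ℂ, fderiv ℝ f (ζ + t • 1) I * g ζ
        = ∫ ζ : ℂ, fderiv ℝ f ζ I * g (ζ + t • (-1)) := by
      rw [← integral_add_right_eq_self (fun ζ => fderiv ℝ f ζ I * g (ζ + t • (-1))) (t • (1:ℂ))]
      congr 1; ext ζ
      congr 2; simp
    have m3 : MemLp (fun ζ : ℂ => g (ζ + t • (-1))) 2 := mg.comp_measurePreserving (hsm _)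
    simp only [sub_mul]
    have s1 := integral_sub (m1.integrable_mul (hg2 I)) (mf.integrable_mul (hg2 I))
    have s2 := integral_sub (m3.integrable_mul (hf2 I)) (mg.integrable_mul (hf2 I))
    simp only [Pi.mul_apply] at s1 s2
    rw [s1, s2, i1, i2, i3]
    simp only [mul_comm]
    ring
  have h3 := h1.congr_of_eventuallyEq (f₁ := fun t : ℝ => - ∫ ζ : ℂ, (g (ζ + t • (-1)) - g ζ) * fderiv ℝ f ζ I)
    (Eventually.of_forall fun t => (key t).symm)
  have h4 := h3.unique h2.neg
  rw [h4, ← integral_neg]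
  congr 1; ext ζ
  simp [mul_comm]



/-- second order differential operator, the Laplacian in the plane -/
noncomputable def lapC (χ : ℂ → ℝ) (ζ : ℂ) : ℝ :=
  fderiv ℝ (fun w => fderiv ℝ χ w 1) ζ 1 + fderiv ℝ (fun w => fderiv ℝ χ w I) ζ I

lemma cut_lemma {E : Type*} [NormedAddCommGroup E] [InnerProductSpace ℝ E] (O : Set ℂ) (F : ℂ → E)
    (he : LocallyIntegrableOn (fun ζ => ‖fderiv ℝ F ζ‖ ^ 2) O)
    (χ : ℂ → ℝ) (hχ : ContDiff ℝ 1 χ) (cχ : HasCompactSupport χ) (sχ : tsupport χ ⊆ O)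
    (m : ℂ → ℝ) (hm : ∀ ζ ∈ O, DifferentiableAt ℝ m ζ) (C : ℝ)
    (hC : ∀ ζ ∈ tsupport χ, ‖fderiv ℝ m ζ‖ ≤ C * ‖fderiv ℝ F ζ‖) :
    Differentiable ℝ (fun ζ => χ ζ * m ζ) ∧ HasCompactSupport (fun ζ => χ ζ * m ζ) ∧
    (∀ e, MemLp (fun ζ => fderiv ℝ (fun ζ => χ ζ * m ζ) ζ e) 2) ∧
    (∀ ζ ∈ O, fderiv ℝ (fun ζ => χ ζ * m ζ) ζ = χ ζ • fderiv ℝ m ζ + m ζ • fderiv ℝ χ ζ) ∧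
    (∀ ζ, ζ ∉ tsupport χ → fderiv ℝ (fun ζ => χ ζ * m ζ) ζ = 0) := by
  have hχd : Differentiable ℝ χ := hχ.differentiable (by norm_num)
  have hon : ∀ ζ ∈ O, HasFDerivAt (fun ζ => χ ζ * m ζ)
      (χ ζ • fderiv ℝ m ζ + m ζ • fderiv ℝ χ ζ) ζ := fun ζ hζ =>
    (hχd ζ).hasFDerivAt.mul (hm ζ hζ).hasFDerivAt
  have hoff : ∀ ζ, ζ ∉ tsupport χ → HasFDerivAt (fun ζ => χ ζ * m ζ) (0 : ℂ →L[ℝ] ℝ) ζ := by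
    intro ζ hζ
    have : (fun ζ => χ ζ * m ζ) =ᶠ[𝓝 ζ] fun _ => 0 := by
      filter_upwards [notMem_tsupport_iff_eventuallyEq.1 hζ] with x hx
      simp [hx]
    exact (hasFDerivAt_const (0:ℝ) ζ).congr_of_eventuallyEq this
  have cs : HasCompactSupport (fun ζ => χ ζ * m ζ) := cχ.mul_right
  refine ⟨?_, cs, ?_, fun ζ hζ => (hon ζ hζ).fderiv, fun ζ hζ => (hoff ζ hζ).fderiv⟩
  · intro ζ
    by_cases h : ζ ∈ tsupport χ
    · exact (hon ζ (sχ h)).differentiableAt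
    · exact (hoff ζ h).differentiableAt
  intro e
  have meas : Measurable (fun ζ => fderiv ℝ (fun ζ => χ ζ * m ζ) ζ e) :=
    measurable_fderiv_apply_const ℝ _ e
  rw [memLp_two_iff_integrable_sq meas.aestronglyMeasurable]
  set K := tsupport χ
  have hK : IsCompact K := cχ
  have mc : ContinuousOn m K := fun ζ hζ => (hm ζ (sχ hζ)).continuousAt.continuousWithinAt
  obtain ⟨M1, hM1⟩ := hK.exists_bound_of_continuousOn mc
  obtain ⟨M2, hM2⟩ := hK.exists_bound_of_continuousOn hχ.continuous.continuousOn
  obtain ⟨M3, hM3⟩ := hK.exists_bound_of_continuousOn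
    (hχ.continuous_fderiv (by norm_num)).continuousOn
  have hInt : IntegrableOn (fun ζ => ‖fderiv ℝ F ζ‖ ^ 2) K := he.integrableOn_compact_subset sχ hK
  have hInt2 : IntegrableOn (fun ζ => 2 * (M2 * C * ‖e‖) ^ 2 * ‖fderiv ℝ F ζ‖ ^ 2 +
      2 * (M1 * M3 * ‖e‖) ^ 2) K := (hInt.const_mul _).add
        (integrableOn_const hK.measure_lt_top.ne)
  rw [← integrable_indicator_iff hK.measurableSet] at hInt2
  refine hInt2.mono' (meas.pow_const 2).aestronglyMeasurable (ae_of_all _ fun ζ => ?_)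
  by_cases h : ζ ∈ K
  · rw [indicator_of_mem h, (hon ζ (sχ h)).fderiv]
    rw [Real.norm_eq_abs, abs_of_nonneg (sq_nonneg _)]
    have hM2' : 0 ≤ M2 := (norm_nonneg _).trans (hM2 ζ h)
    have hM1' : 0 ≤ M1 := (norm_nonneg _).trans (hM1 ζ h)
    have b1 : ‖χ ζ * fderiv ℝ m ζ e‖ ≤ M2 * C * ‖e‖ * ‖fderiv ℝ F ζ‖ := by
      rw [norm_mul]
      calc _ ≤ M2 * (‖fderiv ℝ m ζ‖ * ‖e‖) := by
            gcongr
            · exact hM2 ζ h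
            · exact ContinuousLinearMap.le_opNorm _ _
        _ ≤ M2 * ((C * ‖fderiv ℝ F ζ‖) * ‖e‖) := by gcongr; exact hC ζ h
        _ = _ := by ring
    have b2 : ‖m ζ * fderiv ℝ χ ζ e‖ ≤ M1 * M3 * ‖e‖ := by
      rw [norm_mul]
      calc _ ≤ M1 * (‖fderiv ℝ χ ζ‖ * ‖e‖) := by
            gcongr
            · exact hM1 ζ h
            · exact ContinuousLinearMap.le_opNorm _ _
        _ ≤ M1 * (M3 * ‖e‖) := by gcongr; exact hM3 ζ h
        _ = _ := by ring
    simp only [add_apply, smul_apply, smul_eq_mul]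
    have b1' := pow_le_pow_left₀ (norm_nonneg _) b1 2
    have b2' := pow_le_pow_left₀ (norm_nonneg _) b2 2
    rw [Real.norm_eq_abs, sq_abs] at b1' b2'
    nlinarith [sq_nonneg (χ ζ * fderiv ℝ m ζ e - m ζ * fderiv ℝ χ ζ e)]
  · rw [indicator_of_notMem h, (hoff ζ h).fderiv]
    simp



lemma exists_cut (K O : Set ℂ) (hK : IsCompact K) (hO : IsOpen O) (hKO : K ⊆ O) :
    ∃ ω : ℂ → ℝ, ContDiff ℝ 2 ω ∧ HasCompactSupport ω ∧ tsupport ω ⊆ O ∧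
      (∀ ζ ∈ K, ω ζ = 1 ∧ fderiv ℝ ω ζ = 0) ∧ ∀ ζ, 0 ≤ ω ζ := by
  obtain ⟨K', hK', h1, h2⟩ := exists_compact_between hK hO hKO
  obtain ⟨ω, w1, w2, w3, w4⟩ := exists_contMDiff_support_eq_eq_one_iff (n := 2)
    (modelWithCornersSelf ℝ ℂ) isOpen_interior hK.isClosed h1
  have ts : tsupport ω ⊆ K' := by
    rw [tsupport, w3]; exact closure_minimal interior_subset hK'.isClosed
  refine ⟨ω, w1.contDiff, hK'.of_isClosed_subset (isClosed_tsupport _) ts, ts.trans h2, ?_,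
    fun ζ => (w2 (mem_range_self ζ)).1⟩
  intro ζ hζ
  have e1 := (w4 ζ).1 hζ
  refine ⟨e1, IsLocalMax.fderiv_eq_zero ?_⟩
  exact Eventually.of_forall fun x => by rw [e1]; exact (w2 (mem_range_self x)).2

/-- the weak form of the identity `Δ (g ∘ F) = Λ`. -/
lemma weak_identity {E : Type*} [NormedAddCommGroup E] [InnerProductSpace ℝ E]
    [FiniteDimensional ℝ E] (O : Set ℂ) (hO : IsOpen O) (F : ℂ → E) (W : Set E) (hW : IsOpen W)
    (hFW : MapsTo F O W) (J : E → E →L[ℝ] E) (hJ : ContDiffOn ℝ 1 J W)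
    (hJ2 : ∀ y ∈ W, ∀ v, J y (J y v) = -v)
    (hF : ∀ ζ ∈ O, DifferentiableAt ℝ F ζ) (hFJ : ∀ ζ ∈ O, fderiv ℝ F ζ I = J (F ζ) (fderiv ℝ F ζ 1))
    (he : LocallyIntegrableOn (fun ζ => ‖fderiv ℝ F ζ‖ ^ 2) O)
    (g : E → ℝ) (hg : ContDiffOn ℝ 2 g W)
    (χ : ℂ → ℝ) (hχ : ContDiff ℝ 2 χ) (cχ : HasCompactSupport χ) (sχ : tsupport χ ⊆ O) :
    let b : E → E →L[ℝ] ℝ := fun y => (fderiv ℝ g y).comp (J y)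
    let Λ : ℂ → ℝ := fun ζ =>
      fderiv ℝ b (F ζ) (J (F ζ) (fderiv ℝ F ζ 1)) (fderiv ℝ F ζ 1) -
      fderiv ℝ b (F ζ) (fderiv ℝ F ζ 1) (J (F ζ) (fderiv ℝ F ζ 1))
    Integrable (fun ζ => χ ζ * Λ ζ) ∧
    ∫ ζ, g (F ζ) * lapC χ ζ = ∫ ζ, χ ζ * Λ ζ := by
  intro b Λ
  have hb : ContDiffOn ℝ 1 b W := (hg.fderiv_of_isOpen hW (by norm_num)).clm_comp hJ
  set K := tsupport χ with hKdef
  have hK : IsCompact K := cχ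
  obtain ⟨ω, hω, cω, sω, ω1, -⟩ := exists_cut K O hK hO sχ
  have hω' : ContDiff ℝ 1 ω := hω.of_le (by norm_num)
  have hχ' : ContDiff ℝ 1 χ := hχ.of_le (by norm_num)
  have hχd : Differentiable ℝ χ := hχ.differentiable (by norm_num)
  set e := stdOrthonormalBasis ℝ E
  have hFc : ContinuousOn F O := fun ζ hζ => (hF ζ hζ).continuousAt.continuousWithinAt
  have hgd : ∀ y ∈ W, DifferentiableAt ℝ g y := fun y hy =>
    (hg.differentiableOn (by norm_num)).differentiableAt (hW.mem_nhds hy)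
  have hbd : ∀ y ∈ W, DifferentiableAt ℝ b y := fun y hy =>
    (hb.differentiableOn (by norm_num)).differentiableAt (hW.mem_nhds hy)
  have hg'c : ContinuousOn (fun ζ => fderiv ℝ g (F ζ)) O :=
    (hg.continuousOn_fderiv_of_isOpen hW (by norm_num)).comp hFc hFW
  have hb'c : ContinuousOn (fun ζ => fderiv ℝ b (F ζ)) O :=
    (hb.continuousOn_fderiv_of_isOpen hW (by norm_num)).comp hFc hFW
  have cK : ∀ (ζ) (hζ : ζ ∈ K), ζ ∈ O := sχ
  -- bounds
  obtain ⟨Cg, hCg⟩ := (show IsCompact (tsupport ω) from cω).exists_bound_of_continuousOn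
    (hg'c.mono sω)
  obtain ⟨Cb, hCb⟩ : ∃ C, ∀ ζ ∈ K, ‖fderiv ℝ b (F ζ)‖ ≤ C := by
    obtain ⟨C, hC⟩ := hK.bddAbove_image
      (ContinuousOn.norm (E := E →L[ℝ] E →L[ℝ] ℝ) (hb'c.mono sχ))
    exact ⟨C, fun ζ hζ => hC (mem_image_of_mem _ hζ)⟩
  -- the three kinds of cut functions
  have hgF : ∀ ζ ∈ O, HasFDerivAt (fun ζ => g (F ζ)) ((fderiv ℝ g (F ζ)).comp (fderiv ℝ F ζ)) ζ :=
    fun ζ hζ => (hgd _ (hFW hζ)).hasFDerivAt.comp ζ (hF ζ hζ).hasFDerivAt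
  have hbF : ∀ i, ∀ ζ ∈ O, HasFDerivAt (fun ζ => b (F ζ) (e i))
      ((ContinuousLinearMap.apply ℝ ℝ (e i)).comp
        ((fderiv ℝ b (F ζ)).comp (fderiv ℝ F ζ))) ζ := fun i ζ hζ =>
    (ContinuousLinearMap.apply ℝ ℝ (e i)).hasFDerivAt.comp ζ
      ((hbd _ (hFW hζ)).hasFDerivAt.comp ζ (hF ζ hζ).hasFDerivAt)
  have hFi : ∀ i, ∀ ζ ∈ O, HasFDerivAt (fun ζ => inner ℝ (e i) (F ζ))
      ((innerSL ℝ (e i)).comp (fderiv ℝ F ζ)) ζ := fun i ζ hζ =>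
    (innerSL ℝ (e i)).hasFDerivAt.comp ζ (hF ζ hζ).hasFDerivAt
  obtain ⟨m1, m2, m3, m4, m5⟩ := cut_lemma O F he ω hω' cω sω (fun ζ => g (F ζ))
    (fun ζ hζ => (hgF ζ hζ).differentiableAt) Cg (fun ζ hζ => by
      rw [(hgF ζ (sω hζ)).fderiv]
      refine (ContinuousLinearMap.opNorm_comp_le _ _).trans ?_
      gcongr; exact hCg ζ hζ)
  have hf := fun i => cut_lemma O F he χ hχ' cχ sχ (fun ζ => b (F ζ) (e i))
    (fun ζ hζ => (hbF i ζ hζ).differentiableAt) Cb (fun ζ hζ => by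
      rw [(hbF i ζ (sχ hζ)).fderiv]
      refine ContinuousLinearMap.opNorm_le_bound _ (mul_nonneg
        ((norm_nonneg (E := E →L[ℝ] E →L[ℝ] ℝ) _).trans (hCb ζ hζ))
        (norm_nonneg _)) fun x => ?_
      simp only [ContinuousLinearMap.comp_apply, ContinuousLinearMap.apply_apply]
      calc ‖fderiv ℝ b (F ζ) (fderiv ℝ F ζ x) (e i)‖
          ≤ ‖fderiv ℝ b (F ζ) (fderiv ℝ F ζ x)‖ * ‖e i‖ := ContinuousLinearMap.le_opNorm _ _
        _ ≤ (‖fderiv ℝ b (F ζ)‖ * (‖fderiv ℝ F ζ‖ * ‖x‖)) * 1 := by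
            gcongr
            · exact (ContinuousLinearMap.le_opNorm _ _).trans (by
                gcongr; exact ContinuousLinearMap.le_opNorm _ _)
            · simp
        _ ≤ (Cb * (‖fderiv ℝ F ζ‖ * ‖x‖)) * 1 := by gcongr; exact hCb ζ hζ
        _ = _ := by ring)
  have hG := fun i => cut_lemma O F he ω hω' cω sω (fun ζ => inner ℝ (e i) (F ζ))
    (fun ζ hζ => (hFi i ζ hζ).differentiableAt) 1 (fun ζ hζ => by
      rw [(hFi i ζ (sω hζ)).fderiv]
      refine (ContinuousLinearMap.opNorm_comp_le _ _).trans ?_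
      simp)
  -- part 1
  have mm : MemLp (fun ζ => ω ζ * g (F ζ)) 2 := m1.continuous.memLp_of_hasCompactSupport m2
  have hχe : ∀ v : ℂ, ContDiff ℝ 1 (fun w => fderiv ℝ χ w v) := fun v =>
    (hχ.fderiv_right (m := 1) (by norm_num)).clm_apply contDiff_const
  have cχe : ∀ v : ℂ, HasCompactSupport (fun w => fderiv ℝ χ w v) := fun v => cχ.fderiv_apply ℝ v
  have lχ1 : ∀ v : ℂ, MemLp (fun w => fderiv ℝ χ w v) 2 := fun v =>
    (hχe v).continuous.memLp_of_hasCompactSupport (cχe v)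
  have lχ2 : ∀ v : ℂ, MemLp (fun ζ => fderiv ℝ (fun w => fderiv ℝ χ w v) ζ v) 2 := fun v =>
    (((hχe v).continuous_fderiv (by norm_num)).clm_apply
      continuous_const).memLp_of_hasCompactSupport ((cχe v).fderiv_apply ℝ v)
  have ibp : ∀ v : ℂ, ∫ ζ, (ω ζ * g (F ζ)) * fderiv ℝ (fun w => fderiv ℝ χ w v) ζ v
      = - ∫ ζ, fderiv ℝ (fun ζ => ω ζ * g (F ζ)) ζ v * fderiv ℝ χ ζ v := fun v =>
    integral_mul_fderiv_eq_neg_fderiv_mul_of_integrable ((m3 v).integrable_mul (lχ1 v))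
      (mm.integrable_mul (lχ2 v)) (mm.integrable_mul (lχ1 v)) (fun x _ => m1 x)
      (fun x _ => (hχe v).differentiable (by norm_num) x)
  have suppe : ∀ v : ℂ, ∀ ζ ∉ K, fderiv ℝ (fun w => fderiv ℝ χ w v) ζ v = 0 := by
    intro v ζ hζ
    have h1 : ζ ∉ tsupport (fun w => fderiv ℝ χ w v) :=
      fun h => hζ (tsupport_fderiv_apply_subset ℝ v h)
    exact image_eq_zero_of_notMem_tsupport
      (f := fun ζ => fderiv ℝ (fun w => fderiv ℝ χ w v) ζ v)
      (fun h => h1 (tsupport_fderiv_apply_subset ℝ v h))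
  have L1 : ∫ ζ, g (F ζ) * lapC χ ζ = ∫ ζ, -(fderiv ℝ (fun ζ => ω ζ * g (F ζ)) ζ 1 * fderiv ℝ χ ζ 1
        + fderiv ℝ (fun ζ => ω ζ * g (F ζ)) ζ I * fderiv ℝ χ ζ I) := by
    rw [integral_neg]
    have := integral_add ((m3 1).integrable_mul (lχ1 1)) ((m3 I).integrable_mul (lχ1 I))
    simp only [Pi.mul_apply] at this
    rw [this, neg_add, ← ibp 1, ← ibp I]
    have := integral_add (mm.integrable_mul (lχ2 1)) (mm.integrable_mul (lχ2 I))
    simp only [Pi.mul_apply] at this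
    rw [← this]
    congr 1; ext ζ
    by_cases h : ζ ∈ K
    · rw [(ω1 ζ h).1, lapC]; ring
    · rw [lapC, suppe 1 ζ h, suppe I ζ h]; ring
  have Iint : Integrable (fun ζ => -(fderiv ℝ (fun ζ => ω ζ * g (F ζ)) ζ 1 * fderiv ℝ χ ζ 1
        + fderiv ℝ (fun ζ => ω ζ * g (F ζ)) ζ I * fderiv ℝ χ ζ I)) :=
    (((m3 1).integrable_mul (lχ1 1)).add ((m3 I).integrable_mul (lχ1 I))).neg
  -- part 2
  set S : ℂ → ℝ := fun ζ => ∑ i, (fderiv ℝ (fun ζ => χ ζ * b (F ζ) (e i)) ζ 1 *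
      fderiv ℝ (fun ζ => ω ζ * inner ℝ (e i) (F ζ)) ζ I -
      fderiv ℝ (fun ζ => χ ζ * b (F ζ) (e i)) ζ I *
      fderiv ℝ (fun ζ => ω ζ * inner ℝ (e i) (F ζ)) ζ 1) with hS
  have Sint : Integrable S := integrable_finsetSum _ fun i _ =>
    (((hf i).2.2.1 1).integrable_mul ((hG i).2.2.1 I)).sub
      (((hf i).2.2.1 I).integrable_mul ((hG i).2.2.1 1))
  have Szero : ∫ ζ, S ζ = 0 := by
    have h0 := integral_finsetSum Finset.univ fun i _ =>
      (((hf i).2.2.1 1).integrable_mul ((hG i).2.2.1 I)).sub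
      (((hf i).2.2.1 I).integrable_mul ((hG i).2.2.1 1))
    simp only [Pi.mul_apply, Pi.sub_apply] at h0
    rw [hS, h0]
    refine Finset.sum_eq_zero fun i _ => ?_
    have h1 := integral_sub (((hf i).2.2.1 1).integrable_mul ((hG i).2.2.1 I))
      (((hf i).2.2.1 I).integrable_mul ((hG i).2.2.1 1))
    simp only [Pi.mul_apply] at h1
    rw [h1, nullLag _ _ (hf i).1 (hG i).1 (hf i).2.1 (hG i).2.1 (hf i).2.2.1 (hG i).2.2.1, sub_self]
  -- part 3
  have pt : ∀ ζ, -(fderiv ℝ (fun ζ => ω ζ * g (F ζ)) ζ 1 * fderiv ℝ χ ζ 1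
        + fderiv ℝ (fun ζ => ω ζ * g (F ζ)) ζ I * fderiv ℝ χ ζ I) - S ζ = χ ζ * Λ ζ := by
    intro ζ
    by_cases h : ζ ∈ K
    · have hζO := sχ h
      have y1 := hJ2 _ (hFW hζO) (fderiv ℝ F ζ 1)
      have expand : ∀ (l : E →L[ℝ] ℝ) (x : E), ∑ i, l (e i) * inner ℝ (e i) x = l x := by
        intro l x
        conv_rhs => rw [← e.sum_repr' x]
        simp [map_sum, mul_comm]
      have hSζ : S ζ = fderiv ℝ χ ζ 1 * b (F ζ) (fderiv ℝ F ζ I) +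
          χ ζ * fderiv ℝ b (F ζ) (fderiv ℝ F ζ 1) (fderiv ℝ F ζ I) -
          (fderiv ℝ χ ζ I * b (F ζ) (fderiv ℝ F ζ 1) +
          χ ζ * fderiv ℝ b (F ζ) (fderiv ℝ F ζ I) (fderiv ℝ F ζ 1)) := by
        have : ∀ i, fderiv ℝ (fun ζ => χ ζ * b (F ζ) (e i)) ζ 1 *
            fderiv ℝ (fun ζ => ω ζ * inner ℝ (e i) (F ζ)) ζ I -
            fderiv ℝ (fun ζ => χ ζ * b (F ζ) (e i)) ζ I *
            fderiv ℝ (fun ζ => ω ζ * inner ℝ (e i) (F ζ)) ζ 1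
            = fderiv ℝ χ ζ 1 * (b (F ζ) (e i) * inner ℝ (e i) (fderiv ℝ F ζ I)) +
              χ ζ * (fderiv ℝ b (F ζ) (fderiv ℝ F ζ 1) (e i) * inner ℝ (e i) (fderiv ℝ F ζ I)) -
              (fderiv ℝ χ ζ I * (b (F ζ) (e i) * inner ℝ (e i) (fderiv ℝ F ζ 1)) +
              χ ζ * (fderiv ℝ b (F ζ) (fderiv ℝ F ζ I) (e i) * inner ℝ (e i) (fderiv ℝ F ζ 1))) := by
          intro i
          rw [(hf i).2.2.2.1 ζ hζO, (hG i).2.2.2.1 ζ hζO, (hbF i ζ hζO).fderiv, (hFi i ζ hζO).fderiv,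
            (ω1 ζ h).1, (ω1 ζ h).2]
          simp
          ring
        rw [hS]
        simp only [this]
        rw [Finset.sum_sub_distrib, Finset.sum_add_distrib, Finset.sum_add_distrib,
          ← Finset.mul_sum, ← Finset.mul_sum, ← Finset.mul_sum, ← Finset.mul_sum,
          expand, expand, expand, expand]
      rw [hSζ, m4 ζ hζO, (hgF ζ hζO).fderiv, (ω1 ζ h).1, (ω1 ζ h).2]
      simp only [Λ, hFJ ζ hζO, b, ContinuousLinearMap.comp_apply, y1, add_apply,
        smul_apply, smul_eq_mul, map_neg, zero_apply]
      ring
    · have h0 : fderiv ℝ χ ζ = 0 := image_eq_zero_of_notMem_tsupport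
        (fun h' => h (tsupport_fderiv_subset ℝ h'))
      have h1 : χ ζ = 0 := image_eq_zero_of_notMem_tsupport h
      have : S ζ = 0 := by
        rw [hS]
        refine Finset.sum_eq_zero fun i _ => ?_
        rw [(hf i).2.2.2.2 ζ h]; simp
      rw [this, h0, h1]; simp
  have pt' : (fun ζ => χ ζ * Λ ζ) = fun ζ => -(fderiv ℝ (fun ζ => ω ζ * g (F ζ)) ζ 1 * fderiv ℝ χ ζ 1
        + fderiv ℝ (fun ζ => ω ζ * g (F ζ)) ζ I * fderiv ℝ χ ζ I) - S ζ := 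
    funext fun ζ => (pt ζ).symm
  rw [pt']
  refine ⟨Iint.sub Sint, ?_⟩
  rw [L1, integral_sub Iint Sint, Szero, sub_zero]



/-- the pointwise expression of the Laplacian of `ϕ (B (F - q) (F - q))`. -/
noncomputable def Lam {E : Type*} [NormedAddCommGroup E] [InnerProductSpace ℝ E]
    (J : E → E →L[ℝ] E) (B : E →L[ℝ] E →L[ℝ] ℝ) (q : E) (ϕ1 ϕ2 : ℝ → ℝ) (y v : E) : ℝ :=
  4 * ϕ2 (B (y - q) (y - q)) * ((B (y - q) v) ^ 2 + (B (y - q) (J y v)) ^ 2) +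
  2 * ϕ1 (B (y - q) (y - q)) * (B v v + B (J y v) (J y v) +
    B (y - q) (fderiv ℝ J y (J y v) v - fderiv ℝ J y v (J y v)))

lemma Lam_formula {E : Type*} [NormedAddCommGroup E] [InnerProductSpace ℝ E]
    (W : Set E) (hW : IsOpen W)
    (J : E → E →L[ℝ] E) (hJ : ContDiffOn ℝ 1 J W)
    (hJ2 : ∀ y ∈ W, ∀ v, J y (J y v) = -v)
    (B : E →L[ℝ] E →L[ℝ] ℝ) (hBs : ∀ v w, B v w = B w v) (hB : ∀ v, 0 ≤ B v v) (q : E)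
    (ϕ ϕ1 ϕ2 : ℝ → ℝ) (h1 : ∀ s, 0 ≤ s → HasDerivAt ϕ (ϕ1 s) s)
    (h2 : ∀ s, 0 ≤ s → HasDerivAt ϕ1 (ϕ2 s) s) (y v : E) (hy : y ∈ W) :
    fderiv ℝ (fun y => (fderiv ℝ (fun y => ϕ (B (y - q) (y - q))) y).comp (J y)) y (J y v) v -
    fderiv ℝ (fun y => (fderiv ℝ (fun y => ϕ (B (y - q) (y - q))) y).comp (J y)) y v (J y v)
    = Lam J B q ϕ1 ϕ2 y v := by
  have hk : ∀ y : E, HasFDerivAt (fun y : E => y - q) (ContinuousLinearMap.id ℝ E) y := fun y =>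
    (hasFDerivAt_id y).sub_const q
  have hBk : ∀ y : E, HasFDerivAt (fun y : E => B (y - q)) B y := fun y => by
    have := (B.hasFDerivAt (x := y - q)).comp y (hk y)
    rwa [ContinuousLinearMap.comp_id] at this
  have hs : ∀ y : E, HasFDerivAt (fun y => B (y - q) (y - q)) ((2:ℝ) • B (y - q)) y := by
    intro y
    have := (hBk y).clm_apply (hk y)
    refine this.congr_fderiv ?_
    ext w
    simp [hBs w y, hBs w q, two_mul]
  have hg : ∀ y : E, HasFDerivAt (fun y => ϕ (B (y - q) (y - q)))
      (ϕ1 (B (y - q) (y - q)) • ((2:ℝ) • B (y - q))) y := fun y =>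
    (h1 (B (y - q) (y - q)) (hB _)).comp_hasFDerivAt y (hs y)
  have hb : (fun y => (fderiv ℝ (fun y => ϕ (B (y - q) (y - q))) y).comp (J y))
      = fun y => (ϕ1 (B (y - q) (y - q)) • ((2:ℝ) • B (y - q))).comp (J y) := by
    funext y; rw [(hg y).fderiv]
  rw [hb]
  have hJd : HasFDerivAt J (fderiv ℝ J y) y :=
    ((hJ.differentiableOn (by norm_num)).differentiableAt (hW.mem_nhds hy)).hasFDerivAt
  have hc : HasFDerivAt (fun y => ϕ1 (B (y - q) (y - q)))
      (ϕ2 (B (y - q) (y - q)) • ((2:ℝ) • B (y - q))) y :=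
    (h2 (B (y - q) (y - q)) (hB _)).comp_hasFDerivAt y (hs y)
  have hd := (hc.smul ((hBk y).const_smul (2:ℝ))).clm_comp hJd
  have hd' := hd.fderiv
  simp only [Pi.smul_apply', Pi.smul_apply] at hd'
  rw [hd']
  simp only [Lam, hJ2 y hy v, Pi.smul_apply', Pi.smul_apply, add_apply, smul_apply, smul_eq_mul, map_sub, map_neg,
    ContinuousLinearMap.comp_apply, ContinuousLinearMap.compL_apply, ContinuousLinearMap.flip_apply,
    ContinuousLinearMap.smulRight_apply]
  have hz := hBs (v) (J y (J y v))
  rw [hJ2 y hy v, map_neg] at hz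
  simp
  ring



lemma weak_Lam {E : Type*} [NormedAddCommGroup E] [InnerProductSpace ℝ E]
    [FiniteDimensional ℝ E] (O : Set ℂ) (hO : IsOpen O) (F : ℂ → E) (W : Set E) (hW : IsOpen W)
    (hFW : MapsTo F O W) (J : E → E →L[ℝ] E) (hJ : ContDiffOn ℝ 1 J W)
    (hJ2 : ∀ y ∈ W, ∀ v, J y (J y v) = -v)
    (hF : ∀ ζ ∈ O, DifferentiableAt ℝ F ζ) (hFJ : ∀ ζ ∈ O, fderiv ℝ F ζ I = J (F ζ) (fderiv ℝ F ζ 1))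
    (he : LocallyIntegrableOn (fun ζ => ‖fderiv ℝ F ζ‖ ^ 2) O)
    (B : E →L[ℝ] E →L[ℝ] ℝ) (hBs : ∀ v w, B v w = B w v) (hB : ∀ v, 0 ≤ B v v) (q : E)
    (ϕ ϕ1 ϕ2 : ℝ → ℝ) (h0 : ∀ s, 0 ≤ s → ContDiffAt ℝ 2 ϕ s)
    (h1 : ∀ s, 0 ≤ s → HasDerivAt ϕ (ϕ1 s) s)
    (h2 : ∀ s, 0 ≤ s → HasDerivAt ϕ1 (ϕ2 s) s)
    (χ : ℂ → ℝ) (hχ : ContDiff ℝ 2 χ) (cχ : HasCompactSupport χ) (sχ : tsupport χ ⊆ O) :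
    Integrable (fun ζ => χ ζ * Lam J B q ϕ1 ϕ2 (F ζ) (fderiv ℝ F ζ 1)) ∧
    ∫ ζ, ϕ (B (F ζ - q) (F ζ - q)) * lapC χ ζ
      = ∫ ζ, χ ζ * Lam J B q ϕ1 ϕ2 (F ζ) (fderiv ℝ F ζ 1) := by
  have hg : ContDiffOn ℝ 2 (fun y => ϕ (B (y - q) (y - q))) W := by
    intro y _
    apply ContDiffAt.contDiffWithinAt
    have : ContDiffAt ℝ 2 (fun y => B (y - q) (y - q)) y := by
      apply ContDiff.contDiffAt
      have h : ContDiff ℝ 2 (fun y : E => y - q) := contDiff_id.sub contDiff_const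
      exact (B.contDiff.comp h).clm_apply h
    exact ContDiffAt.comp (g := ϕ) y (h0 _ (hB (y - q))) this
  have key := weak_identity O hO F W hW hFW J hJ hJ2 hF hFJ he _ hg χ hχ cχ sχ
  have e : (fun ζ => χ ζ * Lam J B q ϕ1 ϕ2 (F ζ) (fderiv ℝ F ζ 1)) = fun ζ => χ ζ *
      (fderiv ℝ (fun y => (fderiv ℝ (fun y => ϕ (B (y - q) (y - q))) y).comp (J y)) (F ζ)
        (J (F ζ) (fderiv ℝ F ζ 1)) (fderiv ℝ F ζ 1) -
      fderiv ℝ (fun y => (fderiv ℝ (fun y => ϕ (B (y - q) (y - q))) y).comp (J y)) (F ζ)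
        (fderiv ℝ F ζ 1) (J (F ζ) (fderiv ℝ F ζ 1))) := by
    funext ζ
    by_cases h : ζ ∈ tsupport χ
    · rw [Lam_formula W hW J hJ hJ2 B hBs hB q ϕ ϕ1 ϕ2 h1 h2 (F ζ) _ (hFW (sχ h))]
    · simp [image_eq_zero_of_notMem_tsupport h]
  rw [e]
  exact key

/-- the inner product as a bilinear map -/
noncomputable def Bin (E : Type*) [NormedAddCommGroup E] [InnerProductSpace ℝ E] :
    E →L[ℝ] E →L[ℝ] ℝ := innerSL ℝ

lemma Bin_apply {E : Type*} [NormedAddCommGroup E] [InnerProductSpace ℝ E] (v w : E) :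
    Bin E v w = inner ℝ v w := rfl

/-- bound for the square of the norm -/
lemma Lam_sq {E : Type*} [NormedAddCommGroup E] [InnerProductSpace ℝ E]
    (J : E → E →L[ℝ] E) (q y v : E) (C δ : ℝ) (hC : 0 ≤ C)
    (h1 : ‖J y‖ ≤ C) (h2 : ‖fderiv ℝ J y‖ ≤ C) (hk : ‖y - q‖ ≤ δ) (hδ : 4 * C ^ 2 * δ ≤ 1) :
    ‖v‖ ^ 2 ≤ Lam J (Bin E) q (fun _ => 1) (fun _ => 0) y v := by
  have hJv : ‖J y v‖ ≤ C * ‖v‖ := (J y).le_of_opNorm_le h1 v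
  have a1 : ‖fderiv ℝ J y (J y v) v‖ ≤ C * (C * ‖v‖) * ‖v‖ := by
    have := (fderiv ℝ J y).le_opNorm (J y v)
    have h3 := (fderiv ℝ J y (J y v)).le_opNorm v
    have : ‖fderiv ℝ J y (J y v)‖ ≤ C * (C * ‖v‖) := this.trans (by gcongr)
    exact h3.trans (by gcongr)
  have a2 : ‖fderiv ℝ J y v (J y v)‖ ≤ C * ‖v‖ * (C * ‖v‖) := by
    have := (fderiv ℝ J y).le_opNorm v
    have h3 := (fderiv ℝ J y v).le_opNorm (J y v)
    have : ‖fderiv ℝ J y v‖ ≤ C * ‖v‖ := this.trans (by gcongr)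
    exact h3.trans (by gcongr)
  have a3 := norm_sub_le (fderiv ℝ J y (J y v) v) (fderiv ℝ J y v (J y v))
  have a4 := abs_real_inner_le_norm (y - q) (fderiv ℝ J y (J y v) v - fderiv ℝ J y v (J y v))
  have a5 : ‖y - q‖ * ‖fderiv ℝ J y (J y v) v - fderiv ℝ J y v (J y v)‖ ≤ δ * (2 * C ^ 2 * ‖v‖ ^ 2) := by
    have : ‖fderiv ℝ J y (J y v) v - fderiv ℝ J y v (J y v)‖ ≤ 2 * C ^ 2 * ‖v‖ ^ 2 := by nlinarith
    have := norm_nonneg (y - q)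
    gcongr
    linarith
  have a6 := neg_abs_le (inner ℝ (y - q) (fderiv ℝ J y (J y v) v - fderiv ℝ J y v (J y v)))
  simp only [Lam, Bin_apply, real_inner_self_eq_norm_sq]
  have := sq_nonneg ‖J y v‖
  have : δ * (2 * C ^ 2 * ‖v‖ ^ 2) ≤ 1/2 * ‖v‖ ^ 2 := by nlinarith [sq_nonneg ‖v‖]
  nlinarith



lemma exists_theta : ∃ (Θ η η' : ℝ → ℝ) (Cη : ℝ), 0 ≤ Cη ∧ ContDiff ℝ 2 Θ ∧
    (∀ x, HasDerivAt Θ (η x) x) ∧ (∀ x, HasDerivAt η (η' x) x) ∧ (∀ x, 0 ≤ η x) ∧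
    (∀ x, -Cη ≤ η' x) ∧ (∀ x, x < -1 → η' x = 0) ∧ (∀ x, 0 ≤ x → η x = 0 ∧ η' x = 0 ∧ Θ x = 0) ∧
    (∀ x, Θ x ≤ 0) ∧ (∀ x, Θ x ≤ x + 1) ∧ (∀ x, min x 0 ≤ Θ x) := by
  set η : ℝ → ℝ := fun x => 1 - Real.smoothTransition (x + 1) with hη
  have cη : ContDiff ℝ 2 η := by
    have : ContDiff ℝ 2 (fun x : ℝ => x + 1) := contDiff_id.add contDiff_const
    exact contDiff_const.sub (Real.smoothTransition.contDiff.comp this)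
  have cη1 : ContDiff ℝ 1 η := cη.of_le (by norm_num)
  have ηd : Differentiable ℝ η := cη.differentiable (by norm_num)
  set Θ : ℝ → ℝ := fun x => ∫ y in (0:ℝ)..x, η y with hΘ
  have hΘ' : ∀ x, HasDerivAt Θ (η x) x := fun x =>
    cη.continuous.integral_hasStrictDerivAt 0 x |>.hasDerivAt
  have η0 : ∀ x, 0 ≤ η x := fun x => by simp [hη, Real.smoothTransition.le_one]
  have η1 : ∀ x, η x ≤ 1 := fun x => by simp [hη, Real.smoothTransition.nonneg]
  have ηr : ∀ x, 0 ≤ x → η x = 0 := fun x hx => by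
    simp [hη, Real.smoothTransition.one_of_one_le (show 1 ≤ x + 1 by linarith)]
  have ηl : ∀ x, x ≤ -1 → η x = 1 := fun x hx => by
    simp [hη, Real.smoothTransition.zero_of_nonpos (show x + 1 ≤ 0 by linarith)]
  have d0 : ∀ x, x < -1 → deriv η x = 0 := by
    intro x hx
    have : η =ᶠ[𝓝 x] fun _ => 1 := by
      filter_upwards [Iio_mem_nhds hx] with y hy using ηl y (le_of_lt hy)
    rw [this.deriv_eq]; simp
  have d1 : ∀ x, 0 ≤ x → deriv η x = 0 := by
    intro x hx
    apply IsLocalMin.deriv_eq_zero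
    exact Eventually.of_forall fun y => by rw [ηr x hx]; exact η0 y
  have dc : Continuous (deriv η) := cη1.continuous_deriv (by norm_num)
  obtain ⟨Cη, hCη⟩ := (isCompact_Icc (a := (-1:ℝ)) (b := 0)).exists_bound_of_continuousOn dc.continuousOn
  have Θm : Monotone Θ := monotone_of_deriv_nonneg (fun x => (hΘ' x).differentiableAt)
    (fun x => by rw [(hΘ' x).deriv]; exact η0 x)
  have Θz : Θ 0 = 0 := by simp [hΘ]
  have Θr : ∀ x, 0 ≤ x → Θ x = 0 := by
    intro x hx
    have : ∫ y in (0:ℝ)..x, η y = ∫ y in (0:ℝ)..x, 0 := by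
      apply intervalIntegral.integral_congr
      intro y hy
      rw [uIcc_of_le hx] at hy
      exact ηr y hy.1
    simp only [hΘ]; rw [this]; simp
  have Θn : ∀ x, Θ x ≤ 0 := fun x => by
    rcases le_total x 0 with h | h
    · rw [← Θz]; exact Θm h
    · exact (Θr x h).le
  have Θa : Antitone (fun x => Θ x - x) := by
    apply antitone_of_deriv_nonpos (fun x => ((hΘ' x).sub (hasDerivAt_id x)).differentiableAt)
    intro x
    have := ((hΘ' x).sub (hasDerivAt_id x)).deriv
    rw [this]; linarith [η1 x]
  refine ⟨Θ, η, deriv η, max Cη 0, le_max_right _ _, ?_, hΘ', fun x => (ηd x).hasDerivAt, η0, ?_, d0,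
    fun x hx => ⟨ηr x hx, d1 x hx, Θr x hx⟩, Θn, ?_, ?_⟩
  · have : ContDiff ℝ (1 + 1) Θ := by
      rw [contDiff_succ_iff_deriv]
      refine ⟨fun x => (hΘ' x).differentiableAt, by simp, ?_⟩
      have : deriv Θ = η := funext fun x => (hΘ' x).deriv
      rw [this]; exact cη1
    exact this.of_le (by norm_num [one_add_one_eq_two])
  · intro x
    by_cases h : x ∈ Icc (-1:ℝ) 0
    · have := hCη x h
      rw [Real.norm_eq_abs] at this
      linarith [neg_abs_le (deriv η x), le_max_left Cη 0]
    · have : deriv η x = 0 := by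
        rcases lt_or_ge x (-1) with h1 | h1
        · exact d0 x h1
        · apply d1; by_contra h2; exact h ⟨h1, by linarith⟩
      rw [this]; linarith [le_max_right Cη 0]
  · intro x
    rcases le_total x (-1) with h | h
    · have : ∫ y in x..(-1:ℝ), η y = ∫ y in x..(-1:ℝ), 1 := by
        apply intervalIntegral.integral_congr
        intro y hy
        rw [uIcc_of_le h] at hy
        exact ηl y hy.2
      have h2 : Θ (-1) - Θ x = ∫ y in x..(-1:ℝ), η y := by
        simp only [hΘ]
        rw [intervalIntegral.integral_interval_sub_left] <;>
        exact cη.continuous.intervalIntegrable _ _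
      rw [this] at h2
      simp at h2
      linarith [Θn (-1)]
    · linarith [Θn x]
  · intro x
    rcases le_total x 0 with h | h
    · have := Θa h
      simp only [Θz] at this
      rw [min_eq_left h]; linarith
    · rw [min_eq_right h, Θr x h]

/-- hermitian form -/
noncomputable def BJ {E : Type*} [NormedAddCommGroup E] [InnerProductSpace ℝ E] (K : E →L[ℝ] E) :
    E →L[ℝ] E →L[ℝ] ℝ := Bin E + (Bin E).bilinearComp K K

lemma BJ_apply {E : Type*} [NormedAddCommGroup E] [InnerProductSpace ℝ E] (K : E →L[ℝ] E) (v w : E) :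
    BJ K v w = inner ℝ v w + inner ℝ (K v) (K w) := rfl

lemma BJ_symm {E : Type*} [NormedAddCommGroup E] [InnerProductSpace ℝ E] (K : E →L[ℝ] E) (v w : E) :
    BJ K v w = BJ K w v := by
  simp [BJ_apply, real_inner_comm]

lemma BJ_ge {E : Type*} [NormedAddCommGroup E] [InnerProductSpace ℝ E] (K : E →L[ℝ] E) (v : E) :
    ‖v‖ ^ 2 ≤ BJ K v v := by
  simp only [BJ_apply, real_inner_self_eq_norm_sq]
  linarith [sq_nonneg ‖K v‖]

lemma BJ_nonneg {E : Type*} [NormedAddCommGroup E] [InnerProductSpace ℝ E] (K : E →L[ℝ] E) (v : E) :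
    0 ≤ BJ K v v := (sq_nonneg _).trans (BJ_ge K v)

lemma BJ_le {E : Type*} [NormedAddCommGroup E] [InnerProductSpace ℝ E] (K : E →L[ℝ] E) (v : E)
    (C : ℝ) (h0 : 0 ≤ C) (hK : ‖K‖ ≤ C) : BJ K v v ≤ (1 + C) ^ 2 * ‖v‖ ^ 2 := by
  simp only [BJ_apply, real_inner_self_eq_norm_sq]
  have := K.le_of_opNorm_le hK v
  have : ‖K v‖ ^ 2 ≤ (C * ‖v‖) ^ 2 := by gcongr
  nlinarith [mul_nonneg h0 (sq_nonneg ‖v‖)]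

lemma BJ_cs {E : Type*} [NormedAddCommGroup E] [InnerProductSpace ℝ E] (K : E →L[ℝ] E) (v w : E) :
    (BJ K v w) ^ 2 ≤ BJ K v v * BJ K w w := by
  have key : ∀ t : ℝ, 0 ≤ BJ K w w * (t * t) + (2 * BJ K v w) * t + BJ K v v := by
    intro t
    have h := BJ_nonneg K (v + t • w)
    simp only [map_add, map_smul, add_apply, smul_apply, smul_eq_mul, BJ_symm K w v] at h
    linarith
  have := discrim_le_zero key
  rw [discrim] at this
  nlinarith

lemma BJ_bessel {E : Type*} [NormedAddCommGroup E] [InnerProductSpace ℝ E] (K : E →L[ℝ] E)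
    (hK : ∀ v, K (K v) = -v) (k v : E) :
    (BJ K k v) ^ 2 + (BJ K k (K v)) ^ 2 ≤ BJ K k k * BJ K v v := by
  have o : BJ K v (K v) = 0 := by
    simp only [BJ_apply, hK, inner_neg_right]
    rw [real_inner_comm v (K v)]; ring
  have n : BJ K (K v) (K v) = BJ K v v := by
    simp only [BJ_apply, hK, inner_neg_right, inner_neg_left]
    ring
  set a := BJ K k v
  set b := BJ K k (K v)
  have h := BJ_cs K k (a • v + b • K v)
  simp only [map_add, map_smul, add_apply, smul_apply, smul_eq_mul, BJ_symm K (K v) v, o, n] at h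
  have h' : (a ^ 2 + b ^ 2) * (a ^ 2 + b ^ 2) ≤ (BJ K k k * BJ K v v) * (a ^ 2 + b ^ 2) := by
    nlinarith
  by_contra hc
  push Not at hc
  have : 0 ≤ BJ K k k * BJ K v v := mul_nonneg (BJ_nonneg _ _) (BJ_nonneg _ _)
  nlinarith

lemma real_key (C0 A r m P Q : ℝ) (hC0 : 0 < C0) (hA : A = 12 * C0) (hr : 0 < r) (h9 : 9 * C0 * r ≤ 1)
    (hm : 0 ≤ m) (hP : P ≤ r ^ 2 * m * (1 + C0 * r)) (hQ : 2 * m * (1 - C0 * r) ≤ Q) :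
    0 ≤ 4 * (-1 / r ^ 4 - A / (4 * r ^ 3)) * P + 2 * (1 / r ^ 2 + A / (2 * r)) * Q := by
  have a1 : 0 ≤ 1 / r ^ 4 + A / (4 * r ^ 3) := by rw [hA]; positivity
  have a2 : 0 ≤ 1 / r ^ 2 + A / (2 * r) := by rw [hA]; positivity
  have h1 : 4 * (1 / r ^ 4 + A / (4 * r ^ 3)) * P ≤
    4 * (1 / r ^ 4 + A / (4 * r ^ 3)) * (r ^ 2 * m * (1 + C0 * r)) := by gcongr
  have h2 : 2 * (1 / r ^ 2 + A / (2 * r)) * (2 * m * (1 - C0 * r)) ≤ 2 * (1 / r ^ 2 + A / (2 * r)) * Q := by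
    gcongr
  have h3 : 2 * (1 / r ^ 2 + A / (2 * r)) * (2 * m * (1 - C0 * r)) -
      4 * (1 / r ^ 4 + A / (4 * r ^ 3)) * (r ^ 2 * m * (1 + C0 * r)) =
      4 * m * (C0 / r) * (1 - 9 * C0 * r) := by
    rw [hA]; field_simp; ring
  have h4 : 0 ≤ 4 * m * (C0 / r) * (1 - 9 * C0 * r) := by
    have : 0 ≤ 1 - 9 * C0 * r := by linarith
    positivity
  have h5 : -1 / r ^ 4 - A / (4 * r ^ 3) = -(1 / r ^ 4 + A / (4 * r ^ 3)) := by ring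
  rw [h5]
  linarith

set_option maxHeartbeats 400000 in
lemma PQ_bounds {E : Type*} [NormedAddCommGroup E] [InnerProductSpace ℝ E]
    (J : E → E →L[ℝ] E) (q y v : E) (C r : ℝ) (hC : 0 ≤ C) (hK : ∀ v, J q (J q v) = -v)
    (h0 : ‖J q‖ ≤ C)
    (h1 : ‖J y‖ ≤ C) (h2 : ‖fderiv ℝ J y‖ ≤ C) (h3 : ‖J y - J q‖ ≤ C * ‖y - q‖)
    (hr : 0 ≤ r) (hr1 : r ≤ 1) (hs : BJ (J q) (y - q) (y - q) ≤ r ^ 2) :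
    (BJ (J q) (y - q) v) ^ 2 + (BJ (J q) (y - q) (J y v)) ^ 2
      ≤ r ^ 2 * BJ (J q) v v * (1 + 3 * (1 + C) ^ 4 * r) ∧
    2 * BJ (J q) v v * (1 - 3 * (1 + C) ^ 4 * r) ≤ BJ (J q) v v + BJ (J q) (J y v) (J y v) +
    BJ (J q) (y - q) (fderiv ℝ J y (J y v) v - fderiv ℝ J y v (J y v)) := by
  set k := y - q
  set m := BJ (J q) v v with hm
  have hm0 : 0 ≤ m := BJ_nonneg _ _
  have hkr : ‖k‖ ≤ r := by
    have := BJ_ge (J q) k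
    exact abs_le_of_sq_le_sq' (this.trans hs) hr |>.2
  have hv : ‖v‖ ^ 2 ≤ m := BJ_ge _ _
  -- basic CS
  set M := Real.sqrt m with hM
  have hMs : M ^ 2 = m := Real.sq_sqrt hm0
  have hM0 : 0 ≤ M := Real.sqrt_nonneg _
  have hvM : ‖v‖ ≤ M := Real.le_sqrt_of_sq_le hv
  have cs : ∀ (x w : E) (a : ℝ), 0 ≤ a → BJ (J q) x x ≤ a ^ 2 → |BJ (J q) x w| ≤ a * ((1 + C) * ‖w‖) := by
    intro x w a ha hx
    apply abs_le_of_sq_le_sq _ (by positivity)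
    refine (BJ_cs (J q) x w).trans ?_
    have := BJ_le (J q) w C hC h0
    have := BJ_nonneg (J q) w
    calc _ ≤ a ^ 2 * ((1 + C) ^ 2 * ‖w‖ ^ 2) := by gcongr
      _ = _ := by ring
  set d := J y v - J q v with hd
  have hdn : ‖d‖ ≤ C * r * M := by
    have : d = (J y - J q) v := by simp [hd]
    rw [this]
    refine ((J y - J q).le_opNorm v).trans ?_
    have : ‖J y - J q‖ ≤ C * r := h3.trans (by gcongr)
    gcongr
  have hJy : J y v = J q v + d := by simp [hd]
  have b1 := cs k d r hr hs
  have b1' : |BJ (J q) k d| ≤ r * ((1 + C) * (C * r * M)) := b1.trans (by gcongr)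
  have bes := BJ_bessel (J q) hK k v
  have bes' : (BJ (J q) k v) ^ 2 + (BJ (J q) k (J q v)) ^ 2 ≤ r ^ 2 * m := bes.trans (by gcongr)
  have b2 : |BJ (J q) k (J q v)| ≤ r * M := by
    apply abs_le_of_sq_le_sq _ (by positivity)
    rw [mul_pow, hMs]; nlinarith [sq_nonneg (BJ (J q) k v)]
  have n : BJ (J q) (J q v) (J q v) = m := by
    simp only [hm, BJ_apply, hK, inner_neg_right, inner_neg_left]
    ring
  have hC4 : 2 * ((1 + C) * C) + ((1 + C) * C) ^ 2 ≤ 3 * (1 + C) ^ 4 := by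
    have : 0 ≤ C ^ 3 := by positivity
    have : 0 ≤ C ^ 4 := by positivity
    nlinarith
  have hC5 : (1 + C) * C + (1 + C) * C ^ 2 ≤ 3 * (1 + C) ^ 4 := by
    have : 0 ≤ C ^ 3 := by positivity
    have : 0 ≤ C ^ 4 := by positivity
    nlinarith
  constructor
  · have e : BJ (J q) k (J y v) = BJ (J q) k (J q v) + BJ (J q) k d := by rw [hJy, map_add]
    rw [e]
    have c1 : BJ (J q) k (J q v) * BJ (J q) k d ≤ (r * M) * (r * ((1 + C) * (C * r * M))) := by
      refine (le_abs_self _).trans ?_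
      rw [abs_mul]
      gcongr
    have c2 : (BJ (J q) k d) ^ 2 ≤ (r * ((1 + C) * (C * r * M))) ^ 2 := by
      rw [← sq_abs]; gcongr
    have c3 : 2 * ((r * M) * (r * ((1 + C) * (C * r * M)))) + (r * ((1 + C) * (C * r * M))) ^ 2 ≤
        r ^ 2 * m * (3 * (1 + C) ^ 4 * r) := by
      have : 2 * ((r * M) * (r * ((1 + C) * (C * r * M)))) + (r * ((1 + C) * (C * r * M))) ^ 2
        = r ^ 2 * m * (2 * ((1 + C) * C) * r + ((1 + C) * C) ^ 2 * (r * r)) := by rw [← hMs]; ring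
      rw [this]
      have : r * r ≤ r := by nlinarith
      have : 2 * ((1 + C) * C) * r + ((1 + C) * C) ^ 2 * (r * r) ≤ 3 * (1 + C) ^ 4 * r := by
        calc _ ≤ 2 * ((1 + C) * C) * r + ((1 + C) * C) ^ 2 * r := by gcongr
          _ = (2 * ((1 + C) * C) + ((1 + C) * C) ^ 2) * r := by ring
          _ ≤ _ := by gcongr
      gcongr
    have c4 : r ^ 2 * m * (1 + 3 * (1 + C) ^ 4 * r) = r ^ 2 * m + r ^ 2 * m * (3 * (1 + C) ^ 4 * r) := by ring
    rw [c4, add_sq]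
    linarith
  · have e : BJ (J q) (J y v) (J y v) = m + 2 * BJ (J q) (J q v) d + BJ (J q) d d := by
      rw [hJy]
      simp only [map_add, add_apply, n, BJ_symm (J q) d (J q v)]
      ring
    have c1 := cs (J q v) d M hM0 (by rw [n, hMs])
    have c1' : |BJ (J q) (J q v) d| ≤ M * ((1 + C) * (C * r * M)) := c1.trans (by gcongr)
    have c2 := BJ_nonneg (J q) d
    have hJv : ‖J y v‖ ≤ C * ‖v‖ := (J y).le_of_opNorm_le h1 v
    have a1 : ‖fderiv ℝ J y (J y v) v‖ ≤ C * (C * ‖v‖) * ‖v‖ := by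
      have := (fderiv ℝ J y).le_opNorm (J y v)
      have h3 := (fderiv ℝ J y (J y v)).le_opNorm v
      have : ‖fderiv ℝ J y (J y v)‖ ≤ C * (C * ‖v‖) := this.trans (by gcongr)
      exact h3.trans (by gcongr)
    have a2 : ‖fderiv ℝ J y v (J y v)‖ ≤ C * ‖v‖ * (C * ‖v‖) := by
      have := (fderiv ℝ J y).le_opNorm v
      have h3 := (fderiv ℝ J y v).le_opNorm (J y v)
      have : ‖fderiv ℝ J y v‖ ≤ C * ‖v‖ := this.trans (by gcongr)
      exact h3.trans (by gcongr)
    set R := fderiv ℝ J y (J y v) v - fderiv ℝ J y v (J y v)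
    have a3 : ‖R‖ ≤ 2 * C ^ 2 * m := by
      have := norm_sub_le (fderiv ℝ J y (J y v) v) (fderiv ℝ J y v (J y v))
      have : ‖R‖ ≤ 2 * C ^ 2 * ‖v‖ ^ 2 := by nlinarith
      exact this.trans (by gcongr)
    have a4 := (cs k R r hr hs).trans (show r * ((1 + C) * ‖R‖) ≤ r * ((1 + C) * (2 * C ^ 2 * m)) by gcongr)
    rw [e]
    have l1 := neg_abs_le (BJ (J q) (J q v) d)
    have l2 := neg_abs_le (BJ (J q) k R)
    have l3 : M * ((1 + C) * (C * r * M)) = (1 + C) * C * r * m := by rw [← hMs]; ring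
    have l4 : ((1 + C) * C + (1 + C) * C ^ 2) * (r * m) ≤ 3 * (1 + C) ^ 4 * (r * m) := by gcongr
    have l5 : r * ((1 + C) * (2 * C ^ 2 * m)) = 2 * ((1 + C) * C ^ 2 * (r * m)) := by ring
    rw [l3] at c1'
    rw [l5] at a4
    have l6 : 2 * m * (1 - 3 * (1 + C) ^ 4 * r) = 2 * m - 2 * (3 * (1 + C) ^ 4 * (r * m)) := by ring
    have l7 : ((1 + C) * C + (1 + C) * C ^ 2) * (r * m) = (1 + C) * C * r * m + (1 + C) * C ^ 2 * (r * m) := by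
      ring
    rw [l6]
    rw [l7] at l4
    linarith



set_option maxHeartbeats 1600000 in
lemma exists_phi {E : Type*} [NormedAddCommGroup E] [InnerProductSpace ℝ E]
    (W : Set E) (J : E → E →L[ℝ] E) (C κ0 : ℝ) (hC : 0 ≤ C) (hκ0 : 0 < κ0)
    (hJ2 : ∀ y ∈ W, ∀ v, J y (J y v) = -v)
    (h1 : ∀ y ∈ W, ‖J y‖ ≤ C) (h2 : ∀ y ∈ W, ‖fderiv ℝ J y‖ ≤ C)
    (h3 : ∀ y ∈ W, ∀ q ∈ W, ‖J y - J q‖ ≤ C * ‖y - q‖) :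
    ∃ κ C1 A : ℝ, 0 < κ ∧ κ ≤ κ0 ∧ 0 ≤ C1 ∧ 0 ≤ A ∧ ∀ q ∈ W, ∀ τ : ℝ, 0 < τ →
      ∃ ϕ ϕ1 ϕ2 : ℝ → ℝ, (∀ s, 0 ≤ s → ContDiffAt ℝ 2 ϕ s) ∧
        (∀ s, 0 ≤ s → HasDerivAt ϕ (ϕ1 s) s) ∧ (∀ s, 0 ≤ s → HasDerivAt ϕ1 (ϕ2 s) s) ∧
        (∀ s, ϕ s ≤ 0) ∧ (∀ s, κ ^ 2 ≤ s → ϕ s = 0) ∧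
        (∀ s, ϕ s ≤ 2 * Real.log √(s + τ ^ 2) + A * √(s + τ ^ 2) - 2 * Real.log κ + 1) ∧
        (∀ s, min (2 * Real.log √(s + τ ^ 2) - 2 * Real.log κ) 0 ≤ ϕ s) ∧
        (∀ y ∈ W, ∀ v, -C1 * ‖v‖ ^ 2 ≤ Lam J (BJ (J q)) q ϕ1 ϕ2 y v) := by
  obtain ⟨Θ, η, η', Cη, Cη0, Θ2, Θ', ηd, η0, ηn, ηl, ηr, Θ0, Θx, Θm⟩ := exists_theta
  set C0 : ℝ := 3 * (1 + C) ^ 4 with hC0d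
  have hC0 : 0 < C0 := by positivity
  set A : ℝ := 12 * C0 with hA
  have hA0 : 0 < A := by positivity
  set κ := min κ0 (min 1 (1 / (9 * C0))) with hκ
  have κp : 0 < κ := by positivity
  have κ1 : κ ≤ 1 := (min_le_right _ _).trans (min_le_left _ _)
  have κ9 : κ ≤ 1 / (9 * C0) := (min_le_right _ _).trans (min_le_right _ _)
  set r0 : ℝ := Real.exp (Real.log κ - 1 / 2 - A / 2) with hr0
  have r0p : 0 < r0 := Real.exp_pos _
  set S := (1 / r0 ^ 2 + A / (2 * r0)) ^ 2 with hS
  have S0 : 0 ≤ S := by positivity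
  refine ⟨κ, 4 * Cη * S * (2 * (1 + C) ^ 2), A, κp, min_le_left _ _, by positivity, hA0.le, ?_⟩
  intro q hq τ hτ
  set ρ : ℝ → ℝ := fun s => √(s + τ ^ 2) with hρ
  have ρp : ∀ s, 0 ≤ s → 0 < ρ s := fun s hs => Real.sqrt_pos.2 (by positivity)
  have ρ2 : ∀ s, 0 ≤ s → ρ s ^ 2 = s + τ ^ 2 := fun s hs => Real.sq_sqrt (by positivity)
  have ρ0 : ∀ s, 0 ≤ ρ s := fun s => Real.sqrt_nonneg _
  have ρd : ∀ s, 0 ≤ s → HasDerivAt ρ (1 / (2 * ρ s)) s := by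
    intro s hs
    exact ((hasDerivAt_id s).add_const (τ ^ 2)).sqrt (by simp; positivity)
  have ρc : ∀ s, 0 ≤ s → ContDiffAt ℝ 2 ρ s := by
    intro s hs
    exact (contDiffAt_id.add contDiffAt_const).sqrt (by simp; positivity)
  set X : ℝ → ℝ := fun s => 2 * Real.log (ρ s) + A * ρ s - 2 * Real.log κ with hX
  set ψ1 : ℝ → ℝ := fun s => 1 / ρ s ^ 2 + A / (2 * ρ s) with hψ1
  set ψ2 : ℝ → ℝ := fun s => -1 / ρ s ^ 4 - A / (4 * ρ s ^ 3) with hψ2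
  have Xd : ∀ s, 0 ≤ s → HasDerivAt X (ψ1 s) s := by
    intro s hs
    have hp := ρp s hs
    have := ((((ρd s hs).log hp.ne').const_mul 2).add ((ρd s hs).const_mul A)).sub_const (2 * Real.log κ)
    refine this.congr_deriv ?_
    simp only [hψ1]; field_simp
  have ψd : ∀ s, 0 ≤ s → HasDerivAt ψ1 (ψ2 s) s := by
    intro s hs
    have hp := ρp s hs
    have := (((ρd s hs).pow 2).inv (pow_ne_zero 2 hp.ne')).add
      (((ρd s hs).inv hp.ne').const_mul (A / 2))
    have e : ψ1 = (fun s => ((ρ ^ 2) s)⁻¹ + A / 2 * (ρ s)⁻¹) := by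
      funext s; simp only [hψ1, Pi.pow_apply]; rw [div_mul_eq_div_div]; ring
    rw [e]
    refine this.congr_deriv ?_
    simp only [hψ2, Pi.pow_apply]; field_simp; ring
  have Xc : ∀ s, 0 ≤ s → ContDiffAt ℝ 2 X s := by
    intro s hs
    exact (((contDiffAt_const (c := (2:ℝ))).mul ((ρc s hs).log (ρp s hs).ne')).add
      ((contDiffAt_const (c := A)).mul (ρc s hs))).sub contDiffAt_const
  refine ⟨fun s => Θ (X s), fun s => η (X s) * ψ1 s, fun s => η' (X s) * ψ1 s * ψ1 s + η (X s) * ψ2 s,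
    ?_, ?_, ?_, fun s => Θ0 _, ?_, fun s => ?_, fun s => ?_, ?_⟩
  · intro s hs
    exact Θ2.contDiffAt.comp s (Xc s hs)
  · intro s hs
    exact (Θ' (X s)).comp s (Xd s hs)
  · intro s hs
    exact ((ηd (X s)).comp s (Xd s hs)).mul (ψd s hs)
  · intro s hs
    refine (ηr _ ?_).2.2
    have hs0 : 0 ≤ s := (sq_nonneg κ).trans hs
    have : κ ≤ ρ s := Real.le_sqrt_of_sq_le (by nlinarith)
    have := Real.log_le_log κp this
    have := mul_nonneg hA0.le (ρ0 s)
    simp only [hX]; linarith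
  · exact Θx (X s)
  · refine (min_le_min_right 0 ?_).trans (Θm (X s))
    have := mul_nonneg hA0.le (ρ0 s)
    simp only [hX]
    linarith
  · intro y hy v
    set s := BJ (J q) (y - q) (y - q) with hs
    have hs0 : 0 ≤ s := BJ_nonneg _ _
    simp only [Lam]
    rw [← hs]
    set P := (BJ (J q) (y - q) v) ^ 2 + (BJ (J q) (y - q) (J y v)) ^ 2 with hP
    set Q := BJ (J q) v v + BJ (J q) (J y v) (J y v) +
      BJ (J q) (y - q) (fderiv ℝ J y (J y v) v - fderiv ℝ J y v (J y v)) with hQ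
    have hCn : 0 ≤ 4 * Cη * S * (2 * (1 + C) ^ 2) * ‖v‖ ^ 2 := by positivity
    rcases le_or_gt 0 (X s) with hx | hx
    · obtain ⟨e1, e2, -⟩ := ηr _ hx
      rw [e1, e2]; linarith
    have hρκ : ρ s < κ := by
      by_contra hc
      push Not at hc
      have := Real.log_le_log κp hc
      have := mul_nonneg hA0.le (ρ0 s)
      simp only [hX] at hx
      linarith
    have hp := ρp s hs0
    have hr1 : ρ s ≤ 1 := hρκ.le.trans κ1
    have h9 : 9 * C0 * ρ s ≤ 1 := by
      have : ρ s ≤ 1 / (9 * C0) := hρκ.le.trans κ9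
      rw [le_div_iff₀ (by positivity)] at this
      linarith
    obtain ⟨pb, qb⟩ := PQ_bounds J q y v C (ρ s) hC (hJ2 q hq) (h1 q hq) (h1 y hy) (h2 y hy) (h3 y hy q hq)
      hp.le hr1 (by rw [ρ2 s hs0]; nlinarith [sq_nonneg τ])
    have key := real_key C0 A (ρ s) (BJ (J q) v v) P Q hC0 hA hp h9 (BJ_nonneg _ _) pb qb
    have k2 : 0 ≤ η (X s) * (4 * ψ2 s * P + 2 * ψ1 s * Q) := mul_nonneg (η0 _) key
    have P0 : 0 ≤ P := by positivity
    have k3 : -(4 * Cη * S * (2 * (1 + C) ^ 2)) * ‖v‖ ^ 2 ≤ 4 * η' (X s) * (ψ1 s * ψ1 s) * P := by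
      rcases lt_or_ge (X s) (-1) with hx1 | hx1
      · rw [ηl _ hx1]; linarith
      have hr0l : r0 ≤ ρ s := by
        rw [hr0, ← Real.le_log_iff_exp_le hp]
        have : A * ρ s ≤ A := by nlinarith
        simp only [hX] at hx1
        linarith
      have hψS : ψ1 s * ψ1 s ≤ S := by
        have : ψ1 s ≤ 1 / r0 ^ 2 + A / (2 * r0) := by
          simp only [hψ1]; gcongr
        have h0 : 0 ≤ ψ1 s := by simp only [hψ1]; positivity
        rw [hS, sq]; gcongr
      have hPb : P ≤ 2 * (1 + C) ^ 2 * ‖v‖ ^ 2 := by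
        refine pb.trans ?_
        have := BJ_le (J q) v C hC (h1 q hq)
        have := BJ_nonneg (J q) v
        have : 1 + C0 * ρ s ≤ 2 := by nlinarith
        have h5 : ρ s ^ 2 ≤ 1 := pow_le_one₀ hp.le hr1
        calc _ ≤ 1 * ((1 + C) ^ 2 * ‖v‖ ^ 2) * 2 := by gcongr
          _ = _ := by ring
      have hsq : 0 ≤ ψ1 s * ψ1 s := mul_self_nonneg _
      have a : ψ1 s * ψ1 s * P ≤ S * (2 * (1 + C) ^ 2 * ‖v‖ ^ 2) := by gcongr
      have b : 0 ≤ ψ1 s * ψ1 s * P := by positivity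
      have c : -Cη * (ψ1 s * ψ1 s * P) ≤ η' (X s) * (ψ1 s * ψ1 s * P) := by
        gcongr; exact ηn _
      have d : Cη * (ψ1 s * ψ1 s * P) ≤ Cη * (S * (2 * (1 + C) ^ 2 * ‖v‖ ^ 2)) := by gcongr
      linarith
    linarith



lemma lapC_continuous (χ : ℂ → ℝ) (hχ : ContDiff ℝ 2 χ) : Continuous (lapC χ) := by
  have h : ContDiff ℝ 1 (fderiv ℝ χ) := hχ.fderiv_right (by norm_num)
  have h1 : ∀ e : ℂ, ContDiff ℝ 1 (fun w => fderiv ℝ χ w e) := fun e => h.clm_apply contDiff_const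
  have h2 : ∀ e : ℂ, Continuous (fun ζ => fderiv ℝ (fun w => fderiv ℝ χ w e) ζ e) := fun e =>
    ((h1 e).continuous_fderiv (by norm_num)).clm_apply continuous_const
  exact (h2 1).add (h2 I)

lemma lapC_zero (χ : ℂ → ℝ) (ζ : ℂ) (hζ : ζ ∉ tsupport χ) : lapC χ ζ = 0 := by
  have h : χ =ᶠ[𝓝 ζ] fun _ => 0 := notMem_tsupport_iff_eventuallyEq.1 hζ
  have h2 : ∀ e : ℂ, (fun w => fderiv ℝ χ w e) =ᶠ[𝓝 ζ] fun _ => 0 := by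
    intro e
    filter_upwards [h.fderiv (𝕜 := ℝ)] with w hw
    rw [hw]; simp
  simp [lapC, (h2 1).fderiv_eq, (h2 I).fderiv_eq]

lemma lapC_scale (β : ℂ → ℝ) (hβ : ContDiff ℝ 2 β) (a : ℝ) (ζ0 ζ : ℂ) :
    lapC (fun w => β (a • (w - ζ0))) ζ = a ^ 2 * lapC β (a • (ζ - ζ0)) := by
  have haff : ∀ w : ℂ, HasFDerivAt (fun w : ℂ => a • (w - ζ0)) (a • ContinuousLinearMap.id ℝ ℂ) w :=
    fun w => ((hasFDerivAt_id w).sub_const ζ0).const_smul a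
  have h1 : ∀ w e : ℂ, fderiv ℝ (fun w => β (a • (w - ζ0))) w e = a * fderiv ℝ β (a • (w - ζ0)) e := by
    intro w e
    have := ((hβ.differentiable (by norm_num)) (a • (w - ζ0))).hasFDerivAt.comp w (haff w)
    have e2 := this.fderiv
    have e3 : fderiv ℝ (fun w => β (a • (w - ζ0))) w = _ := e2
    rw [e3]; simp
  have h : ContDiff ℝ 1 (fderiv ℝ β) := hβ.fderiv_right (by norm_num)
  have h2 : ∀ e : ℂ, fderiv ℝ (fun w => fderiv ℝ (fun w => β (a • (w - ζ0))) w e) ζ e =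
      a ^ 2 * fderiv ℝ (fun w => fderiv ℝ β w e) (a • (ζ - ζ0)) e := by
    intro e
    have g1 : ContDiff ℝ 1 (fun w => fderiv ℝ β w e) := h.clm_apply contDiff_const
    have := (((g1.differentiable (by norm_num)) (a • (ζ - ζ0))).hasFDerivAt.comp ζ (haff ζ)).const_mul a
    have e2 := this.fderiv
    have e3 : (fun w => fderiv ℝ (fun w => β (a • (w - ζ0))) w e) =
      (fun y => a * ((fun w => fderiv ℝ β w e) ∘ fun w => a • (w - ζ0)) y) := by
      funext w; rw [h1]; rfl
    rw [e3, e2]; simp; ring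
  simp only [lapC, h2]; ring

lemma exists_bump : ∃ M : ℝ, 0 ≤ M ∧ ∀ (ζ0 : ℂ) (d : ℝ), 0 < d → ∃ χ : ℂ → ℝ, ContDiff ℝ 2 χ ∧
    HasCompactSupport χ ∧ tsupport χ ⊆ closedBall ζ0 d ∧ (∀ ζ, 0 ≤ χ ζ) ∧
    (∀ ζ ∈ closedBall ζ0 (d / 2), χ ζ = 1) ∧ ∀ ζ, |lapC χ ζ| ≤ M / d ^ 2 := by
  obtain ⟨β, b1, b2, b3, b4, b5⟩ := exists_cut (closedBall (0:ℂ) (1/2)) (ball 0 1)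
    (isCompact_closedBall _ _) isOpen_ball (closedBall_subset_ball (by norm_num))
  obtain ⟨M, hM⟩ := (show IsCompact (tsupport β) from b2).exists_bound_of_continuousOn
    (lapC_continuous β b1).continuousOn
  have hM' : ∀ ζ, |lapC β ζ| ≤ max M 0 := by
    intro ζ
    by_cases h : ζ ∈ tsupport β
    · exact (hM ζ h).trans (le_max_left _ _)
    · rw [lapC_zero β ζ h]; simp
  refine ⟨max M 0, le_max_right _ _, ?_⟩
  intro ζ0 d hd
  set χ : ℂ → ℝ := fun w => β (d⁻¹ • (w - ζ0)) with hχ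
  have ts : tsupport χ ⊆ closedBall ζ0 d := by
    apply closure_minimal _ isClosed_closedBall
    intro ζ hζ
    have : d⁻¹ • (ζ - ζ0) ∈ ball (0:ℂ) 1 := b3 (subset_tsupport _ hζ)
    rw [mem_ball_zero_iff, norm_smul, Real.norm_of_nonneg (by positivity), inv_mul_lt_iff₀ hd] at this
    rw [mem_closedBall, dist_eq_norm]; linarith
  refine ⟨χ, ?_, (isCompact_closedBall ζ0 d).of_isClosed_subset (isClosed_tsupport _) ts, ts,
    fun ζ => b5 _, ?_, ?_⟩
  · exact b1.comp ((contDiff_id.sub contDiff_const).const_smul _)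
  · intro ζ hζ
    refine (b4 _ ?_).1
    rw [mem_closedBall, dist_eq_norm] at hζ
    rw [mem_closedBall_zero_iff, norm_smul, Real.norm_of_nonneg (by positivity), inv_mul_le_iff₀ hd]
    linarith
  · intro ζ
    rw [hχ, lapC_scale β b1, abs_mul, abs_of_nonneg (by positivity)]
    have := hM' (d⁻¹ • (ζ - ζ0))
    calc _ ≤ (d⁻¹) ^ 2 * max M 0 := by gcongr
      _ = _ := by rw [inv_pow]; field_simp

/-- constants for bump functions -/
def BumpConst (M : ℝ) : Prop := 0 ≤ M ∧ (∀ (ζ0 : ℂ) (d : ℝ), 0 < d → ∃ χ : ℂ → ℝ, ContDiff ℝ 2 χ ∧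
    HasCompactSupport χ ∧ tsupport χ ⊆ closedBall ζ0 d ∧ (∀ ζ, 0 ≤ χ ζ) ∧
    (∀ ζ ∈ closedBall ζ0 (d / 2), χ ζ = 1) ∧ ∀ ζ, |lapC χ ζ| ≤ M / d ^ 2)

lemma caccioppoli {E : Type*} [NormedAddCommGroup E] [InnerProductSpace ℝ E]
    [FiniteDimensional ℝ E] (M : ℝ) (hMb : BumpConst M)
    (O : Set ℂ) (hO : IsOpen O) (F : ℂ → E) (W : Set E) (hW : IsOpen W)
    (hFW : MapsTo F O W) (J : E → E →L[ℝ] E) (hJ : ContDiffOn ℝ 1 J W)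
    (hJ2 : ∀ y ∈ W, ∀ v, J y (J y v) = -v)
    (hF : ∀ ζ ∈ O, DifferentiableAt ℝ F ζ) (hFJ : ∀ ζ ∈ O, fderiv ℝ F ζ I = J (F ζ) (fderiv ℝ F ζ 1))
    (he : LocallyIntegrableOn (fun ζ => ‖fderiv ℝ F ζ‖ ^ 2) O) (C δ : ℝ) (hC : 0 ≤ C)
    (h1 : ∀ y ∈ W, ‖J y‖ ≤ C) (h2 : ∀ y ∈ W, ‖fderiv ℝ J y‖ ≤ C)
    (hδ : ∀ y ∈ W, ∀ q ∈ W, ‖y - q‖ ≤ δ) (hCδ : 4 * C ^ 2 * δ ≤ 1)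
    (ζ0 : ℂ) (d m : ℝ) (hd : 0 < d) (hdO : closedBall ζ0 d ⊆ O) (y0 : E) (hy0 : y0 ∈ W)
    (hm : ∀ ζ ∈ closedBall ζ0 d, ‖F ζ - y0‖ ≤ m) :
    ∫⁻ ζ in closedBall ζ0 (d / 2), ENNReal.ofReal (‖fderiv ℝ F ζ‖ ^ 2)
      ≤ ENNReal.ofReal (M * Real.pi * (1 + C) ^ 2 * m ^ 2) := by
  obtain ⟨hM, hb⟩ := hMb
  obtain ⟨χ, c1, c2, c3, c4, c5, c6⟩ := hb ζ0 d hd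
  obtain ⟨i1, i2⟩ := weak_Lam O hO F W hW hFW J hJ hJ2 hF hFJ he (Bin E)
    (fun v w => by simp [Bin_apply, real_inner_comm]) (fun v => by simp [Bin_apply]) y0
    (fun s => s) (fun _ => 1) (fun _ => 0) (fun s _ => contDiffAt_id) (fun s _ => hasDerivAt_id s)
    (fun s _ => hasDerivAt_const s 1) χ c1 c2 (c3.trans hdO)
  have hLam : ∀ ζ ∈ O, ‖fderiv ℝ F ζ 1‖ ^ 2 ≤
      Lam J (Bin E) y0 (fun _ => 1) (fun _ => 0) (F ζ) (fderiv ℝ F ζ 1) := fun ζ hζ =>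
    Lam_sq J y0 (F ζ) _ C δ hC (h1 _ (hFW hζ)) (h2 _ (hFW hζ)) (hδ _ (hFW hζ) _ hy0) hCδ
  have hdF : ∀ ζ ∈ O, ‖fderiv ℝ F ζ‖ ^ 2 ≤ (1 + C) ^ 2 * ‖fderiv ℝ F ζ 1‖ ^ 2 := by
    intro ζ hζ
    rw [← mul_pow]
    gcongr
    apply ContinuousLinearMap.opNorm_le_bound _ (by positivity)
    intro x
    have : fderiv ℝ F ζ x = x.re • fderiv ℝ F ζ 1 + x.im • J (F ζ) (fderiv ℝ F ζ 1) := by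
      rw [← hFJ ζ hζ, ← map_smul, ← map_smul, ← map_add]
      congr 1
      apply Complex.ext <;> simp
    rw [this]
    have hJv := (J (F ζ)).le_of_opNorm_le (h1 _ (hFW hζ)) (fderiv ℝ F ζ 1)
    calc _ ≤ ‖x.re • fderiv ℝ F ζ 1‖ + ‖x.im • J (F ζ) (fderiv ℝ F ζ 1)‖ := norm_add_le _ _
      _ ≤ ‖x‖ * ‖fderiv ℝ F ζ 1‖ + ‖x‖ * (C * ‖fderiv ℝ F ζ 1‖) := by
        rw [norm_smul, norm_smul]
        have := abs_re_le_norm x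
        have := abs_im_le_norm x
        simp only [Real.norm_eq_abs]
        gcongr
      _ = _ := by ring
  have mF : Measurable (fun ζ => ‖fderiv ℝ F ζ‖ ^ 2) := (measurable_fderiv ℝ F).norm.pow_const 2
  have cont := c1.continuous
  have ptw : ∀ ζ, χ ζ * ‖fderiv ℝ F ζ‖ ^ 2 ≤
      (1 + C) ^ 2 * (χ ζ * Lam J (Bin E) y0 (fun _ => 1) (fun _ => 0) (F ζ) (fderiv ℝ F ζ 1)) := by
    intro ζ
    by_cases h : ζ ∈ tsupport χ
    · have hζ := hdO (c3 h)
      have := (hdF ζ hζ).trans (mul_le_mul_of_nonneg_left (hLam ζ hζ) (by positivity))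
      have := mul_le_mul_of_nonneg_left this (c4 ζ)
      linarith
    · simp [image_eq_zero_of_notMem_tsupport h]
  have int1 : Integrable (fun ζ => χ ζ * ‖fderiv ℝ F ζ‖ ^ 2) := by
    refine Integrable.mono' (i1.const_mul ((1 + C) ^ 2)) (cont.measurable.mul mF).aestronglyMeasurable ?_
    refine Eventually.of_forall fun ζ => ?_
    rw [Real.norm_of_nonneg (mul_nonneg (c4 ζ) (by positivity))]
    exact ptw ζ
  have up : ∫ ζ, χ ζ * ‖fderiv ℝ F ζ‖ ^ 2 ≤ M * Real.pi * (1 + C) ^ 2 * m ^ 2 := by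
    have u1 : ∫ ζ, χ ζ * ‖fderiv ℝ F ζ‖ ^ 2 ≤ (1 + C) ^ 2 *
        ∫ ζ, (Bin E (F ζ - y0) (F ζ - y0)) * lapC χ ζ := by
      rw [i2, ← integral_const_mul]
      exact integral_mono int1 (i1.const_mul _) ptw
    have u2 : ∫ ζ, (Bin E (F ζ - y0) (F ζ - y0)) * lapC χ ζ ≤ M * Real.pi * m ^ 2 := by
      have e : ∫ ζ, (Bin E (F ζ - y0) (F ζ - y0)) * lapC χ ζ =
          ∫ ζ in closedBall ζ0 d, (Bin E (F ζ - y0) (F ζ - y0)) * lapC χ ζ := by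
        symm
        apply setIntegral_eq_integral_of_forall_compl_eq_zero
        intro ζ hζ
        rw [lapC_zero χ ζ (fun h => hζ (c3 h)), mul_zero]
      rw [e]
      have b : ‖∫ ζ in closedBall ζ0 d, (Bin E (F ζ - y0) (F ζ - y0)) * lapC χ ζ‖ ≤
          (m ^ 2 * (M / d ^ 2)) * volume.real (closedBall ζ0 d) := by
        apply norm_setIntegral_le_of_norm_le_const measure_closedBall_lt_top
        intro ζ hζ
        rw [norm_mul, Bin_apply, real_inner_self_eq_norm_sq, norm_pow, norm_norm]
        have := hm ζ hζ
        have := c6 ζ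
        rw [← Real.norm_eq_abs] at this
        gcongr
      refine (Real.le_norm_self _).trans (b.trans (le_of_eq ?_))
      have : volume.real (closedBall ζ0 d) = d ^ 2 * Real.pi := by
        rw [Measure.real, Complex.volume_closedBall]
        simp [hd.le]
      rw [this]; field_simp
    calc _ ≤ (1 + C) ^ 2 * (M * Real.pi * m ^ 2) := u1.trans (by gcongr)
      _ = _ := by ring
  calc ∫⁻ ζ in closedBall ζ0 (d / 2), ENNReal.ofReal (‖fderiv ℝ F ζ‖ ^ 2)
      = ∫⁻ ζ in closedBall ζ0 (d / 2), ENNReal.ofReal (χ ζ * ‖fderiv ℝ F ζ‖ ^ 2) := by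
        apply setLIntegral_congr_fun measurableSet_closedBall
        intro ζ hζ
        simp only [c5 ζ hζ, one_mul]
    _ ≤ ∫⁻ ζ, ENNReal.ofReal (χ ζ * ‖fderiv ℝ F ζ‖ ^ 2) := setLIntegral_le_lintegral _ _
    _ = ENNReal.ofReal (∫ ζ, χ ζ * ‖fderiv ℝ F ζ‖ ^ 2) := by
        rw [ofReal_integral_eq_lintegral_ofReal int1]
        exact Eventually.of_forall fun ζ => mul_nonneg (c4 ζ) (by positivity)
    _ ≤ _ := ENNReal.ofReal_le_ofReal up



lemma baire_step {E : Type*} [NormedAddCommGroup E] [NormedSpace ℝ E]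
    (G Z : Set ℂ) (hG : IsOpen G) (hZ : IsClosed Z) (F : ℂ → E)
    (hF : ∀ ζ ∈ G, DifferentiableAt ℝ F ζ) (hne : (G ∩ Z).Nonempty) :
    ∃ ζ1 ∈ G ∩ Z, ∃ s : ℝ, 0 < s ∧ ∃ k : ℝ, 0 ≤ k ∧ ball ζ1 s ⊆ G ∧
      ∀ ζ ∈ G ∩ Z, ζ ∈ ball ζ1 s → ∀ ξ ∈ ball ζ1 s, ‖F ξ - F ζ‖ ≤ k * ‖ξ - ζ‖ := by
  have lc : IsLocallyClosed (G ∩ Z) := ⟨G, Z, hG, hZ, rfl⟩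
  have := lc.locallyCompactSpace
  have : Nonempty (G ∩ Z : Set ℂ) := hne.to_subtype
  let S : ℕ → Set (G ∩ Z : Set ℂ) := fun k =>
    {ζ | ∀ ξ ∈ G, 1 / ((k:ℝ) + 1) ≤ ‖ξ - ζ‖ ∨ ‖F ξ - F ζ‖ ≤ k * ‖ξ - ζ‖}
  have Fc : Continuous (fun ζ : (G ∩ Z : Set ℂ) => F ζ) := by
    rw [continuous_iff_continuousAt]
    intro ζ
    exact (hF ζ ζ.2.1).continuousAt.comp continuous_subtype_val.continuousAt
  have hS : ∀ k, IsClosed (S k) := by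
    intro k
    have : S k = ⋂ ξ ∈ G, ({ζ : (G ∩ Z : Set ℂ) | 1 / ((k:ℝ) + 1) ≤ ‖ξ - ζ‖} ∪ {ζ : (G ∩ Z : Set ℂ) | ‖F ξ - F ζ‖ ≤ k * ‖ξ - ζ‖}) := by
      ext ζ; simp [S]
    rw [this]
    refine isClosed_biInter fun ξ _ => IsClosed.union ?_ ?_
    · exact isClosed_le continuous_const (by fun_prop)
    · exact isClosed_le (continuous_const.sub Fc).norm (by fun_prop)
  have hU : ⋃ k, S k = univ := by
    rw [eq_univ_iff_forall]
    intro ζ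
    obtain ⟨c, hc⟩ := (hF ζ ζ.2.1).isBigO_sub.bound
    obtain ⟨ρ, hρ, hb⟩ := Metric.eventually_nhds_iff.1 hc
    obtain ⟨k1, hk1⟩ := exists_nat_gt c
    obtain ⟨k2, hk2⟩ := exists_nat_one_div_lt hρ
    rw [mem_iUnion]
    refine ⟨max k1 k2, fun ξ hξ => ?_⟩
    by_contra hcon
    push Not at hcon
    have l1 : 1 / (((max k1 k2 : ℕ):ℝ) + 1) ≤ 1 / ((k2:ℝ) + 1) := by
      gcongr; exact le_max_right _ _
    have := hb (show dist ξ ζ < ρ by rw [dist_eq_norm]; linarith [hcon.1])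
    have l2 : c ≤ ((max k1 k2 : ℕ):ℝ) := hk1.le.trans (by exact_mod_cast le_max_left _ _)
    have : c * ‖ξ - (ζ:ℂ)‖ ≤ ((max k1 k2 : ℕ):ℝ) * ‖ξ - (ζ:ℂ)‖ := by gcongr
    linarith [hcon.2]
  obtain ⟨k, ⟨ζ1, hζ1⟩⟩ := nonempty_interior_of_iUnion_of_closed hS hU
  rw [mem_interior_iff_mem_nhds, Metric.mem_nhds_iff] at hζ1
  obtain ⟨s1, hs1, hb1⟩ := hζ1
  obtain ⟨s2, hs2, hb2⟩ := Metric.isOpen_iff.1 hG ζ1 ζ1.2.1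
  refine ⟨ζ1, ζ1.2, min (min s1 s2) (1 / (2 * ((k:ℝ) + 1))), by positivity, k, by positivity, ?_, ?_⟩
  · exact (ball_subset_ball ((min_le_left _ _).trans (min_le_right _ _))).trans hb2
  · intro ζ hζ hζb ξ hξ
    have hξG : ξ ∈ G := hb2 (ball_subset_ball ((min_le_left _ _).trans (min_le_right _ _)) hξ)
    have m : (⟨ζ, hζ⟩ : (G ∩ Z : Set ℂ)) ∈ S k := hb1 (by
      rw [mem_ball] at hζb ⊢
      exact lt_of_lt_of_le hζb ((min_le_left _ _).trans (min_le_left _ _)))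
    rcases m ξ hξG with h | h
    · exfalso
      have a1 : dist ζ ζ1 < 1 / (2 * ((k:ℝ) + 1)) := lt_of_lt_of_le hζb (min_le_right _ _)
      have a2 : dist ξ ζ1 < 1 / (2 * ((k:ℝ) + 1)) := lt_of_lt_of_le hξ (min_le_right _ _)
      have a3 := dist_triangle_right ξ ζ ζ1
      rw [dist_eq_norm] at a3
      have a4 : 1 / (2 * ((k:ℝ) + 1)) + 1 / (2 * ((k:ℝ) + 1)) = 1 / ((k:ℝ) + 1) := by field_simp; norm_num
      simp only at h
      linarith
    · exact h

lemma vitali_step (e : ℂ → ℝ≥0∞) (t : Set ℂ) (ζ1 : ℂ) (R K : ℝ) (d : ℂ → ℝ) (hK : 0 ≤ K)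
    (ht : t ⊆ ball ζ1 R) (hd : ∀ ζ ∈ t, 0 < d ζ ∧ d ζ ≤ R)
    (he : ∀ ζ ∈ t, ∫⁻ ξ in closedBall ζ (d ζ / 4), e ξ ≤ ENNReal.ofReal (K * d ζ ^ 2)) :
    ∫⁻ ξ in t, e ξ < ⊤ := by
  obtain ⟨u, hut, hdisj, hcov⟩ := Vitali.exists_disjoint_subfamily_covering_enlargement_closedBall
    t id (fun ζ => d ζ / 20) R (fun a ha => by have := hd a ha; linarith) 5 (by norm_num)
  have hcount : u.Countable := hdisj.countable_of_nonempty_interior fun a ha => by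
    rw [id, interior_closedBall _ (by have := hd a (hut ha); intro h; linarith)]
    exact nonempty_ball.2 (by have := hd a (hut ha); linarith)
  have := hcount.to_subtype
  have sub : t ⊆ ⋃ b : u, closedBall (b:ℂ) (d b / 4) := by
    intro a ha
    obtain ⟨b, hb, hab⟩ := hcov a ha
    rw [mem_iUnion]
    refine ⟨⟨b, hb⟩, ?_⟩
    have := hab (mem_closedBall_self (by have := hd a ha; linarith))
    simp only [id] at this
    convert this using 2
    ring
  calc ∫⁻ ξ in t, e ξ ≤ ∫⁻ ξ in ⋃ b : u, closedBall (b:ℂ) (d b / 4), e ξ :=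
        lintegral_mono_set sub
    _ ≤ ∑' b : u, ∫⁻ ξ in closedBall (b:ℂ) (d b / 4), e ξ := lintegral_iUnion_le _ _
    _ ≤ ∑' b : u, ENNReal.ofReal (400 * K / Real.pi) * volume (closedBall (b:ℂ) (d b / 20)) := by
        refine ENNReal.tsum_le_tsum fun b => (he b (hut b.2)).trans (le_of_eq ?_)
        have hb := hd b (hut b.2)
        have e1 : volume (closedBall (b:ℂ) (d b / 20)) = ENNReal.ofReal ((d b / 20) ^ 2 * Real.pi) := by
          rw [Complex.volume_closedBall, ENNReal.ofReal_mul (by positivity), ENNReal.ofReal_pow (by linarith)]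
          congr 1
          rw [ENNReal.ofReal_eq_coe_nnreal Real.pi_pos.le]; rfl
        rw [e1, ← ENNReal.ofReal_mul (by positivity)]
        congr 1
        field_simp
        norm_num
    _ = ENNReal.ofReal (400 * K / Real.pi) * volume (⋃ b : u, closedBall (b:ℂ) (d b / 20)) := by
        rw [ENNReal.tsum_mul_left, measure_iUnion]
        · intro a b hab
          exact hdisj a.2 b.2 (fun h => hab (Subtype.ext h))
        · intro b; exact measurableSet_closedBall
    _ ≤ ENNReal.ofReal (400 * K / Real.pi) * volume (closedBall ζ1 (2 * R)) := by
        gcongr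
        apply iUnion_subset
        intro b
        have hb := hd b (hut b.2)
        have := ht (hut b.2)
        rw [mem_ball] at this
        apply closedBall_subset_closedBall'
        linarith
    _ < ⊤ := ENNReal.mul_lt_top ENNReal.ofReal_lt_top measure_closedBall_lt_top

lemma energy_locInt {E : Type*} [NormedAddCommGroup E] [InnerProductSpace ℝ E]
    [FiniteDimensional ℝ E]
    (G : Set ℂ) (hG : IsOpen G) (F : ℂ → E) (W : Set E) (hW : IsOpen W)
    (hFW : MapsTo F G W) (J : E → E →L[ℝ] E) (hJ : ContDiffOn ℝ 1 J W)
    (hJ2 : ∀ y ∈ W, ∀ v, J y (J y v) = -v)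
    (hF : ∀ ζ ∈ G, DifferentiableAt ℝ F ζ) (hFJ : ∀ ζ ∈ G, fderiv ℝ F ζ I = J (F ζ) (fderiv ℝ F ζ 1))
    (C δ : ℝ) (hC : 0 ≤ C)
    (h1 : ∀ y ∈ W, ‖J y‖ ≤ C) (h2 : ∀ y ∈ W, ‖fderiv ℝ J y‖ ≤ C)
    (hδ : ∀ y ∈ W, ∀ q ∈ W, ‖y - q‖ ≤ δ) (hCδ : 4 * C ^ 2 * δ ≤ 1) :
    LocallyIntegrableOn (fun ζ => ‖fderiv ℝ F ζ‖ ^ 2) G := by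
  obtain ⟨M, hM⟩ : ∃ M, BumpConst M := exists_bump
  set e : ℂ → ℝ := fun ζ => ‖fderiv ℝ F ζ‖ ^ 2 with he
  set T : Set ℂ := {ζ | IntegrableAtFilter e (𝓝 ζ)} with hT
  have Topen : IsOpen T := by
    rw [isOpen_iff_mem_nhds]
    rintro ζ ⟨s, hs, hi⟩
    filter_upwards [eventually_mem_nhds_iff.2 hs] with ξ hξ
    exact ⟨s, hξ, hi⟩
  suffices h : G ⊆ T by
    intro ζ hζ
    exact (h hζ : IntegrableAtFilter e (𝓝 ζ) volume).filter_mono nhdsWithin_le_nhds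
  by_contra hGT
  have hne : (G ∩ Tᶜ).Nonempty := by
    obtain ⟨x, hx, hx2⟩ := not_subset.1 hGT
    exact ⟨x, hx, hx2⟩
  obtain ⟨ζ1, hζ1, s, hs, k, hk, hsG, hlip⟩ := baire_step G Tᶜ hG Topen.isClosed_compl F hF hne
  have mF : Measurable e := (measurable_fderiv ℝ F).norm.pow_const 2
  apply hζ1.2
  refine ⟨ball ζ1 (s / 8), ball_mem_nhds _ (by positivity), mF.aestronglyMeasurable, ?_⟩
  rw [hasFiniteIntegral_iff_ofReal (Eventually.of_forall fun ζ => by positivity)]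
  set O : Set ℂ := G ∩ T with hOd
  have hO : IsOpen O := hG.inter Topen
  have heO : LocallyIntegrableOn e O := fun ζ hζ =>
    (hζ.2 : IntegrableAtFilter e (𝓝 ζ) volume).filter_mono nhdsWithin_le_nhds
  have hsub : ball ζ1 (s / 8) ⊆ (ball ζ1 (s / 8) ∩ T) ∪ (ball ζ1 (s / 8) ∩ Tᶜ) := by
    rw [← inter_union_distrib_left, union_compl_self, inter_univ]
  refine lt_of_le_of_lt ((lintegral_mono_set hsub).trans (lintegral_union_le _ _ _)) ?_
  refine ENNReal.add_lt_top.2 ⟨?_, ?_⟩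
  · set d : ℂ → ℝ := fun ζ => infDist ζ (G ∩ Tᶜ) with hd
    refine vitali_step _ _ ζ1 (s / 8) (M * Real.pi * (1 + C) ^ 2 * (k * (5 / 2)) ^ 2) d
      (by have := hM.1; positivity) inter_subset_left ?_ ?_
    · intro ζ hζ
      have hζG : ζ ∈ G := hsG (ball_subset_ball (by linarith) hζ.1)
      constructor
      · refine (infDist_pos_iff_notMem_closure hne).1 ?_
        intro hcl
        rw [_root_.mem_closure_iff] at hcl
        obtain ⟨x, hx1, hx2⟩ := hcl T Topen hζ.2
        exact hx2.2 hx1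
      · have := infDist_le_dist_of_mem (x := ζ) hζ1
        have h8 := hζ.1
        rw [mem_ball] at h8
        linarith
    · intro ζ hζ
      have hζG : ζ ∈ G := hsG (ball_subset_ball (by linarith) hζ.1)
      have hdp : 0 < d ζ := by
        refine (infDist_pos_iff_notMem_closure hne).1 ?_
        intro hcl
        rw [_root_.mem_closure_iff] at hcl
        obtain ⟨x, hx1, hx2⟩ := hcl T Topen hζ.2
        exact hx2.2 hx1
      have h8 : dist ζ ζ1 < s / 8 := hζ.1
      have hd8 : d ζ < s / 8 := lt_of_le_of_lt (infDist_le_dist_of_mem hζ1) h8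
      obtain ⟨ζ', hζ', hdist⟩ := (infDist_lt_iff hne).1 (show infDist ζ (G ∩ Tᶜ) < 2 * d ζ by
        change d ζ < 2 * d ζ; linarith)
      have hζ'b : ζ' ∈ ball ζ1 s := by
        rw [mem_ball]
        have := dist_triangle_left ζ' ζ1 ζ
        linarith
      have hballs : closedBall ζ (d ζ / 2) ⊆ ball ζ1 s := by
        intro ξ hξ
        rw [mem_closedBall] at hξ
        rw [mem_ball]
        have := dist_triangle ξ ζ ζ1
        linarith
      have hballO : closedBall ζ (d ζ / 2) ⊆ O := by
        intro ξ hξ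
        refine ⟨hsG (hballs hξ), ?_⟩
        by_contra hc
        have : d ζ ≤ dist ζ ξ := infDist_le_dist_of_mem (show ξ ∈ G ∩ Tᶜ from ⟨hsG (hballs hξ), hc⟩)
        rw [mem_closedBall, dist_comm] at hξ
        linarith
      have key := caccioppoli M hM O hO F W hW (hFW.mono_left inter_subset_left) J hJ hJ2
        (fun ζ hζ => hF ζ hζ.1) (fun ζ hζ => hFJ ζ hζ.1) heO C δ hC h1 h2 hδ hCδ ζ (d ζ / 2)
        (k * (5 / 2 * d ζ)) (by positivity) hballO (F ζ') (hFW hζ'.1) (by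
          intro ξ hξ
          refine (hlip ζ' hζ' hζ'b ξ (hballs hξ)).trans ?_
          rw [mem_closedBall] at hξ
          have := dist_triangle ξ ζ ζ'
          rw [dist_eq_norm ξ ζ'] at this
          gcongr
          linarith)
      have e1 : d ζ / 2 / 2 = d ζ / 4 := by ring
      rw [e1] at key
      refine key.trans (le_of_eq ?_)
      congr 1; ring
  · have hb : ∀ ξ ∈ ball ζ1 (s / 8) ∩ Tᶜ, ENNReal.ofReal (e ξ) ≤ ENNReal.ofReal (k ^ 2) := by
      intro ξ hξ
      have hξs : ξ ∈ ball ζ1 s := ball_subset_ball (by linarith) hξ.1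
      have hξG := hsG hξs
      apply ENNReal.ofReal_le_ofReal
      have : ‖fderiv ℝ F ξ‖ ≤ k := by
        refine (hF ξ hξG).hasFDerivAt.le_of_lip' hk ?_
        filter_upwards [isOpen_ball.mem_nhds hξs] with x hx
        exact hlip ξ ⟨hξG, hξ.2⟩ hξs x hx
      simp only [he]; gcongr
    refine lt_of_le_of_lt (setLIntegral_mono_ae' (measurableSet_ball.inter Topen.measurableSet.compl)
      (Eventually.of_forall hb)) ?_
    rw [setLIntegral_const]
    exact ENNReal.mul_lt_top ENNReal.ofReal_lt_top
      (lt_of_le_of_lt (measure_mono inter_subset_left) measure_ball_lt_top)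



/-- the profile `S(y-1)/y`. -/
noncomputable def prof (y : ℝ) : ℝ := Real.smoothTransition (y - 1) / y

lemma prof_contDiff : ContDiff ℝ 2 prof := by
  rw [contDiff_iff_contDiffAt]
  intro y
  by_cases hy : y < 1
  · have : prof =ᶠ[𝓝 y] fun _ => 0 := by
      filter_upwards [Iio_mem_nhds hy] with x hx
      have hx' : x < 1 := hx
      simp [prof, Real.smoothTransition.zero_of_nonpos (by linarith : x - 1 ≤ 0)]
    exact contDiffAt_const.congr_of_eventuallyEq this
  · unfold prof
    refine ContDiffAt.div ?_ contDiffAt_id (by show y ≠ 0; linarith)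
    exact (Real.smoothTransition.contDiff.contDiffAt).comp y (contDiffAt_id.sub contDiffAt_const)

lemma prof_mul (y : ℝ) : prof y * y = Real.smoothTransition (y - 1) := by
  by_cases hy : y = 0
  · subst hy
    simp [Real.smoothTransition.zero_of_nonpos (by norm_num : (-1:ℝ) ≤ 0)]
  · simp [prof, hy]

noncomputable def Phi (x : ℝ) : ℝ := ∫ y in (1:ℝ)..x, prof y

lemma Phi_hasDeriv (x : ℝ) : HasDerivAt Phi (prof x) x :=
  intervalIntegral.integral_hasDerivAt_right (prof_contDiff.continuous.intervalIntegrable _ _)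
    (prof_contDiff.continuous.stronglyMeasurableAtFilter _ _) prof_contDiff.continuous.continuousAt

lemma Phi_contDiff : ContDiff ℝ 2 Phi := by
  have h : deriv Phi = prof := funext fun x => (Phi_hasDeriv x).deriv
  have : ContDiff ℝ (1 + 1) Phi := by
    rw [contDiff_succ_iff_deriv]
    refine ⟨fun x => (Phi_hasDeriv x).differentiableAt, by simp, ?_⟩
    rw [h]; exact prof_contDiff.of_le (by norm_num)
  simpa [one_add_one_eq_two] using this

lemma prof_nonneg (y : ℝ) (hy : 0 < y) : 0 ≤ prof y :=
  div_nonneg (Real.smoothTransition.nonneg _) hy.le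

lemma Phi_mono (x y : ℝ) (hx : 0 < x) (hxy : x ≤ y) : Phi y - Real.log y ≤ Phi x - Real.log x := by
  have : AntitoneOn (fun x => Phi x - Real.log x) (Ioi 0) := by
    refine antitoneOn_of_hasDerivWithinAt_nonpos (f' := fun x => prof x - x⁻¹) (convex_Ioi 0) ?_ ?_ ?_
    · intro t ht
      exact ((Phi_hasDeriv t).sub (Real.hasDerivAt_log (ne_of_gt ht))).continuousAt.continuousWithinAt
    · intro t ht
      rw [interior_Ioi] at ht
      exact ((Phi_hasDeriv t).sub (Real.hasDerivAt_log (ne_of_gt ht))).hasDerivWithinAt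
    · intro t ht
      rw [interior_Ioi] at ht
      have ht' : 0 < t := ht
      simp only [prof, sub_nonpos, div_eq_mul_inv]
      exact mul_le_of_le_one_left (by positivity) (Real.smoothTransition.le_one _)
  exact this hx (lt_of_lt_of_le hx hxy : (0:ℝ) < y) hxy

lemma Phi_eq (x y : ℝ) (hx : 2 ≤ x) (hxy : x ≤ y) : Phi y - Real.log y = Phi x - Real.log x := by
  have : ∀ t ∈ Icc x y, Phi t - Real.log t = Phi x - Real.log x := by
    apply constant_of_has_deriv_right_zero
    · intro t ht
      have : 0 < t := by have := ht.1; linarith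
      exact ((Phi_hasDeriv t).sub (Real.hasDerivAt_log this.ne')).continuousAt.continuousWithinAt
    · intro t ht
      have h0 : 0 < t := by have := ht.1; linarith
      have h2 : prof t - t⁻¹ = 0 := by
        rw [prof, Real.smoothTransition.one_of_one_le (by have := ht.1; linarith)]; simp
      have := ((Phi_hasDeriv t).sub (Real.hasDerivAt_log h0.ne')).hasDerivWithinAt (s := Ici t)
      rw [h2] at this
      exact this
  exact this y ⟨hxy, le_rfl⟩

lemma Phi_zero (x : ℝ) (hx : x ≤ 1) : Phi x = 0 := by
  unfold Phi
  rw [intervalIntegral.integral_congr (g := fun _ => 0)]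
  · simp
  · intro t ht
    rw [uIcc_of_ge hx] at ht
    simp [prof, Real.smoothTransition.zero_of_nonpos (by linarith [ht.2] : t - 1 ≤ 0)]

noncomputable def Psi (ξ : ℂ) : ℝ := Phi (normSq ξ)

lemma normSq_hasF (ξ : ℂ) : HasFDerivAt (fun w : ℂ => normSq w) ((2 * ξ.re) • reCLM + (2 * ξ.im) • imCLM) ξ := by
  have h1 : HasFDerivAt (fun w : ℂ => w.re) reCLM ξ := reCLM.hasFDerivAt
  have h2 : HasFDerivAt (fun w : ℂ => w.im) imCLM ξ := imCLM.hasFDerivAt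
  have := (h1.mul h1).add (h2.mul h2)
  refine (this.congr_fderiv ?_).congr_of_eventuallyEq (Eventually.of_forall fun w => by simp [normSq_apply])
  ext v
  simp; ring

lemma Psi_fderiv (ξ : ℂ) : HasFDerivAt Psi (prof (normSq ξ) • ((2 * ξ.re) • reCLM + (2 * ξ.im) • imCLM)) ξ :=
  (Phi_hasDeriv _).comp_hasFDerivAt ξ (normSq_hasF ξ)

lemma normSq_contDiff : ContDiff ℝ 2 (fun w : ℂ => normSq w) := by
  have h1 : ContDiff ℝ 2 (fun w : ℂ => w.re) := reCLM.contDiff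
  have h2 : ContDiff ℝ 2 (fun w : ℂ => w.im) := imCLM.contDiff
  simpa [normSq_apply] using (h1.mul h1).add (h2.mul h2)

lemma Psi_contDiff : ContDiff ℝ 2 Psi := Phi_contDiff.comp normSq_contDiff

lemma Psi_lap (ξ : ℂ) : lapC Psi ξ = 4 * deriv Real.smoothTransition (normSq ξ - 1) := by
  have e1 : (fun w => fderiv ℝ Psi w 1) = fun w => prof (normSq w) * (2 * w.re) := by
    ext w; rw [(Psi_fderiv w).fderiv]; simp
  have e2 : (fun w => fderiv ℝ Psi w I) = fun w => prof (normSq w) * (2 * w.im) := by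
    ext w; rw [(Psi_fderiv w).fderiv]; simp
  have hp : HasDerivAt prof (deriv prof (normSq ξ)) (normSq ξ) :=
    (prof_contDiff.differentiable (by norm_num) _).hasDerivAt
  have h1 : HasFDerivAt (fun w : ℂ => w.re) reCLM ξ := reCLM.hasFDerivAt
  have h2 : HasFDerivAt (fun w : ℂ => w.im) imCLM ξ := imCLM.hasFDerivAt
  have hc := hp.comp_hasFDerivAt ξ (normSq_hasF ξ)
  have d1 := hc.mul (h1.const_mul 2)
  have d2 := hc.mul (h2.const_mul 2)
  have key : deriv prof (normSq ξ) * normSq ξ + prof (normSq ξ) = deriv Real.smoothTransition (normSq ξ - 1) := by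
    have a1 := hp.mul (hasDerivAt_id (normSq ξ))
    have a2 : HasDerivAt (fun t => Real.smoothTransition (t - 1)) (deriv Real.smoothTransition (normSq ξ - 1)) (normSq ξ) := by
      have := (((Real.smoothTransition.contDiff (n := 1)).differentiable (by norm_num)) (normSq ξ - 1)).hasDerivAt
      simpa using this.comp_sub_const (normSq ξ) 1
    have a3 : (prof * id) = fun t => Real.smoothTransition (t - 1) := by
      ext t; exact prof_mul t
    rw [a3] at a1
    simpa using a1.unique a2
  unfold lapC
  rw [e1, e2]
  have d1' : HasFDerivAt (fun w : ℂ => prof (normSq w) * (2 * w.re)) _ ξ := d1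
  have d2' : HasFDerivAt (fun w : ℂ => prof (normSq w) * (2 * w.im)) _ ξ := d2
  rw [d1'.fderiv, d2'.fderiv, ← key]
  simp [normSq_apply]
  ring

lemma Psi_lap_nonneg (ξ : ℂ) : 0 ≤ lapC Psi ξ := by
  rw [Psi_lap]
  have := Real.smoothTransition.monotone.deriv_nonneg (x := normSq ξ - 1)
  linarith

lemma Psi_lap_inner (ξ : ℂ) (h : ‖ξ‖ < 1) : lapC Psi ξ = 0 := by
  rw [Psi_lap, Filter.EventuallyEq.deriv_eq (f := fun _ => 0)]
  · simp
  · have : normSq ξ - 1 < 0 := by rw [normSq_eq_norm_sq]; nlinarith [norm_nonneg ξ]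
    filter_upwards [Iio_mem_nhds this] with x hx
    exact Real.smoothTransition.zero_of_nonpos (le_of_lt hx)

lemma Psi_lap_outer (ξ : ℂ) (h : 2 ≤ ‖ξ‖) : lapC Psi ξ = 0 := by
  rw [Psi_lap, Filter.EventuallyEq.deriv_eq (f := fun _ => 1)]
  · simp
  · have : 1 < normSq ξ - 1 := by rw [normSq_eq_norm_sq]; nlinarith [norm_nonneg ξ]
    filter_upwards [Ioi_mem_nhds this] with x hx
    exact Real.smoothTransition.one_of_one_le (le_of_lt hx)

lemma Psi_lap_ne : ∃ ξ, lapC Psi ξ ≠ 0 := by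
  by_contra! h
  have h0 : ∀ t ∈ Icc (0:ℝ) 1, Real.smoothTransition t = Real.smoothTransition 0 := by
    apply constant_of_has_deriv_right_zero
    · exact Real.smoothTransition.continuous.continuousOn
    · intro t ht
      have := h (Real.sqrt (t + 1))
      rw [Psi_lap, normSq_ofReal, Real.mul_self_sqrt (by linarith [ht.1])] at this
      have h3 : deriv Real.smoothTransition t = 0 := by simpa using this
      have := (((Real.smoothTransition.contDiff (n := 1)).differentiable (by norm_num)) t).hasDerivAt
      rw [h3] at this
      exact this.hasDerivWithinAt
  have := h0 1 (by simp)
  rw [Real.smoothTransition.one_of_one_le le_rfl, Real.smoothTransition.zero_of_nonpos le_rfl] at this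
  norm_num at this

lemma Psi_cut_nonneg (R ε : ℝ) (hε : 0 < ε) (hR : ε ≤ R) (ζ : ℂ) :
    0 ≤ Psi (R⁻¹ • ζ) - Psi (ε⁻¹ • ζ) + 2 * Real.log (R / ε) := by
  have hRp : 0 < R := hε.trans_le hR
  by_cases hζ : ζ = 0
  · subst hζ
    have := Real.log_nonneg ((one_le_div hε).2 hR)
    simp only [smul_zero]; linarith
  have n0 : 0 < normSq ζ := normSq_pos.2 hζ
  have e : ∀ a : ℝ, normSq (a • ζ) = a ^ 2 * normSq ζ := by
    intro a; simp [normSq_apply]; ring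
  have := Phi_mono ((R⁻¹)^2 * normSq ζ) ((ε⁻¹)^2 * normSq ζ) (by positivity) (by gcongr)
  rw [Real.log_mul (by positivity) n0.ne', Real.log_mul (by positivity) n0.ne', Real.log_pow, Real.log_pow, Real.log_inv, Real.log_inv] at this
  unfold Psi
  rw [e, e, Real.log_div hRp.ne' hε.ne']
  push_cast at this
  linarith

lemma Psi_cut_zero (R ε : ℝ) (hε : 0 < ε) (hR : ε ≤ R) (ζ : ℂ) (hζ : 2 * R ≤ ‖ζ‖):
    Psi (R⁻¹ • ζ) - Psi (ε⁻¹ • ζ) + 2 * Real.log (R / ε) = 0 := by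
  have hRp : 0 < R := hε.trans_le hR
  have hn : 0 < ‖ζ‖ := by linarith
  have n0 : 0 < normSq ζ := by rw [normSq_eq_norm_sq]; positivity
  have e : ∀ a : ℝ, normSq (a • ζ) = a ^ 2 * normSq ζ := by
    intro a; simp [normSq_apply]; ring
  have h2 : 2 ≤ (R⁻¹)^2 * normSq ζ := by
    rw [inv_pow, inv_mul_eq_div, le_div_iff₀ (by positivity), normSq_eq_norm_sq]; nlinarith
  have := Phi_eq ((R⁻¹)^2 * normSq ζ) ((ε⁻¹)^2 * normSq ζ) h2 (by gcongr)
  rw [Real.log_mul (by positivity) n0.ne', Real.log_mul (by positivity) n0.ne', Real.log_pow, Real.log_pow, Real.log_inv, Real.log_inv] at this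
  unfold Psi
  rw [e, e, Real.log_div hRp.ne' hε.ne']
  push_cast at this
  linarith



lemma cont_mul_cut (w k : ℂ → ℝ) (ρ : ℝ) (hρ : 2 < ρ) (hw : Continuous w)
    (h2 : ∀ ξ : ℂ, 2 ≤ ‖ξ‖ → w ξ = 0) (hk : ContinuousOn k (ball 0 ρ)) :
    Continuous (fun ξ => w ξ * k ξ) := by
  rw [continuous_iff_continuousAt]
  intro ξ
  by_cases h : ‖ξ‖ < ρ
  · exact hw.continuousAt.mul (hk.continuousAt (isOpen_ball.mem_nhds (by simpa using h)))
  · have : (fun ξ => w ξ * k ξ) =ᶠ[𝓝 ξ] fun _ => 0 := by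
      have h3 : 2 < ‖ξ‖ := by linarith
      filter_upwards [(isOpen_lt continuous_const continuous_norm).mem_nhds h3] with x hx
      have hx' : 2 < ‖x‖ := hx
      simp [h2 x hx'.le]
    exact (continuousAt_const.congr this.symm)

lemma cpt_of_cut (g : ℂ → ℝ) (h2 : ∀ ξ : ℂ, 2 ≤ ‖ξ‖ → g ξ = 0) : HasCompactSupport g := by
  refine HasCompactSupport.intro (isCompact_closedBall (0:ℂ) 2) ?_
  intro x hx
  apply h2
  have : ¬ ‖x‖ ≤ 2 := by simpa using hx
  linarith

lemma rot_int (g : ℂ → ℝ) (θ : ℝ) : ∫ ξ, g (ξ * exp (θ * I)) = ∫ ξ, g ξ := by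
  have h := (rotation (Circle.exp θ)).measurePreserving
  have h2 := h.integral_comp (rotation (Circle.exp θ)).toHomeomorph.measurableEmbedding g
  rw [← h2]
  congr 1
  ext ξ
  simp [rotation_apply, Circle.coe_exp, mul_comm]

lemma rot_avg (g : ℂ → ℝ) (hg : Continuous g) (h2 : ∀ ξ : ℂ, 2 ≤ ‖ξ‖ → g ξ = 0) :
    2 * Real.pi * ∫ ξ, g ξ = ∫ ξ, ∫ θ in (0:ℝ)..(2 * Real.pi), g (ξ * exp (θ * I)) ∧
    Integrable (fun ξ => ∫ θ in (0:ℝ)..(2 * Real.pi), g (ξ * exp (θ * I))) := by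
  have hpi := Real.pi_pos
  have cont : Continuous (fun p : ℝ × ℂ => g (p.2 * exp (p.1 * I))) := by fun_prop
  have int : Integrable (fun p : ℝ × ℂ => g (p.2 * exp (p.1 * I)))
      ((volume.restrict (Ioc 0 (2 * Real.pi))).prod volume) := by
    have e : (volume.restrict (Ioc 0 (2 * Real.pi))).prod (volume : Measure ℂ)
      = (volume.prod volume).restrict (Ioc 0 (2 * Real.pi) ×ˢ univ) := by
      rw [← Measure.prod_restrict, Measure.restrict_univ]
    rw [e]
    have h1 : IntegrableOn (fun p : ℝ × ℂ => g (p.2 * exp (p.1 * I)))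
        (Icc 0 (2 * Real.pi) ×ˢ closedBall (0:ℂ) 2) (volume.prod volume) :=
      cont.continuousOn.integrableOn_compact (isCompact_Icc.prod (isCompact_closedBall _ _))
    refine IntegrableOn.of_forall_sdiff_eq_zero h1 (measurableSet_Ioc.prod MeasurableSet.univ) ?_
    rintro ⟨t, ξ⟩ ⟨⟨ha, -⟩, hb⟩
    apply h2
    have hξ : ξ ∉ closedBall (0:ℂ) 2 := by
      intro hh
      exact hb ⟨⟨ha.1.le, ha.2⟩, hh⟩
    have : ¬ ‖ξ‖ ≤ 2 := by simpa using hξ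
    rw [norm_mul, norm_exp_ofReal_mul_I, mul_one]
    linarith
  have e1 : ∀ ξ : ℂ, ∫ θ in (0:ℝ)..(2 * Real.pi), g (ξ * exp (θ * I)) =
      ∫ θ in Ioc 0 (2 * Real.pi), g (ξ * exp (θ * I)) := fun ξ =>
    intervalIntegral.integral_of_le (by positivity)
  simp only [e1]
  refine ⟨?_, int.integral_prod_right⟩
  rw [← integral_integral_swap (f := fun (θ : ℝ) (ξ : ℂ) => g (ξ * exp (θ * I))) int]
  simp only [rot_int]
  simp [hpi.le]

lemma scale_int (w T : ℂ → ℝ) (a : ℝ) (ha : 0 < a) (ζ0 : ℂ) :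
    ∫ ζ, T ζ * (a ^ 2 * w (a • (ζ - ζ0))) = ∫ ξ, w ξ * T (ζ0 + a⁻¹ • ξ) := by
  have h1 := Measure.integral_comp_smul (volume : Measure ℂ) (fun ξ => w ξ * T (ζ0 + a⁻¹ • ξ)) a
  have h2 := integral_sub_right_eq_self (μ := volume) (fun η : ℂ => w (a • η) * T (ζ0 + a⁻¹ • a • η)) ζ0
  rw [finrank_real_complex, abs_of_pos (by positivity)] at h1
  rw [h1] at h2
  have : ∀ ζ : ℂ, T ζ * (a ^ 2 * w (a • (ζ - ζ0))) = a^2 * (w (a • (ζ - ζ0)) * T (ζ0 + a⁻¹ • a • (ζ - ζ0))) := by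
    intro ζ
    rw [inv_smul_smul₀ ha.ne']; ring_nf
  simp only [this]
  rw [integral_const_mul, h2, smul_eq_mul]
  field_simp

lemma lapC_sub_const (α β : ℂ → ℝ) (hα : ContDiff ℝ 2 α) (hβ : ContDiff ℝ 2 β) (c : ℝ) (ζ : ℂ) :
    lapC (fun w => α w - β w + c) ζ = lapC α ζ - lapC β ζ := by
  have e : ∀ v : ℂ, (fun w => fderiv ℝ (fun w => α w - β w + c) w v) = fun w => fderiv ℝ α w v - fderiv ℝ β w v := by
    intro v; ext w
    have := (((hα.differentiable (by norm_num) w).hasFDerivAt.sub (hβ.differentiable (by norm_num) w).hasFDerivAt).add_const c).fderiv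
    have h2 : fderiv ℝ (fun w => α w - β w + c) w = fderiv ℝ α w - fderiv ℝ β w := this
    rw [h2]; rfl
  have d : ∀ (γ : ℂ → ℝ), ContDiff ℝ 2 γ → ∀ v : ℂ, DifferentiableAt ℝ (fun w => fderiv ℝ γ w v) ζ := by
    intro γ hγ v
    have : ContDiff ℝ 1 (fderiv ℝ γ) := hγ.fderiv_right (by norm_num)
    exact (this.differentiable (by norm_num) ζ).clm_apply (differentiableAt_const v)
  unfold lapC
  rw [e, e, fderiv_fun_sub (d α hα 1) (d β hβ 1), fderiv_fun_sub (d α hα I) (d β hβ I)]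
  simp only [sub_apply]
  ring

lemma no_max (H T : ℂ → ℝ) (ζ0 : ℂ) (R0 δ : ℝ) (hR0 : 0 < R0) (hδ : 0 < δ)
    (hH : ContinuousOn H (ball ζ0 R0)) (hT : ContinuousOn T (ball ζ0 R0))
    (hm : ∀ c : ℂ, c ≠ 0 → ‖c‖ < R0 → H ζ0 + δ * ‖c‖ ^ 2 ≤
      (2 * Real.pi)⁻¹ * ∫ θ in (0:ℝ)..(2 * Real.pi), H (ζ0 + c * exp (θ * I)))
    (hw : ∀ χ : ℂ → ℝ, ContDiff ℝ 2 χ → (∀ ζ, 0 ≤ χ ζ) → HasCompactSupport χ →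
      tsupport χ ⊆ ball ζ0 R0 → 0 ≤ ∫ ζ, T ζ * lapC χ ζ)
    (hmax : ∀ ζ ∈ ball ζ0 R0, T ζ + H ζ ≤ T ζ0 + H ζ0) : False := by
  have hpi := Real.pi_pos
  set w := lapC Psi with hwdef
  have wc : Continuous w := lapC_continuous Psi Psi_contDiff
  have w0 : ∀ ξ, 0 ≤ w ξ := Psi_lap_nonneg
  have w2 : ∀ ξ : ℂ, 2 ≤ ‖ξ‖ → w ξ = 0 := Psi_lap_outer
  have wcs := cpt_of_cut w w2
  have wi : Integrable w := wc.integrable_of_hasCompactSupport wcs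
  have wpos : 0 < ∫ ξ, w ξ := by
    obtain ⟨ξ, hξ⟩ := Psi_lap_ne
    exact wc.integral_pos_of_hasCompactSupport_nonneg_nonzero wcs w0 hξ
  set R := R0 / 4 with hR
  have hRp : 0 < R := by positivity
  -- scaling continuity
  have kc : ∀ (K : ℂ → ℝ), ContinuousOn K (ball ζ0 R0) → ∀ a : ℝ, 0 < a → a ≤ R →
      ContinuousOn (fun ξ : ℂ => K (ζ0 + a • ξ)) (ball 0 4) := by
    intro K hK a ha haR
    refine hK.comp (by fun_prop) ?_
    intro ξ hξ
    have : ‖ξ‖ < 4 := by simpa using hξ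
    simp only [mem_ball, dist_eq_norm, add_sub_cancel_left, norm_smul, Real.norm_eq_abs, abs_of_pos ha]
    calc a * ‖ξ‖ ≤ R * ‖ξ‖ := by gcongr
      _ < R * 4 := by gcongr
      _ = R0 := by rw [hR]; ring
  have ki : ∀ (K : ℂ → ℝ), ContinuousOn K (ball ζ0 R0) → ∀ a : ℝ, 0 < a → a ≤ R →
      Integrable (fun ξ : ℂ => w ξ * K (ζ0 + a • ξ)) := by
    intro K hK a ha haR
    refine (cont_mul_cut w _ 4 (by norm_num) wc w2 (kc K hK a ha haR)).integrable_of_hasCompactSupport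
      (cpt_of_cut _ ?_)
    intro ξ hξ; simp [w2 ξ hξ]
  -- H part
  have hHpart : (H ζ0 + δ * R^2) * ∫ ξ, w ξ ≤ ∫ ξ, w ξ * H (ζ0 + R • ξ) := by
    obtain ⟨a1, a2⟩ := rot_avg (fun ξ => w ξ * H (ζ0 + R • ξ))
      (cont_mul_cut w _ 4 (by norm_num) wc w2 (kc H hH R hRp le_rfl)) (fun ξ hξ => by simp [w2 ξ hξ])
    have : 2 * Real.pi * ((H ζ0 + δ * R^2) * ∫ ξ, w ξ) ≤ 2 * Real.pi * ∫ ξ, w ξ * H (ζ0 + R • ξ) := by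
      rw [a1, ← integral_const_mul, ← integral_const_mul]
      refine integral_mono ((wi.const_mul _).const_mul _) a2 ?_
      intro ξ
      have hrad : ∀ θ : ℝ, w (ξ * exp (θ * I)) = w ξ := by
        intro θ
        simp only [hwdef, Psi_lap]
        rw [normSq_mul, normSq_eq_norm_sq (exp _), norm_exp_ofReal_mul_I]; simp
      simp only [hrad]
      rw [intervalIntegral.integral_const_mul]
      by_cases hξ1 : ‖ξ‖ < 1
      · have : w ξ = 0 := Psi_lap_inner ξ hξ1
        simp [this]
      by_cases hξ2 : 2 ≤ ‖ξ‖
      · simp [w2 ξ hξ2]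
      have n1 : 1 ≤ ‖ξ‖ := by linarith
      have n2 : ‖ξ‖ < 2 := by linarith
      have nc : ‖R • ξ‖ = R * ‖ξ‖ := by rw [norm_smul, Real.norm_eq_abs, abs_of_pos hRp]
      have := hm (R • ξ) (by rw [← norm_pos_iff, nc]; positivity) (by rw [nc]; nlinarith)
      rw [nc] at this
      have e : ∀ θ : ℝ, R • (ξ * exp (θ * I)) = R • ξ * exp (θ * I) := fun θ => (smul_mul_assoc _ _ _).symm
      simp only [e]
      rw [inv_mul_eq_div, le_div_iff₀ (by positivity)] at this
      have h5 : δ * R ^ 2 ≤ δ * (R * ‖ξ‖)^2 := by gcongr; nlinarith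
      have h6 := w0 ξ
      calc 2 * Real.pi * ((H ζ0 + δ * R ^ 2) * w ξ) = w ξ * ((H ζ0 + δ * R ^ 2) * (2 * Real.pi)) := by ring
        _ ≤ w ξ * ((H ζ0 + δ * (R * ‖ξ‖) ^ 2) * (2 * Real.pi)) := by gcongr
        _ ≤ _ := by gcongr
    exact le_of_mul_le_mul_left this (by positivity)
  -- choose ε
  have hT0 : ContinuousAt T ζ0 := hT.continuousAt (isOpen_ball.mem_nhds (mem_ball_self hR0))
  obtain ⟨d, hd, hTd⟩ := Metric.continuousAt_iff.1 hT0 (δ * R^2 / 2) (by positivity)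
  set ε := min R (d / 4) with hε
  have hεp : 0 < ε := by positivity
  have hεR : ε ≤ R := min_le_left _ _
  have hεd : ε ≤ d / 4 := min_le_right _ _
  have hTpart : (T ζ0 - δ * R^2 / 2) * ∫ ξ, w ξ ≤ ∫ ξ, w ξ * T (ζ0 + ε • ξ) := by
    rw [← integral_const_mul]
    refine integral_mono (wi.const_mul _) (ki T hT ε hεp hεR) ?_
    intro ξ
    by_cases hξ2 : 2 ≤ ‖ξ‖
    · simp [w2 ξ hξ2]
    have n2 : ‖ξ‖ < 2 := by linarith
    have h3 : dist (ζ0 + ε • ξ) ζ0 < d := by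
      simp only [dist_eq_norm, add_sub_cancel_left, norm_smul, Real.norm_eq_abs, abs_of_pos hεp]
      nlinarith [norm_nonneg ξ]
    have h4 := hTd h3
    rw [Real.dist_eq, abs_lt] at h4
    show (T ζ0 - δ * R^2 / 2) * w ξ ≤ w ξ * T (ζ0 + ε • ξ)
    rw [mul_comm]
    exact mul_le_mul_of_nonneg_left (by linarith [h4.1]) (w0 ξ)
  -- test function
  set α : ℂ → ℝ := fun ζ => Psi (R⁻¹ • (ζ - ζ0)) with hα
  set β : ℂ → ℝ := fun ζ => Psi (ε⁻¹ • (ζ - ζ0)) with hβ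
  have hαc : ContDiff ℝ 2 α := Psi_contDiff.comp (by fun_prop)
  have hβc : ContDiff ℝ 2 β := Psi_contDiff.comp (by fun_prop)
  set χ : ℂ → ℝ := fun ζ => α ζ - β ζ + 2 * Real.log (R / ε) with hχ
  have ts : tsupport χ ⊆ closedBall ζ0 (2 * R) := by
    refine closure_minimal ?_ isClosed_closedBall
    intro ζ hζ
    by_contra h
    apply hζ
    have : ¬ ‖ζ - ζ0‖ ≤ 2 * R := by simpa [dist_eq_norm] using h
    exact Psi_cut_zero R ε hεp hεR (ζ - ζ0) (by linarith)
  have hχ0 := hw χ ((hαc.sub hβc).add contDiff_const) (fun ζ => Psi_cut_nonneg R ε hεp hεR (ζ - ζ0))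
    ((isCompact_closedBall ζ0 (2*R)).of_isClosed_subset (isClosed_tsupport χ) ts)
    (ts.trans (closedBall_subset_ball (by rw [hR]; linarith)))
  have hlap : ∀ ζ, T ζ * lapC χ ζ = T ζ * ((R⁻¹)^2 * w (R⁻¹ • (ζ - ζ0))) - T ζ * ((ε⁻¹)^2 * w (ε⁻¹ • (ζ - ζ0))) := by
    intro ζ
    rw [hχ, lapC_sub_const α β hαc hβc, hα, hβ, lapC_scale Psi Psi_contDiff, lapC_scale Psi Psi_contDiff]
    ring
  have hInt : ∀ a : ℝ, 0 < a → a ≤ R → Integrable (fun ζ => T ζ * ((a⁻¹)^2 * w (a⁻¹ • (ζ - ζ0)))) := by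
    intro a ha haR
    have h1 := ki T hT a ha haR
    have h2 := ((integrable_comp_smul_iff volume (fun ξ : ℂ => w ξ * T (ζ0 + a • ξ)) (inv_ne_zero ha.ne')).2 h1).comp_sub_right ζ0
    refine (h2.const_mul ((a⁻¹)^2)).congr (Eventually.of_forall fun ζ => ?_)
    simp only [smul_inv_smul₀ ha.ne']
    ring_nf
  simp only [hlap] at hχ0
  rw [integral_sub (hInt R hRp le_rfl) (hInt ε hεp hεR), scale_int w T _ (inv_pos.2 hRp), scale_int w T _ (inv_pos.2 hεp), inv_inv, inv_inv] at hχ0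
  have hsum : ∫ ξ, w ξ * T (ζ0 + R • ξ) ≤ (T ζ0 + H ζ0) * (∫ ξ, w ξ) - ∫ ξ, w ξ * H (ζ0 + R • ξ) := by
    rw [← integral_const_mul, ← integral_sub (wi.const_mul _) (ki H hH R hRp le_rfl)]
    refine integral_mono (ki T hT R hRp le_rfl) ((wi.const_mul _).sub (ki H hH R hRp le_rfl)) ?_
    intro ξ
    by_cases hξ2 : 2 ≤ ‖ξ‖
    · simp [w2 ξ hξ2]
    have n2 : ‖ξ‖ < 2 := by linarith
    have := hmax (ζ0 + R • ξ) (by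
      simp only [mem_ball, dist_eq_norm, add_sub_cancel_left, norm_smul, Real.norm_eq_abs, abs_of_pos hRp]
      nlinarith [norm_nonneg ξ])
    have h6 := w0 ξ
    show w ξ * T (ζ0 + R • ξ) ≤ (T ζ0 + H ζ0) * w ξ - w ξ * H (ζ0 + R • ξ)
    nlinarith [mul_le_mul_of_nonneg_left this h6]
  have : 0 < δ * R^2 * ∫ ξ, w ξ := by positivity
  nlinarith



lemma mean_log (ζ0 c : ℂ) (hc : c ≠ 0) (h : ‖c‖ < ‖ζ0‖) :
    ∫ θ in (0:ℝ)..(2 * Real.pi), Real.log ‖ζ0 + c * exp (θ * I)‖ = 2 * Real.pi * Real.log ‖ζ0‖ := by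
  have hpi := Real.pi_pos
  have hcn : 0 < ‖c‖ := norm_pos_iff.2 hc
  have hcn' : (‖c‖ : ℂ) ≠ 0 := by exact_mod_cast hcn.ne'
  set u : ℂ := c / ‖c‖ with hu
  have nu : ‖u‖ = 1 := by simp [hu, hcn.ne']
  have hu0 : u ≠ 0 := by rw [← norm_pos_iff, nu]; norm_num
  have e := circleAverage_log_norm_sub_const_eq_log_radius_add_posLog (a := 0) (c := ζ0 / u) (R := ‖c‖) hcn.ne'
  rw [sub_zero, norm_div, nu, div_one, Real.posLog_eq_log, Real.log_mul (by positivity) (by linarith), Real.log_inv] at e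
  · rw [Real.circleAverage_def] at e
    have e2 : ∀ θ : ℝ, Real.log ‖circleMap (ζ0 / u) ‖c‖ θ - 0‖ = Real.log ‖ζ0 + c * exp (θ * I)‖ := by
      intro θ
      congr 1
      have : ζ0 + c * exp (θ * I) = u * circleMap (ζ0 / u) ‖c‖ θ := by
        rw [circleMap, mul_add, mul_div_cancel₀ _ hu0, ← mul_assoc]
        congr 2
        rw [hu]; field_simp
      rw [this, norm_mul, nu, one_mul, sub_zero]
    simp only [e2, smul_eq_mul] at e
    have : (∫ θ in (0:ℝ)..(2 * Real.pi), Real.log ‖ζ0 + c * exp (θ * I)‖) = 2 * Real.pi * ((2 * Real.pi)⁻¹ * ∫ θ in (0:ℝ)..(2 * Real.pi), Real.log ‖ζ0 + c * exp (θ * I)‖) := by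
      rw [← mul_assoc, mul_inv_cancel₀ (by positivity), one_mul]
    rw [this, e]; ring
  · rw [abs_of_nonneg (by positivity), inv_mul_eq_div, one_le_div hcn]
    exact h.le

lemma mean_sq (ζ0 c : ℂ) :
    ∫ θ in (0:ℝ)..(2 * Real.pi), ‖ζ0 + c * exp (θ * I)‖ ^ 2 = 2 * Real.pi * (‖ζ0‖ ^ 2 + ‖c‖ ^ 2) := by
  have e : ∀ θ : ℝ, ‖ζ0 + c * exp (θ * I)‖ ^ 2 = (‖ζ0‖ ^ 2 + ‖c‖ ^ 2) +
      (2 * (ζ0.re * c.re + ζ0.im * c.im) * Real.cos θ + 2 * (ζ0.im * c.re - ζ0.re * c.im) * Real.sin θ) := by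
    intro θ
    simp only [← normSq_eq_norm_sq, normSq_apply, exp_mul_I, ← ofReal_cos, ← ofReal_sin, add_re, add_im, mul_re, mul_im, ofReal_re, ofReal_im, I_re, I_im]
    have := Real.sin_sq_add_cos_sq θ
    linear_combination (c.re ^ 2 + c.im ^ 2) * this
  simp only [e]
  generalize ‖ζ0‖ ^ 2 + ‖c‖ ^ 2 = X
  rw [intervalIntegral.integral_add, intervalIntegral.integral_add, intervalIntegral.integral_const_mul, intervalIntegral.integral_const_mul]
  · simp
  all_goals exact Continuous.intervalIntegrable (by fun_prop) _ _

lemma circ_cont (H : ℂ → ℝ) (ζ0 c : ℂ) (R : ℝ) (hH : ContinuousOn H (ball ζ0 R)) (hc : ‖c‖ < R) :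
    Continuous (fun θ : ℝ => H (ζ0 + c * exp (θ * I))) := by
  refine hH.comp_continuous (by fun_prop) ?_
  intro θ
  simp [norm_exp_ofReal_mul_I, dist_eq_norm, hc]

lemma mean_H (k : ℂ → ℝ) (M δ : ℝ) (hM : 0 ≤ M) (ζ0 c : ℂ) (R : ℝ) (hk : ContinuousOn k (ball ζ0 R))
    (hc0 : c ≠ 0) (hc : ‖c‖ < R) (hR : R ≤ ‖ζ0‖)
    (hm : k ζ0 ≤ (2 * Real.pi)⁻¹ * ∫ θ in (0:ℝ)..(2 * Real.pi), k (ζ0 + c * exp (θ * I))) :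
    (M * k ζ0 - Real.log ‖ζ0‖ + δ * ‖ζ0‖ ^ 2) + δ * ‖c‖ ^ 2 ≤ (2 * Real.pi)⁻¹ *
      ∫ θ in (0:ℝ)..(2 * Real.pi), (M * k (ζ0 + c * exp (θ * I)) - Real.log ‖ζ0 + c * exp (θ * I)‖
        + δ * ‖ζ0 + c * exp (θ * I)‖ ^ 2) := by
  have hpi := Real.pi_pos
  have c1 := circ_cont k ζ0 c R hk hc
  have lc : ContinuousOn (fun ζ : ℂ => Real.log ‖ζ‖) (ball ζ0 R) := by
    refine continuous_norm.continuousOn.log ?_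
    intro ζ hζ h0
    have h0 : ζ = 0 := norm_eq_zero.1 h0
    subst h0
    simp only [mem_ball, dist_zero_left] at hζ
    linarith
  have c2 := circ_cont (fun ζ => Real.log ‖ζ‖) ζ0 c R lc hc
  have c3 : Continuous (fun θ : ℝ => δ * ‖ζ0 + c * exp (θ * I)‖ ^ 2) := by fun_prop
  have c4 : Continuous (fun θ : ℝ => M * k (ζ0 + c * exp (θ * I))) := continuous_const.mul c1
  have c5 : Continuous (fun θ : ℝ => M * k (ζ0 + c * exp (θ * I)) - Real.log ‖ζ0 + c * exp (θ * I)‖) := c4.sub c2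
  rw [intervalIntegral.integral_add (c5.intervalIntegrable _ _) (c3.intervalIntegrable _ _),
    intervalIntegral.integral_sub (c4.intervalIntegrable _ _) (c2.intervalIntegrable _ _),
    intervalIntegral.integral_const_mul, intervalIntegral.integral_const_mul, mean_sq, mean_log ζ0 c hc0 (by linarith)]
  have := mul_le_mul_of_nonneg_left hm hM
  have e : ∀ X : ℝ, (2 * Real.pi)⁻¹ * (M * X - 2 * Real.pi * Real.log ‖ζ0‖ + δ * (2 * Real.pi * (‖ζ0‖^2 + ‖c‖^2)))
    = M * ((2 * Real.pi)⁻¹ * X) - Real.log ‖ζ0‖ + δ * (‖ζ0‖^2 + ‖c‖^2) := by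
    intro X; field_simp
  rw [e]
  linarith



lemma T_weak {E : Type*} [NormedAddCommGroup E] [InnerProductSpace ℝ E] [FiniteDimensional ℝ E]
    (G : Set ℂ) (hG : IsOpen G) (F : ℂ → E) (W : Set E) (hW : IsOpen W)
    (hFW : MapsTo F G W) (J : E → E →L[ℝ] E) (hJ : ContDiffOn ℝ 1 J W)
    (hJ2 : ∀ y ∈ W, ∀ v, J y (J y v) = -v)
    (hF : ∀ ζ ∈ G, DifferentiableAt ℝ F ζ) (hFJ : ∀ ζ ∈ G, fderiv ℝ F ζ I = J (F ζ) (fderiv ℝ F ζ 1))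
    (he : LocallyIntegrableOn (fun ζ => ‖fderiv ℝ F ζ‖ ^ 2) G)
    (C δ C1 : ℝ) (hC : 0 ≤ C) (hC1 : 0 ≤ C1)
    (h1 : ∀ y ∈ W, ‖J y‖ ≤ C) (h2 : ∀ y ∈ W, ‖fderiv ℝ J y‖ ≤ C)
    (hδ : ∀ y ∈ W, ‖y‖ ≤ δ) (hCδ : 4 * C ^ 2 * δ ≤ 1)
    (q : E) (ϕ ϕ1 ϕ2 : ℝ → ℝ) (p0 : ∀ s, 0 ≤ s → ContDiffAt ℝ 2 ϕ s)
    (p1 : ∀ s, 0 ≤ s → HasDerivAt ϕ (ϕ1 s) s)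
    (p2 : ∀ s, 0 ≤ s → HasDerivAt ϕ1 (ϕ2 s) s)
    (p3 : ∀ y ∈ W, ∀ v, -C1 * ‖v‖ ^ 2 ≤ Lam J (BJ (J q)) q ϕ1 ϕ2 y v)
    (χ : ℂ → ℝ) (hχ : ContDiff ℝ 2 χ) (hχ0 : ∀ ζ, 0 ≤ χ ζ) (cχ : HasCompactSupport χ)
    (sχ : tsupport χ ⊆ G) :
    0 ≤ ∫ ζ, (ϕ (BJ (J q) (F ζ - q) (F ζ - q)) + C1 * ‖F ζ‖ ^ 2) * lapC χ ζ := by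
  obtain ⟨a1, a2⟩ := weak_Lam G hG F W hW hFW J hJ hJ2 hF hFJ he (BJ (J q)) (BJ_symm _) (BJ_nonneg _) q
    ϕ ϕ1 ϕ2 p0 p1 p2 χ hχ cχ sχ
  obtain ⟨b1, b2⟩ := weak_Lam G hG F W hW hFW J hJ hJ2 hF hFJ he (Bin E) (fun v w => by simp [Bin_apply, real_inner_comm])
    (fun v => by simp [Bin_apply]) 0 (fun s => s) (fun _ => 1) (fun _ => 0) (fun s _ => contDiffAt_id)
    (fun s _ => hasDerivAt_id s) (fun s _ => hasDerivAt_const s 1) χ hχ cχ sχ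
  have Fc : ContinuousOn F G := fun ζ hζ => (hF ζ hζ).continuousAt.continuousWithinAt
  have lc := lapC_continuous χ hχ
  have int : ∀ k : ℂ → ℝ, ContinuousOn k G → Integrable (fun ζ => k ζ * lapC χ ζ) := by
    intro k hk
    have : IntegrableOn (fun ζ => k ζ * lapC χ ζ) (tsupport χ) :=
      ((hk.mono sχ).mul lc.continuousOn).integrableOn_compact cχ
    rw [← integrableOn_univ]
    refine this.of_forall_sdiff_eq_zero MeasurableSet.univ ?_
    intro ζ hζ
    simp [lapC_zero χ ζ hζ.2]
  have c1 : ContinuousOn (fun ζ => ϕ (BJ (J q) (F ζ - q) (F ζ - q))) G := by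
    intro ζ hζ
    apply ContinuousAt.continuousWithinAt
    have hFζ := (hF ζ hζ).continuousAt
    have : ContinuousAt (fun ζ => BJ (J q) (F ζ - q) (F ζ - q)) ζ :=
      ((BJ (J q)).continuous.continuousAt.comp (hFζ.sub continuousAt_const)).clm_apply (hFζ.sub continuousAt_const)
    exact ContinuousAt.comp (g := ϕ) (p0 _ (BJ_nonneg _ _)).continuousAt this
  have c2 : ContinuousOn (fun ζ => C1 * ‖F ζ‖ ^ 2) G := continuousOn_const.mul (Fc.norm.pow 2)
  have e : ∀ ζ, (ϕ (BJ (J q) (F ζ - q) (F ζ - q)) + C1 * ‖F ζ‖ ^ 2) * lapC χ ζ =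
     ϕ (BJ (J q) (F ζ - q) (F ζ - q)) * lapC χ ζ + C1 * (Bin E (F ζ - 0) (F ζ - 0) * lapC χ ζ) := by
    intro ζ; rw [Bin_apply, sub_zero, real_inner_self_eq_norm_sq]; ring
  have i2 : Integrable (fun ζ => C1 * (Bin E (F ζ - 0) (F ζ - 0) * lapC χ ζ)) := by
    refine (int _ c2).congr (Eventually.of_forall fun ζ => ?_)
    simp only [Bin_apply, sub_zero, real_inner_self_eq_norm_sq]; ring
  simp only [e]
  rw [integral_add (int _ c1) i2, integral_const_mul, a2, b2, ← integral_const_mul,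
    ← integral_add a1 (b1.const_mul _)]
  refine integral_nonneg fun ζ => ?_
  show 0 ≤ _ + _
  by_cases hζ : ζ ∈ G
  · have y := hFW hζ
    have l1 := p3 (F ζ) y (fderiv ℝ F ζ 1)
    have l2 := Lam_sq J 0 (F ζ) (fderiv ℝ F ζ 1) C δ hC (h1 _ y) (h2 _ y) (by simpa using hδ _ y) hCδ
    have l3 := mul_le_mul_of_nonneg_left l2 hC1
    have := mul_nonneg (hχ0 ζ) (by linarith : 0 ≤ Lam J (BJ (J q)) q ϕ1 ϕ2 (F ζ) (fderiv ℝ F ζ 1) + C1 * Lam J (Bin E) 0 (fun _ => 1) (fun _ => 0) (F ζ) (fderiv ℝ F ζ 1))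
    linarith
  · have : χ ζ = 0 := image_eq_zero_of_notMem_tsupport (fun h => hζ (sχ h))
    simp [this]

set_option maxHeartbeats 2000000 in
/-- main pointwise estimate -/
lemma schwarz_pt {E : Type*} [NormedAddCommGroup E] [InnerProductSpace ℝ E] [FiniteDimensional ℝ E]
    (ε : ℝ) (hε : 0 < ε) (G : Set ℂ) (hG : IsOpen G) (hG1 : G ⊆ ball 0 1) (F : ℂ → E)
    (hFW : MapsTo F G (ball 0 ε)) (J : E → E →L[ℝ] E) (hJ : ContDiffOn ℝ 1 J (ball 0 ε))
    (hJ2 : ∀ y ∈ ball (0:E) ε, ∀ v, J y (J y v) = -v)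
    (hF : ∀ ζ ∈ G, DifferentiableAt ℝ F ζ) (hFJ : ∀ ζ ∈ G, fderiv ℝ F ζ I = J (F ζ) (fderiv ℝ F ζ 1))
    (C C1 κ A c L : ℝ) (hC : 0 ≤ C) (hC1 : 0 ≤ C1) (hκ : 0 < κ) (hκε : κ ≤ ε / 4) (hA : 0 ≤ A)
    (hc : 0 < c) (hL : 0 < L)
    (h1 : ∀ y ∈ ball (0:E) ε, ‖J y‖ ≤ C) (h2 : ∀ y ∈ ball (0:E) ε, ‖fderiv ℝ J y‖ ≤ C)
    (hCδ : 4 * C ^ 2 * (2 * ε) ≤ 1)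
    (hphi : ∀ q ∈ ball (0:E) ε, ∀ τ : ℝ, 0 < τ →
      ∃ ϕ ϕ1 ϕ2 : ℝ → ℝ, (∀ s, 0 ≤ s → ContDiffAt ℝ 2 ϕ s) ∧
        (∀ s, 0 ≤ s → HasDerivAt ϕ (ϕ1 s) s) ∧ (∀ s, 0 ≤ s → HasDerivAt ϕ1 (ϕ2 s) s) ∧
        (∀ s, ϕ s ≤ 0) ∧ (∀ s, κ ^ 2 ≤ s → ϕ s = 0) ∧
        (∀ s, ϕ s ≤ 2 * Real.log √(s + τ ^ 2) + A * √(s + τ ^ 2) - 2 * Real.log κ + 1) ∧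
        (∀ s, min (2 * Real.log √(s + τ ^ 2) - 2 * Real.log κ) 0 ≤ ϕ s) ∧
        (∀ y ∈ ball (0:E) ε, ∀ v, -C1 * ‖v‖ ^ 2 ≤ Lam J (BJ (J q)) q ϕ1 ϕ2 y v))
    (h0G : (0:ℂ) ∈ G) (hq : ‖F 0‖ < ε / 4)
    (hout : ∀ ζ0 ∈ ball (0:ℂ) 1, ζ0 ∉ G → ∀ᶠ ζ in 𝓝 ζ0, ζ ∈ G → ε / 2 < ‖F ζ‖)
    (h : ℂ → ℝ) (hcont : ContinuousOn h (ball 0 1)) (hneg : ∀ ζ ∈ ball (0:ℂ) 1, h ζ ≤ 0)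
    (hlow : ∀ ζ ∈ G, -L ≤ h ζ)
    (hm1 : ∀ ζ0 a : ℂ, a ≠ 0 → ball ζ0 (2 * ‖a‖) ⊆ ball 0 1 →
      h ζ0 ≤ (2 * Real.pi)⁻¹ * ∫ θ in (0:ℝ)..(2 * Real.pi), h (ζ0 + a * exp (θ * I)))
    (hm2 : ∀ ζ0 a : ℂ, a ≠ 0 → ball ζ0 (2 * ‖a‖) ⊆ G →
      h ζ0 - c * ‖F ζ0‖ ^ 2 ≤ (2 * Real.pi)⁻¹ * ∫ θ in (0:ℝ)..(2 * Real.pi),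
        (h (ζ0 + a * exp (θ * I)) - c * ‖F (ζ0 + a * exp (θ * I))‖ ^ 2))
    (ζ1 : ℂ) (hζ1 : ζ1 ∈ G) (hζ10 : ζ1 ≠ 0) (hζ1s : ‖ζ1‖ < Real.exp (-(C1 / c * L)) / 16) :
    ‖F ζ1 - F 0‖ ≤ κ / 2 := by
  set q := F 0 with hqdef
  set W := ball (0:E) ε with hWd
  have hqW : q ∈ W := by simp only [hWd, mem_ball, dist_zero_right]; linarith
  set M := C1 / c with hM
  have hM0 : 0 ≤ M := by positivity
  have hMc : M * c = C1 := by rw [hM]; field_simp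
  have he : LocallyIntegrableOn (fun ζ => ‖fderiv ℝ F ζ‖ ^ 2) G := by
    refine energy_locInt G hG F W isOpen_ball hFW J hJ hJ2 hF hFJ C (2 * ε) hC h1 h2 ?_ hCδ
    intro y hy q hq
    have a1 : ‖y‖ < ε := by simpa [hWd] using hy
    have a2 : ‖q‖ < ε := by simpa [hWd] using hq
    have := norm_sub_le y q
    linarith
  have hWδ : ∀ y ∈ W, ‖y‖ ≤ 2 * ε := by
    intro y hy
    have a1 : ‖y‖ < ε := by simpa [hWd] using hy
    linarith
  have eML : Real.exp (-(M * L)) ≤ 1 := Real.exp_le_one_iff.2 (by have := mul_nonneg hM0 hL.le; linarith)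
  have n1 : ‖ζ1‖ < 1 / 16 := by linarith
  have n1p : 0 < ‖ζ1‖ := norm_pos_iff.2 hζ10
  have Fc : ∀ ζ ∈ G, ContinuousAt F ζ := fun ζ hζ => (hF ζ hζ).continuousAt
  -- Lipschitz bound at 0
  obtain ⟨k, hk0, hk⟩ : ∃ k : ℝ, 0 ≤ k ∧ ∀ᶠ ζ in 𝓝 (0:ℂ), ‖F ζ - q‖ ≤ k * ‖ζ‖ := by
    have := (hF 0 h0G).hasFDerivAt.isBigO_sub
    obtain ⟨k, hk⟩ := this.bound
    refine ⟨max k 0, le_max_right _ _, ?_⟩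
    filter_upwards [hk] with ζ hζ
    simp only [sub_zero] at hζ
    exact hζ.trans (by gcongr; exact le_max_left _ _)
  set K : ℝ := (1 + C) * k + 1 with hK
  have hKp : 0 < K := by positivity
  -- choose t
  obtain ⟨d, hd, hball⟩ := Metric.eventually_nhds_iff.1 (hk.and (hG.mem_nhds h0G))
  obtain ⟨t, ht0, htd, htζ, ht1, htlog⟩ : ∃ t : ℝ, 0 < t ∧ t < d ∧ t < ‖ζ1‖ ∧ t < 1 ∧
      Real.log t + (2 * Real.log K + A * K - 2 * Real.log κ + 1 + 1) ≤ 0 := by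
    have l1 : ∀ᶠ t in 𝓝[>] (0:ℝ), Real.log t ≤ -(2 * Real.log K + A * K - 2 * Real.log κ + 1 + 1) :=
      Real.tendsto_log_nhdsGT_zero.eventually_le_atBot _
    have l2 : ∀ r : ℝ, 0 < r → ∀ᶠ t in 𝓝[>] (0:ℝ), t < r := fun r hr =>
      mem_nhdsWithin_of_mem_nhds (Iio_mem_nhds hr)
    have l3 : ∀ᶠ t in 𝓝[>] (0:ℝ), 0 < t := self_mem_nhdsWithin
    obtain ⟨t, a1, a2, a3, a4, a5⟩ := (l1.and ((l2 d hd).and ((l2 _ n1p).and ((l2 1 one_pos).and l3)))).exists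
    exact ⟨t, a5, a2, a3, a4, by linarith⟩
  obtain ⟨ϕ, ϕ1, ϕ2, p0, p1, p2, pneg, pzero, pup, plow, pLam⟩ := hphi q hqW t ht0
  set sq : ℂ → ℝ := fun ζ => BJ (J q) (F ζ - q) (F ζ - q) with hsq
  have sq0 : ∀ ζ, 0 ≤ sq ζ := fun ζ => BJ_nonneg _ _
  have sqge : ∀ ζ, ‖F ζ - q‖ ^ 2 ≤ sq ζ := fun ζ => BJ_ge _ _
  have pc : ∀ ζ ∈ G, ContinuousAt (fun ζ => ϕ (sq ζ)) ζ := by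
    intro ζ hζ
    have hFζ := Fc ζ hζ
    have : ContinuousAt sq ζ :=
      ((BJ (J q)).continuous.continuousAt.comp (hFζ.sub continuousAt_const)).clm_apply (hFζ.sub continuousAt_const)
    exact ContinuousAt.comp (g := ϕ) (p0 _ (sq0 _)).continuousAt this
  classical
  set P : ℂ → ℝ := fun ζ => if ζ ∈ G then ϕ (sq ζ) else 0 with hP
  have PG : ∀ ζ ∈ G, P ζ = ϕ (sq ζ) := fun ζ hζ => by simp [hP, hζ]
  have Pneg : ∀ ζ, P ζ ≤ 0 := by
    intro ζ; simp only [hP]; split_ifs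
    · exact pneg _
    · exact le_rfl
  have Pout : ∀ ζ0 ∈ ball (0:ℂ) 1, ζ0 ∉ G → ∀ᶠ ζ in 𝓝 ζ0, P ζ = 0 := by
    intro ζ0 hζ0 hn
    filter_upwards [hout ζ0 hζ0 hn] with ζ hζ
    by_cases hg : ζ ∈ G
    · rw [PG ζ hg]
      apply pzero
      have a1 := hζ hg
      have a2 : ‖F ζ‖ ≤ ‖F ζ - q‖ + ‖q‖ := by simpa using norm_add_le (F ζ - q) q
      have a3 : κ ≤ ‖F ζ - q‖ := by linarith
      exact (by gcongr : κ ^ 2 ≤ ‖F ζ - q‖ ^ 2).trans (sqge ζ)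
    · simp [hP, hg]
  have Pc : ∀ ζ ∈ ball (0:ℂ) 1, ContinuousAt P ζ := by
    intro ζ hζ
    by_cases hg : ζ ∈ G
    · refine (pc ζ hg).congr ?_
      filter_upwards [hG.mem_nhds hg] with x hx
      exact (PG x hx).symm
    · exact (continuousAt_const (y := (0:ℝ))).congr ((Pout ζ hζ hg).mono fun x hx => hx.symm)
  set δ := Real.log 2 with hδ
  have hδp : 0 < δ := Real.log_pos (by norm_num)
  have hδ1 : δ ≤ 1 := by have := Real.log_two_lt_d9; linarith
  set S : ℂ → ℝ := fun ζ => P ζ + (M * h ζ - Real.log ‖ζ‖ + δ * ‖ζ‖ ^ 2) with hS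
  set An : Set ℂ := closedBall 0 (1/2) ∩ {ζ | t ≤ ‖ζ‖} with hAn
  have Anc : IsCompact An := (isCompact_closedBall 0 (1/2)).inter_right (isClosed_le continuous_const continuous_norm)
  have hζ1A : ζ1 ∈ An := ⟨by simp; linarith, htζ.le⟩
  have hcA : ∀ ζ ∈ ball (0:ℂ) 1, ContinuousAt h ζ := fun ζ hζ => hcont.continuousAt (isOpen_ball.mem_nhds hζ)
  have Sc : ContinuousOn S An := by
    intro ζ hζ
    have hb : ζ ∈ ball (0:ℂ) 1 := by
      have := hζ.1
      simp only [mem_closedBall, dist_zero_right] at this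
      simp only [mem_ball, dist_zero_right]; linarith
    have hz : t ≤ ‖ζ‖ := hζ.2
    apply ContinuousAt.continuousWithinAt
    exact (Pc ζ hb).add (((continuousAt_const.mul (hcA ζ hb)).sub (continuous_norm.continuousAt.log (by linarith))).add
      (continuousAt_const.mul (continuous_norm.continuousAt.pow 2)))
  obtain ⟨ζs, hζsA, hmax⟩ := Anc.exists_isMaxOn ⟨ζ1, hζ1A⟩ Sc
  have hmax' : ∀ ζ ∈ An, S ζ ≤ S ζs := fun ζ hζ => hmax hζ
  have hs2 : ‖ζs‖ ≤ 1/2 := by simpa using hζsA.1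
  have hs1 : t ≤ ‖ζs‖ := hζsA.2
  have hsb : ζs ∈ ball (0:ℂ) 1 := by simp only [mem_ball, dist_zero_right]; linarith
  -- the bound on S ζs
  have key : S ζs ≤ 2 * δ := by
    rcases hs2.eq_or_lt with hs2 | hs2
    · have a1 := Pneg ζs
      have a2 := mul_nonneg hM0 (neg_nonneg.2 (hneg ζs hsb))
      have a3 : Real.log (1/2) = -δ := by rw [hδ, one_div, Real.log_inv]
      simp only [hS]
      rw [hs2, a3]
      linarith
    rcases hs1.eq_or_lt with hs1 | hs1
    · have hb := hball (y := ζs) (by simpa [← hs1] using htd)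
      have a2 := mul_nonneg hM0 (neg_nonneg.2 (hneg ζs hsb))
      have a1 := pup (sq ζs)
      have b1 : √(sq ζs + t ^ 2) ≤ K * t := by
        rw [Real.sqrt_le_iff]
        refine ⟨by positivity, ?_⟩
        have := BJ_le (J q) (F ζs - q) C hC (h1 q hqW)
        have b2 : ‖F ζs - q‖ ≤ k * t := by rw [hs1]; exact hb.1
        have b3 : sq ζs ≤ (1 + C)^2 * (k * t)^2 := this.trans (by gcongr)
        have : 0 ≤ (1 + C) * k * t^2 := by positivity
        rw [hK]
        nlinarith
      have b0 : 0 < √(sq ζs + t ^ 2) := Real.sqrt_pos.2 (by have := sq0 ζs; positivity)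
      have b4 : Real.log √(sq ζs + t ^ 2) ≤ Real.log K + Real.log t := by
        rw [← Real.log_mul hKp.ne' ht0.ne']; exact Real.log_le_log b0 b1
      have b5 : A * √(sq ζs + t ^ 2) ≤ A * K := by
        gcongr; exact b1.trans (by nlinarith)
      simp only [hS]
      rw [PG ζs hb.2, ← hs1]
      have : δ * t^2 ≤ 1 := by nlinarith
      linarith
    · exfalso
      have opn : IsOpen ({ζ : ℂ | ‖ζ‖ < 1/2} ∩ {ζ | t < ‖ζ‖}) :=
        (isOpen_lt continuous_norm continuous_const).inter (isOpen_lt continuous_const continuous_norm)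
      have mem : ζs ∈ ({ζ : ℂ | ‖ζ‖ < 1/2} ∩ {ζ | t < ‖ζ‖}) := ⟨hs2, hs1⟩
      by_cases hg : ζs ∈ G
      · obtain ⟨r, hr, hrb⟩ := Metric.isOpen_iff.1 (opn.inter hG) ζs ⟨mem, hg⟩
        set R0 := min (r / 2) ‖ζs‖ with hR0
        have R0p : 0 < R0 := lt_min (by positivity) (by linarith)
        have R0r : R0 ≤ r / 2 := min_le_left _ _
        have sub : ball ζs R0 ⊆ ball ζs r := ball_subset_ball (by linarith)
        have kc : ContinuousOn (fun ζ => h ζ - c * ‖F ζ‖ ^ 2) (ball ζs R0) := by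
          intro ζ hζ
          have hgζ := (hrb (sub hζ)).2
          exact ((hcA ζ (hG1 hgζ)).sub (continuousAt_const.mul ((Fc ζ hgζ).norm.pow 2))).continuousWithinAt
        refine no_max (fun ζ => M * (h ζ - c * ‖F ζ‖ ^ 2) - Real.log ‖ζ‖ + δ * ‖ζ‖ ^ 2)
          (fun ζ => ϕ (sq ζ) + C1 * ‖F ζ‖ ^ 2) ζs R0 δ R0p hδp ?_ ?_ ?_ ?_ ?_
        · intro ζ hζ
          have hz : t < ‖ζ‖ := (hrb (sub hζ)).1.2
          exact ((continuousWithinAt_const.mul (kc ζ hζ)).sub (continuous_norm.continuousAt.log (by linarith)).continuousWithinAt).add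
            (continuousAt_const.mul (continuous_norm.continuousAt.pow 2)).continuousWithinAt
        · intro ζ hζ
          have hgζ := (hrb (sub hζ)).2
          exact ((pc ζ hgζ).add (continuousAt_const.mul ((Fc ζ hgζ).norm.pow 2))).continuousWithinAt
        · intro a ha0 ha
          refine mean_H (fun ζ => h ζ - c * ‖F ζ‖ ^ 2) M δ hM0 ζs a R0 kc ha0 ha (min_le_right _ _) ?_
          exact hm2 ζs a ha0 ((ball_subset_ball (by linarith)).trans (fun x hx => (hrb hx).2))
        · intro χ c1 c2 c3 c4
          exact T_weak G hG F W isOpen_ball hFW J hJ hJ2 hF hFJ he C (2 * ε) C1 hC hC1 h1 h2 hWδ hCδ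
            q ϕ ϕ1 ϕ2 p0 p1 p2 pLam χ c1 c2 c3 (c4.trans (sub.trans fun x hx => (hrb hx).2))
        · intro ζ hζ
          have hx := hrb (sub hζ)
          have hx1 : ‖ζ‖ < 1/2 := hx.1.1
          have hx2 : t < ‖ζ‖ := hx.1.2
          have := hmax' ζ ⟨by simpa using hx1.le, hx2.le⟩
          simp only [hS] at this
          rw [PG ζ hx.2, PG ζs hg] at this
          have e1 : M * (h ζ - c * ‖F ζ‖ ^ 2) = M * h ζ - C1 * ‖F ζ‖^2 := by rw [← hMc]; ring
          have e2 : M * (h ζs - c * ‖F ζs‖ ^ 2) = M * h ζs - C1 * ‖F ζs‖^2 := by rw [← hMc]; ring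
          simp only [e1, e2]
          linarith
      · obtain ⟨r, hr, hrb⟩ := Metric.eventually_nhds_iff_ball.1 ((opn.eventually_mem mem).and (Pout ζs hsb hg))
        set R0 := min (r / 2) ‖ζs‖ with hR0
        have R0p : 0 < R0 := lt_min (by positivity) (by linarith)
        have R0r : R0 ≤ r / 2 := min_le_left _ _
        have sub : ball ζs R0 ⊆ ball ζs r := ball_subset_ball (by linarith)
        have sb1 : ball ζs r ⊆ ball 0 1 := by
          intro x hx
          have : ‖x‖ < 1/2 := (hrb x hx).1.1
          simp only [mem_ball, dist_zero_right]; linarith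
        have kc : ContinuousOn h (ball ζs R0) := hcont.mono (sub.trans sb1)
        refine no_max (fun ζ => M * h ζ - Real.log ‖ζ‖ + δ * ‖ζ‖ ^ 2)
          (fun ζ => 0) ζs R0 δ R0p hδp ?_ continuousOn_const ?_ (fun χ _ _ _ _ => by simp) ?_
        · intro ζ hζ
          have hz : t < ‖ζ‖ := (hrb ζ (sub hζ)).1.2
          exact ((continuousWithinAt_const.mul (kc ζ hζ)).sub (continuous_norm.continuousAt.log (by linarith)).continuousWithinAt).add
            (continuousAt_const.mul (continuous_norm.continuousAt.pow 2)).continuousWithinAt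
        · intro a ha0 ha
          refine mean_H h M δ hM0 ζs a R0 kc ha0 ha (min_le_right _ _) ?_
          exact hm1 ζs a ha0 ((ball_subset_ball (by linarith)).trans sb1)
        · intro ζ hζ
          have hx := hrb ζ (sub hζ)
          have hx1 : ‖ζ‖ < 1/2 := hx.1.1
          have hx2 : t < ‖ζ‖ := hx.1.2
          have := hmax' ζ ⟨by simpa using hx1.le, hx2.le⟩
          simp only [hS] at this
          rw [hx.2, (hrb ζs (mem_ball_self hr)).2] at this
          exact this
  -- conclusion
  have fin := (hmax' ζ1 hζ1A).trans key
  simp only [hS] at fin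
  rw [PG ζ1 hζ1] at fin
  have lo := plow (sq ζ1)
  have hl := mul_le_mul_of_nonneg_left (hlow ζ1 hζ1) hM0
  have d0 : 0 ≤ δ * ‖ζ1‖ ^ 2 := by positivity
  have hlog : Real.log ‖ζ1‖ < -(M * L) - 4 * δ := by
    have a1 := Real.log_lt_log n1p hζ1s
    rw [Real.log_div (Real.exp_pos _).ne' (by norm_num), Real.log_exp] at a1
    have : Real.log 16 = 4 * δ := by
      rw [hδ, show (16:ℝ) = 2 ^ 4 by norm_num, Real.log_pow]; norm_num
    linarith
  have hmin : min (2 * Real.log √(sq ζ1 + t ^ 2) - 2 * Real.log κ) 0 < -(2 * δ) := by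
    refine lo.trans_lt ?_
    linarith
  have h3 : 2 * Real.log √(sq ζ1 + t ^ 2) - 2 * Real.log κ < -(2 * δ) := by
    rcases min_lt_iff.1 hmin with h | h
    · exact h
    · linarith
  have b0 : 0 < √(sq ζ1 + t ^ 2) := Real.sqrt_pos.2 (by have := sq0 ζ1; positivity)
  have h4 : √(sq ζ1 + t ^ 2) < κ / 2 := by
    rw [← Real.log_lt_log_iff b0 (by positivity), Real.log_div hκ.ne' (by norm_num)]
    linarith
  refine le_trans ?_ h4.le
  apply Real.le_sqrt_of_sq_le
  have := sqge ζ1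
  nlinarith



lemma conn_step {E : Type*} [NormedAddCommGroup E] (ε κ ρ : ℝ) (hρ : 0 < ρ) (hρ1 : ρ ≤ 1)
    (G : Set ℂ) (hG : IsOpen G) (F : ℂ → E) (hκε : κ ≤ ε / 4) (h0G : (0:ℂ) ∈ G) (hq : ‖F 0‖ < ε / 4)
    (hout : ∀ ζ0 ∈ ball (0:ℂ) 1, ζ0 ∉ G → ∀ᶠ ζ in 𝓝 ζ0, ζ ∈ G → ε / 2 < ‖F ζ‖)
    (hs : ∀ ζ ∈ G, ζ ≠ 0 → ‖ζ‖ < ρ → ‖F ζ - F 0‖ ≤ κ / 2) : ball 0 ρ ⊆ G := by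
  have hpre : IsPreconnected (ball (0:ℂ) ρ) := (convex_ball (0:ℂ) ρ).isPreconnected
  have hsub : ball (0:ℂ) ρ ⊆ G ∩ ball 0 ρ := by
    refine hpre.subset_of_closure_inter_subset (hG.inter isOpen_ball)
      ⟨0, mem_ball_self hρ, h0G, mem_ball_self hρ⟩ ?_
    rintro ζ0 ⟨hcl, hb⟩
    refine ⟨?_, hb⟩
    by_contra hn
    have e := hout ζ0 (ball_subset_ball hρ1 hb) hn
    rw [mem_closure_iff_frequently] at hcl
    obtain ⟨ζ, ⟨hζG, hζb⟩, hζ⟩ := (hcl.and_eventually e).exists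
    have h1 := hζ hζG
    have hn : ‖ζ‖ < ρ := by simpa using hζb
    by_cases h0 : ζ = 0
    · subst h0
      have := norm_nonneg (F 0)
      linarith
    · have h2 := hs ζ hζG h0 hn
      have h3 : ‖F ζ‖ ≤ ‖F ζ - F 0‖ + ‖F 0‖ := by simpa using norm_add_le (F ζ - F 0) (F 0)
      have := norm_nonneg (F 0)
      linarith
  exact fun x hx => (hsub hx).1

lemma loc_core {E : Type*} [NormedAddCommGroup E] [InnerProductSpace ℝ E] [FiniteDimensional ℝ E]
    (D Ω U : Set E) (hΩ : IsOpen Ω) (J : E → E →L[ℝ] E) (hJ : ContDiffOn ℝ (⊤ : ℕ∞) J Ω)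
    (hJ2 : ∀ x ∈ Ω, ∀ v, J x (J x v) = -v) (hDΩ : D ⊆ Ω)
    (p : E) (hp : p ∈ Ω) (hU : IsOpen U) (hpU : p ∈ U) (z w : E → E)
    (hz : ContDiffOn ℝ (⊤ : ℕ∞) z U) (hw : ContDiffOn ℝ (⊤ : ℕ∞) w (ball (0 : E) 1))
    (hzw : ∀ x ∈ U, w (z x) = x) (hwz : ∀ y ∈ ball (0 : E) 1, z (w y) = y)
    (hzU : MapsTo z U (ball (0 : E) 1))
    (hwU : MapsTo w (ball (0 : E) 1) U) (hzp : z p = 0)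
    (c L : ℝ) (hc : 0 < c) (hL : 0 < L) (u : E → ℝ) (hu : ContinuousOn u D)
    (huneg : ∀ x ∈ D, u x < 0) (huL : ∀ x ∈ D ∩ U, -L ≤ u x) :
    ∃ ε ρ : ℝ, 0 < ε ∧ ε < 1 ∧ 0 < ρ ∧ ρ ≤ 1 ∧ ∀ f : ℂ → E, MapsTo f (ball 0 1) D →
      (∀ ζ ∈ ball (0:ℂ) 1, DifferentiableAt ℝ f ζ) →
      (∀ ζ ∈ ball (0:ℂ) 1, fderiv ℝ f ζ I = J (f ζ) (fderiv ℝ f ζ 1)) →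
      (∀ ζ0 a : ℂ, a ≠ 0 → ball ζ0 (2 * ‖a‖) ⊆ ball 0 1 →
        u (f ζ0) ≤ (2 * Real.pi)⁻¹ * ∫ θ in (0:ℝ)..(2 * Real.pi), u (f (ζ0 + a * exp (θ * I)))) →
      (∀ ζ0 a : ℂ, a ≠ 0 → ball ζ0 (2 * ‖a‖) ⊆ ball 0 1 → MapsTo f (ball ζ0 (2 * ‖a‖)) U →
        u (f ζ0) - c * ‖z (f ζ0)‖ ^ 2 ≤ (2 * Real.pi)⁻¹ * ∫ θ in (0:ℝ)..(2 * Real.pi),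
          (u (f (ζ0 + a * exp (θ * I))) - c * ‖z (f (ζ0 + a * exp (θ * I)))‖ ^ 2)) →
      f 0 ∈ U → ‖z (f 0)‖ < ε / 4 → MapsTo f (ball 0 ρ) U := by
  have hw0 : w 0 = p := by rw [← hzp]; exact hzw p hpU
  have hwc : ContinuousOn w (ball 0 1) := hw.continuousOn
  have hzc : ContinuousOn z U := hz.continuousOn
  obtain ⟨ε1, hε1, hε1b⟩ : ∃ ε1 : ℝ, 0 < ε1 ∧ ball (0:E) ε1 ⊆ ball 0 1 ∩ w ⁻¹' Ω := by
    refine Metric.isOpen_iff.1 (hwc.isOpen_inter_preimage isOpen_ball hΩ) 0 ⟨mem_ball_self one_pos, ?_⟩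
    simpa [hw0] using hp
  set J' : E → E →L[ℝ] E := fun y => (fderiv ℝ z (w y)).comp ((J (w y)).comp (fderiv ℝ w y)) with hJ'
  have top1 : ((1:ℕ∞) : WithTop ℕ∞) + 1 ≤ ((⊤ : ℕ∞) : WithTop ℕ∞) := by
    exact_mod_cast (le_top : (1:ℕ∞) + 1 ≤ ⊤)
  have top0 : (1 : WithTop ℕ∞) ≤ ((⊤ : ℕ∞) : WithTop ℕ∞) := by
    exact_mod_cast (le_top : (1:ℕ∞) ≤ ⊤)
  have hdz : ContDiffOn ℝ 1 (fderiv ℝ z) U := hz.fderiv_of_isOpen hU top1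
  have hdw : ContDiffOn ℝ 1 (fderiv ℝ w) (ball 0 1) := hw.fderiv_of_isOpen isOpen_ball top1
  have hJ'c : ContDiffOn ℝ 1 J' (ball 0 ε1) := by
    have hw1 : ContDiffOn ℝ 1 w (ball 0 ε1) := (hw.of_le top0).mono fun y hy => (hε1b hy).1
    refine (hdz.comp hw1 (fun y hy => hwU (hε1b hy).1)).clm_comp
      (((hJ.of_le top0).comp hw1 (fun y hy => (hε1b hy).2)).clm_comp (hdw.mono fun y hy => (hε1b hy).1))
  have zd : ∀ x ∈ U, DifferentiableAt ℝ z x := fun x hx =>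
    (hz.contDiffAt (hU.mem_nhds hx)).differentiableAt (by simp)
  have wd : ∀ y ∈ ball (0:E) 1, DifferentiableAt ℝ w y := fun y hy =>
    (hw.contDiffAt (isOpen_ball.mem_nhds hy)).differentiableAt (by simp)
  have inv1 : ∀ x ∈ U, ∀ v, fderiv ℝ w (z x) (fderiv ℝ z x v) = v := by
    intro x hx v
    have h1 := (wd (z x) (hzU hx)).hasFDerivAt.comp x (zd x hx).hasFDerivAt
    have h2 : HasFDerivAt (w ∘ z) (ContinuousLinearMap.id ℝ E) x :=
      (hasFDerivAt_id x).congr_of_eventuallyEq (by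
        filter_upwards [hU.mem_nhds hx] with y hy
        exact hzw y hy)
    have := h1.unique h2
    exact DFunLike.congr_fun this v
  have hJ'2 : ∀ y ∈ ball (0:E) ε1, ∀ v, J' y (J' y v) = -v := by
    intro y hy v
    have hy1 := (hε1b hy).1
    have hyU := hwU hy1
    have e : ∀ v', fderiv ℝ w y (fderiv ℝ z (w y) v') = v' := by
      intro v'
      have := inv1 (w y) hyU v'
      rwa [hwz y hy1] at this
    have e2 : fderiv ℝ z (w y) (fderiv ℝ w y v) = v := by
      have h1 := (zd (w y) hyU).hasFDerivAt.comp y (wd y hy1).hasFDerivAt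
      have h2 : HasFDerivAt (z ∘ w) (ContinuousLinearMap.id ℝ E) y :=
        (hasFDerivAt_id y).congr_of_eventuallyEq (by
          filter_upwards [isOpen_ball.mem_nhds hy1] with y' hy'
          exact hwz y' hy')
      exact DFunLike.congr_fun (h1.unique h2) v
    simp only [hJ', ContinuousLinearMap.comp_apply, e]
    rw [hJ2 _ (hε1b hy).2, map_neg, e2]
  -- bounds
  have csub : closedBall (0:E) (ε1/2) ⊆ ball 0 ε1 := closedBall_subset_ball (by linarith)
  obtain ⟨Ca, hCa⟩ := (isCompact_closedBall (0:E) (ε1/2)).exists_bound_of_continuousOn (hJ'c.continuousOn.mono csub)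
  obtain ⟨Cb, hCb⟩ := (isCompact_closedBall (0:E) (ε1/2)).exists_bound_of_continuousOn
    ((hJ'c.continuousOn_fderiv_of_isOpen isOpen_ball le_rfl).mono csub)
  set C := max 0 (max Ca Cb) with hCdef
  have hC : 0 ≤ C := le_max_left _ _
  have hCaC : Ca ≤ C := (le_max_left _ _).trans (le_max_right _ _)
  have hCbC : Cb ≤ C := (le_max_right _ _).trans (le_max_right _ _)
  set ε := min (ε1/2) (min (1/2) (1 / (8 * C^2 + 8))) with hε
  have hεp : 0 < ε := by positivity
  have hεa : ε ≤ ε1/2 := min_le_left _ _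
  have hεb : ε ≤ 1/2 := (min_le_right _ _).trans (min_le_left _ _)
  have hεc : ε ≤ 1 / (8 * C^2 + 8) := (min_le_right _ _).trans (min_le_right _ _)
  have hWc : ball (0:E) ε ⊆ closedBall 0 (ε1/2) := (ball_subset_ball hεa).trans ball_subset_closedBall
  have hW1 : ball (0:E) ε ⊆ ball 0 ε1 := hWc.trans csub
  have b1 : ∀ y ∈ ball (0:E) ε, ‖J' y‖ ≤ C := fun y hy => (hCa y (hWc hy)).trans hCaC
  have b2 : ∀ y ∈ ball (0:E) ε, ‖fderiv ℝ J' y‖ ≤ C := fun y hy => (hCb y (hWc hy)).trans hCbC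
  have b3 : ∀ y ∈ ball (0:E) ε, ∀ q ∈ ball (0:E) ε, ‖J' y - J' q‖ ≤ C * ‖y - q‖ := by
    intro y hy q hq
    refine (convex_ball (0:E) ε).norm_image_sub_le_of_norm_fderiv_le (𝕜 := ℝ) ?_ b2 hq hy
    intro x hx
    exact (hJ'c.contDiffAt (isOpen_ball.mem_nhds (hW1 hx))).differentiableAt (by norm_num)
  have hCε : 4 * C ^ 2 * (2 * ε) ≤ 1 := by
    have : (8 * C^2 + 8) * ε ≤ 1 := by
      rw [le_div_iff₀ (by positivity)] at hεc; linarith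
    nlinarith
  obtain ⟨κ, C1, A, hκ, hκε, hC1, hA, hphi⟩ := exists_phi (ball (0:E) ε) J' C (ε / 4) hC (by positivity)
    (fun y hy => hJ'2 y (hW1 hy)) b1 b2 b3
  set ρ := Real.exp (-(C1 / c * L)) / 16 with hρ
  have hρp : 0 < ρ := by positivity
  have hρ1 : ρ ≤ 1 := by
    have : Real.exp (-(C1 / c * L)) ≤ 1 := Real.exp_le_one_iff.2 (by
      have : 0 ≤ C1 / c * L := by positivity
      linarith)
    rw [hρ]; linarith
  refine ⟨ε, ρ, hεp, by linarith, hρp, hρ1, ?_⟩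
  intro f hfD hfd hfJ hm1 hm2 hf0 hf0q
  have fc : ContinuousOn f (ball 0 1) := fun ζ hζ => (hfd ζ hζ).continuousAt.continuousWithinAt
  have Xo : IsOpen (U ∩ z ⁻¹' (ball 0 ε)) := hzc.isOpen_inter_preimage hU isOpen_ball
  set G : Set ℂ := ball 0 1 ∩ f ⁻¹' (U ∩ z ⁻¹' (ball 0 ε)) with hGd
  have hG : IsOpen G := fc.isOpen_inter_preimage isOpen_ball Xo
  have hX' : IsClosed (w '' closedBall (0:E) (ε/2)) :=
    ((isCompact_closedBall (0:E) (ε/2)).image_of_continuousOn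
      (hwc.mono (closedBall_subset_ball (by linarith)))).isClosed
  have h0G : (0:ℂ) ∈ G := by
    refine ⟨mem_ball_self one_pos, hf0, ?_⟩
    simp only [mem_preimage, mem_ball, dist_zero_right]; linarith
  have hout : ∀ ζ0 ∈ ball (0:ℂ) 1, ζ0 ∉ G → ∀ᶠ ζ in 𝓝 ζ0, ζ ∈ G → ε / 2 < ‖z (f ζ)‖ := by
    intro ζ0 hζ0 hn
    have hnot : f ζ0 ∉ w '' closedBall (0:E) (ε/2) := by
      rintro ⟨y, hy, hyf⟩
      apply hn
      have hy' : ‖y‖ ≤ ε/2 := by simpa using hy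
      have hy1 : y ∈ ball (0:E) 1 := by simp only [mem_ball, dist_zero_right]; linarith
      refine ⟨hζ0, ?_, ?_⟩
      · rw [← hyf]; exact hwU hy1
      · simp only [mem_preimage, ← hyf, hwz y hy1, mem_ball, dist_zero_right]; linarith
    filter_upwards [(hfd ζ0 hζ0).continuousAt.eventually_mem (hX'.isOpen_compl.mem_nhds hnot)] with ζ hζ hζG
    by_contra hle
    push Not at hle
    exact hζ ⟨z (f ζ), by simpa using hle, hzw _ hζG.2.1⟩
  have hF : ∀ ζ ∈ G, HasFDerivAt (fun ζ => z (f ζ)) ((fderiv ℝ z (f ζ)).comp (fderiv ℝ f ζ)) ζ :=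
    fun ζ hζ => (zd _ hζ.2.1).hasFDerivAt.comp ζ (hfd ζ hζ.1).hasFDerivAt
  have hFJ : ∀ ζ ∈ G, fderiv ℝ (fun ζ => z (f ζ)) ζ I =
      J' (z (f ζ)) (fderiv ℝ (fun ζ => z (f ζ)) ζ 1) := by
    intro ζ hζ
    rw [(hF ζ hζ).fderiv]
    simp only [hJ', ContinuousLinearMap.comp_apply, hzw _ hζ.2.1, inv1 _ hζ.2.1, hfJ ζ hζ.1]
  have hsub : ball 0 ρ ⊆ G := by
    refine conn_step ε κ ρ hρp hρ1 G hG (fun ζ => z (f ζ)) hκε h0G hf0q hout ?_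
    intro ζ1 hζ1 hne hlt
    exact schwarz_pt ε hεp G hG (fun x hx => hx.1) (fun ζ => z (f ζ)) (fun x hx => hx.2.2) J' (hJ'c.mono hW1)
      (fun y hy => hJ'2 y (hW1 hy)) (fun ζ hζ => (hF ζ hζ).differentiableAt) hFJ C C1 κ A c L hC hC1 hκ hκε hA
      hc hL b1 b2 hCε hphi h0G hf0q hout (fun ζ => u (f ζ)) (hu.comp fc hfD)
      (fun ζ hζ => (huneg _ (hfD hζ)).le) (fun ζ hζ => huL _ ⟨hfD hζ.1, hζ.2.1⟩) hm1
      (fun ζ0 a ha hb => hm2 ζ0 a ha (fun x hx => (hb hx).1) (fun x hx => (hb hx).2.1)) ζ1 hζ1 hne hlt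
  exact fun ζ hζ => (hsub hζ).2.1



lemma erealIntegral_cont (k : ℝ → ℝ) (hk : Continuous k) :
    erealIntegral (volume.restrict (Set.Ioc (0 : ℝ) (2 * Real.pi))) (fun θ => (k θ : EReal))
      = ((∫ θ in (0:ℝ)..(2 * Real.pi), k θ : ℝ) : EReal) := by
  have h2 : (0:ℝ) ≤ 2 * Real.pi := by positivity
  have hInt : Integrable k (volume.restrict (Set.Ioc (0 : ℝ) (2 * Real.pi))) := by
    have := hk.intervalIntegrable (μ := volume) 0 (2 * Real.pi)
    rwa [intervalIntegrable_iff_integrableOn_Ioc_of_le h2] at this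
  have e1 : ∀ x : ℝ, erealPos (x : EReal) = ENNReal.ofReal x := by
    intro x
    simp [erealPos]
  have e2 : ∀ x : ℝ, erealPos (-(x : EReal)) = ENNReal.ofReal (-x) := by
    intro x
    rw [← EReal.coe_neg, e1]
  have f1 : (∫⁻ x, ENNReal.ofReal (k x) ∂(volume.restrict (Set.Ioc (0 : ℝ) (2 * Real.pi)))) ≠ ⊤ :=
    hInt.lintegral_lt_top.ne
  have f2 : (∫⁻ x, ENNReal.ofReal (-k x) ∂(volume.restrict (Set.Ioc (0 : ℝ) (2 * Real.pi)))) ≠ ⊤ :=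
    hInt.neg.lintegral_lt_top.ne
  unfold erealIntegral
  simp only [e1, e2]
  rw [intervalIntegral.integral_of_le h2, integral_eq_lintegral_pos_part_sub_lintegral_neg_part hInt,
    EReal.coe_sub, EReal.coe_ennreal_toReal f1, EReal.coe_ennreal_toReal f2]

lemma JHolOn.cr {n : ℕ} {J : Cn n → Cn n →L[ℝ] Cn n} {f : ℂ → Cn n} {s : Set ℂ}
    (h : JHolOn J f s) (ζ : ℂ) (hζ : ζ ∈ s) : fderiv ℝ f ζ I = J (f ζ) (fderiv ℝ f ζ 1) := by
  have := DFunLike.congr_fun (h ζ hζ).2 1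
  simpa [JstdC] using this

lemma JDisc_affine {n : ℕ} (J : Cn n → Cn n →L[ℝ] Cn n) (D' : Set (Cn n)) (f : ℂ → Cn n)
    (hf : JHolOn J f unitDisc) (ζ0 b : ℂ) (hb : b ≠ 0) (hsub : ball ζ0 ‖b‖ ⊆ ball 0 1)
    (hm : MapsTo f (ball ζ0 ‖b‖) D') :
    JDisc J D' (fun ζ => f (ζ0 + b * ζ)) ∧ fderiv ℝ (fun ζ => f (ζ0 + b * ζ)) 0 1 = fderiv ℝ f ζ0 b := by
  have hb0 : 0 < ‖b‖ := norm_pos_iff.2 hb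
  have hin : ∀ ζ ∈ ball (0:ℂ) 1, ζ0 + b * ζ ∈ ball ζ0 ‖b‖ := by
    intro ζ hζ
    rw [mem_ball_zero_iff] at hζ
    rw [mem_ball_iff_norm, add_sub_cancel_left, norm_mul]
    nlinarith
  have hd : ∀ ζ ∈ ball (0:ℂ) 1, HasFDerivAt (fun ζ => f (ζ0 + b * ζ))
      ((fderiv ℝ f (ζ0 + b * ζ)).comp (b • ContinuousLinearMap.id ℝ ℂ)) ζ := by
    intro ζ hζ
    have h1 := (hf _ (hsub (hin ζ hζ))).1.hasFDerivAt
    have h2 : HasFDerivAt (fun ζ : ℂ => ζ0 + b * ζ) (b • ContinuousLinearMap.id ℝ ℂ) ζ :=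
      ((hasFDerivAt_id ζ).const_mul b).const_add ζ0
    exact h1.comp ζ h2
  refine ⟨⟨fun ζ hζ => hm (hin ζ hζ), ?_⟩, ?_⟩
  · intro ζ hζ
    refine ⟨(hd ζ hζ).differentiableAt, ?_⟩
    rw [(hd ζ hζ).fderiv]
    have h3 := (hf _ (hsub (hin ζ hζ))).2
    ext1 x
    have h4 := DFunLike.congr_fun h3 (b * x)
    simp only [ContinuousLinearMap.comp_apply, JstdC, ContinuousLinearMap.coe_restrictScalars',
      smul_apply, ContinuousLinearMap.id_apply, smul_eq_mul] at h4 ⊢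
    rw [← h4]
    congr 1
    ring
  · rw [(hd 0 (by simp)).fderiv]
    simp

lemma psh_mean {n : ℕ} (J : Cn n → Cn n →L[ℝ] Cn n) (D' : Set (Cn n)) (h : Cn n → ℝ)
    (hh : JPshOnR J D' h) (hc : ContinuousOn h D') (f : ℂ → Cn n)
    (hf : JHolOn J f unitDisc) (ζ0 a : ℂ) (ha : a ≠ 0) (hsub : ball ζ0 (2 * ‖a‖) ⊆ ball 0 1)
    (hm : MapsTo f (ball ζ0 (2 * ‖a‖)) D') :
    h (f ζ0) ≤ (2 * Real.pi)⁻¹ * ∫ θ in (0:ℝ)..(2 * Real.pi), h (f (ζ0 + a * exp (θ * I))) := by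
  have hn : ‖2 * a‖ = 2 * ‖a‖ := by simp
  have hd := (JDisc_affine J D' f hf ζ0 (2 * a) (by simpa using ha) (by rwa [hn]) (by rwa [hn])).1
  have h1 := (hh.2 _ hd).2 0 (1/2) (by norm_num)
    (closedBall_subset_ball (by norm_num))
  have hk : Continuous (fun θ : ℝ => h (f (ζ0 + a * exp (θ * I)))) := by
    refine circ_cont (fun ζ => h (f ζ)) ζ0 a (2 * ‖a‖) ?_ ?_
    · refine hc.comp (fun ζ hζ => ?_) hm
      exact (hf ζ (hsub hζ)).1.continuousAt.continuousWithinAt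
    · have := norm_pos_iff.2 ha
      linarith
  have h2 : (fun θ : ℝ => ((h (f (ζ0 + 2 * a * (0 + ((1/2 : ℝ) : ℂ) * exp (θ * I)))) : ℝ) : EReal))
      = fun θ : ℝ => ((h (f (ζ0 + a * exp (θ * I))) : ℝ) : EReal) := by
    funext θ
    congr 4
    push_cast
    ring
  rw [h2, erealIntegral_cont _ hk] at h1
  beta_reduce at h1
  rw [mul_zero, add_zero, ← EReal.coe_mul, EReal.coe_le_coe_iff] at h1
  exact h1

/-- **Localization principle for the Kobayashi–Royden metric** (Proposition 3.1.5):
`K_{(D,J)}(q,v) ≥ s K_{(D∩U,J)}(q,v)` for `q` in a suitable relatively compact neighborhood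
`V ⋐ U` of a point `p ∈ closure D`, under the stated plurisubharmonicity assumptions. -/
theorem kobayashi_localization {n : ℕ} (D : Set (Cn n)) (hDopen : IsOpen D)
    (hDconn : IsConnected D)
    (Ω : Set (Cn n)) (hΩ : IsOpen Ω) (hDΩ : closure D ⊆ Ω)
    (J : Cn n → Cn n →L[ℝ] Cn n) (hJ : IsACS Ω J)
    (p : Cn n) (hp : p ∈ closure D)
    (U : Set (Cn n)) (hU : IsOpen U) (hpU : p ∈ U)
    (z w : Cn n → Cn n)
    (hz : ContDiffOn ℝ (⊤ : ℕ∞) z U) (hw : ContDiffOn ℝ (⊤ : ℕ∞) w (Metric.ball (0 : Cn n) 1))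
    (hzw : ∀ x ∈ U, w (z x) = x) (hwz : ∀ y ∈ Metric.ball (0 : Cn n) 1, z (w y) = y)
    (hzU : MapsTo z U (Metric.ball (0 : Cn n) 1))
    (hwU : MapsTo w (Metric.ball (0 : Cn n) 1) U)
    (hzp : z p = 0)
    (r : ℝ) (hr0 : 0 < r) (hr1 : r < 1)
    (θr : ℝ → ℝ) (hθsmooth : ContDiff ℝ (⊤ : ℕ∞) θr) (hθmono : Monotone θr)
    (hθid : ∀ s : ℝ, s ≤ r / 3 → θr s = s) (hθone : ∀ s : ℝ, 2 * r / 3 ≤ s → θr s = 1)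
    (A B : ℝ) (hA : 0 < A) (hB : 0 < B)
    (hlogpsh : JPshOn J U (fun x =>
      if θr (‖z x‖ ^ 2) = 0 then (⊥ : EReal)
      else ((Real.log (θr (‖z x‖ ^ 2)) + θr (A * ‖z x‖) + B * ‖z x‖ ^ 2 : ℝ) : EReal)))
    (c L : ℝ) (hc : 0 < c) (hL : 0 < L)
    (u : Cn n → ℝ) (hu : ContDiffOn ℝ 2 u (closure D))
    (huneg : ∀ x ∈ D, u x < 0) (hupsh : JPshOnR J D u)
    (huL : ∀ x ∈ D ∩ U, -L ≤ u x)
    (hupsh2 : JPshOnR J (D ∩ U) (fun x => u x - c * ‖z x‖ ^ 2)) :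
    ∃ s : ℝ, 0 < s ∧ ∃ V : Set (Cn n), IsOpen V ∧ p ∈ V ∧
      closure V ⊆ U ∧ IsCompact (closure V) ∧
      ∀ q ∈ D ∩ V, ∀ v : Cn n, s * kobMetric J (D ∩ U) q v ≤ kobMetric J D q v := by
  have hDU : D ⊆ Ω := subset_closure.trans hDΩ
  have hJ2 : ∀ x ∈ Ω, ∀ v, J x (J x v) = -v := by
    intro x hx v
    simpa using DFunLike.congr_fun (hJ.2 x hx) v
  have huc : ContinuousOn u D := hu.continuousOn.mono subset_closure
  obtain ⟨ε, ρ, hε, hε1, hρ, hρ1, hmain⟩ := loc_core D Ω U hΩ J hJ.1 hJ2 hDU p (hDΩ hp) hU hpU z w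
    hz hw hzw hwz hzU hwU hzp c L hc hL u huc huneg huL
  have hcl : closedBall (0 : Cn n) (ε / 4) ⊆ ball 0 1 := closedBall_subset_ball (by linarith)
  have hK : IsCompact (w '' closedBall (0 : Cn n) (ε / 4)) :=
    (isCompact_closedBall _ _).image_of_continuousOn (hw.continuousOn.mono hcl)
  have hVK : closure (U ∩ z ⁻¹' ball 0 (ε / 4)) ⊆ w '' closedBall (0 : Cn n) (ε / 4) := by
    refine closure_minimal ?_ hK.isClosed
    rintro x ⟨hx, hx2⟩
    exact ⟨z x, ball_subset_closedBall hx2, hzw x hx⟩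
  have hKU : w '' closedBall (0 : Cn n) (ε / 4) ⊆ U := by
    rintro _ ⟨y, hy, rfl⟩
    exact hwU (hcl hy)
  refine ⟨ρ, hρ, U ∩ z ⁻¹' ball 0 (ε / 4), hz.continuousOn.isOpen_inter_preimage hU isOpen_ball,
    ⟨hpU, by simp [hzp, hε]⟩, hVK.trans hKU, hK.of_isClosed_subset isClosed_closure hVK, ?_⟩
  rintro q ⟨hqD, hqU, hqz⟩ v
  have hqz' : ‖z q‖ < ε / 4 := by simpa using hqz
  have hdisc : ∀ f : ℂ → Cn n, JDisc J D f → f 0 = q → MapsTo f (ball 0 ρ) U := by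
    intro f hf hfq
    refine hmain f hf.1 (fun ζ hζ => (hf.2 ζ hζ).1) (fun ζ hζ => hf.2.cr ζ hζ) ?_ ?_
      (by rwa [hfq]) (by rwa [hfq])
    · intro ζ0 a ha hsub
      exact psh_mean J D u hupsh huc f hf.2 ζ0 a ha hsub (hf.1.mono_left hsub)
    · intro ζ0 a ha hsub hmU
      refine psh_mean J (D ∩ U) (fun x => u x - c * ‖z x‖ ^ 2) hupsh2 ?_ f hf.2 ζ0 a ha hsub
        ((hf.1.mono_left hsub).inter hmU)
      have hzc : ContinuousOn z (D ∩ U) := hz.continuousOn.mono inter_subset_right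
      exact (huc.mono inter_subset_left).sub (continuousOn_const.mul (hzc.norm.pow 2))
  unfold kobMetric
  rcases Set.eq_empty_or_nonempty
    {α : ℝ | 0 < α ∧ ∃ f : ℂ → Cn n, JDisc J D f ∧ f 0 = q ∧ fderiv ℝ f 0 1 = α⁻¹ • v} with he | hne
  · have he2 : {α : ℝ | 0 < α ∧ ∃ f : ℂ → Cn n, JDisc J (D ∩ U) f ∧ f 0 = q ∧
        fderiv ℝ f 0 1 = α⁻¹ • v} = ∅ := by
      rw [Set.eq_empty_iff_forall_notMem] at he ⊢
      rintro α ⟨hα, f, hf, h1, h2⟩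
      exact he α ⟨hα, f, ⟨hf.1.mono_right inter_subset_left, hf.2⟩, h1, h2⟩
    rw [he, he2]
    simp
  · refine le_csInf hne ?_
    rintro α ⟨hα, f, hf, h1, h2⟩
    have hmU := hdisc f hf h1
    have hρn : ‖(ρ : ℂ)‖ = ρ := by simp [abs_of_pos hρ]
    have hsub : ball (0:ℂ) ‖(ρ : ℂ)‖ ⊆ ball 0 1 := ball_subset_ball (by rw [hρn]; exact hρ1)
    obtain ⟨hg, hg'⟩ := JDisc_affine J (D ∩ U) f hf.2 0 (ρ : ℂ) (by exact_mod_cast hρ.ne') hsub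
      ((hf.1.mono_left hsub).inter (by rwa [hρn]))
    have hle : sInf {α : ℝ | 0 < α ∧ ∃ f : ℂ → Cn n, JDisc J (D ∩ U) f ∧ f 0 = q ∧
        fderiv ℝ f 0 1 = α⁻¹ • v} ≤ α / ρ := by
      refine csInf_le ⟨0, fun x hx => hx.1.le⟩ ⟨by positivity, _, hg, by simpa using h1, ?_⟩
      have : (ρ : ℂ) = ρ • (1:ℂ) := by simp
      rw [hg', this, map_smul, h2, smul_smul]
      congr 1
      field_simp
    rw [le_div_iff₀ hρ] at hle
    linarith
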